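/- arXiv:1305.5953 — 5 statements merged into one kernel-verified Lean document; each statement's English description precedes it below -/
import Mathlib

section
/- Let L be a first-order language, M an L-structure, and n a natural number. A subset A ⊆ M^n is algebraic over M if and only if A is implicitly definable over M. -/
open FirstOrder Language

/-- The language with no function symbols and a single `n`-ary relation symbol `R`. -/
def relLang (n : ℕ) : FirstOrder.Language :=
  ⟨fun _ => Empty, fun m => PLift (m = n)⟩

/-- Given an `L`-structure `M` and a set `A ⊆ Mⁿ`, the `L'`-structure `⟨M, A⟩` expanding `M`,
where `L'` is `L` together with one new `n`-ary relation symbol interpreted as `A`. -/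
def expandedStructure {L : FirstOrder.Language} {M : Type*} [L.Structure M] (n : ℕ)
    (A : Set (Fin n → M)) : (L.sum (relLang n)).Structure M where
  funMap := fun f x =>
    match f with
    | Sum.inl f => Structure.funMap f x
    | Sum.inr f => f.elim
  RelMap := fun {m} r x =>
    match r with
    | Sum.inl r => Structure.RelMap r x
    | Sum.inr r => (fun i => x (Fin.cast r.down.symm i)) ∈ A

/-- `A ⊆ Mⁿ` is implicitly definable over `M`:  some sentence `ψ` of the expanded language,
with parameters from `M` (formalized as a formula whose free variables are indexed by `M`,
realized by the identity valuation), holds in `⟨M, A⟩`, and `A` is the unique subset of `Mⁿ`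
with this property. -/
def ImplicitlyDefinableOver {L : FirstOrder.Language} (M : Type*) [L.Structure M] (n : ℕ)
    (A : Set (Fin n → M)) : Prop :=
  ∃ ψ : (L.sum (relLang n)).Formula M,
    (letI := expandedStructure (L := L) n A; ψ.Realize (id : M → M)) ∧
    ∀ B : Set (Fin n → M), (letI := expandedStructure (L := L) n B; ψ.Realize (id : M → M)) → B = A

/-- `A ⊆ Mⁿ` is algebraic over `M`: some sentence `ψ` of the expanded language, with parameters
from `M`, holds in `⟨M, A⟩`, and only finitely many `B ⊆ Mⁿ` satisfy `ψ` in `⟨M, B⟩`. -/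
def AlgebraicOver {L : FirstOrder.Language} (M : Type*) [L.Structure M] (n : ℕ)
    (A : Set (Fin n → M)) : Prop :=
  ∃ ψ : (L.sum (relLang n)).Formula M,
    (letI := expandedStructure (L := L) n A; ψ.Realize (id : M → M)) ∧
    {B : Set (Fin n → M) | letI := expandedStructure (L := L) n B; ψ.Realize (id : M → M)}.Finite

/-- The sentence `ψ`, with parameters from `M`, holds in `⟨M, B⟩`. -/
def HoldsInExpansion {L : FirstOrder.Language} {M : Type*} [L.Structure M] {n : ℕ}
    (B : Set (Fin n → M)) (ψ : (L.sum (relLang n)).Formula M) : Prop :=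
  letI := expandedStructure (L := L) n B
  ψ.Realize (id : M → M)

/-- The atomic sentence `R(a)` for a tuple of parameters `a`. -/
def memFormula (L : FirstOrder.Language) {M : Type*} {n : ℕ} (a : Fin n → M) :
    (L.sum (relLang n)).Formula M :=
  Relations.formula (L := L.sum (relLang n)) (n := n) (Sum.inr ⟨rfl⟩) fun i => Term.var (a i)

namespace HoldsInExpansion

variable {L : FirstOrder.Language} {M : Type*} [L.Structure M] {n : ℕ}

theorem memFormula_iff (B : Set (Fin n → M)) (a : Fin n → M) :
    HoldsInExpansion B (memFormula L a) ↔ a ∈ B := by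
  let := expandedStructure (L := L) n B
  exact Formula.realize_rel

theorem not_iff (B : Set (Fin n → M)) (φ : (L.sum (relLang n)).Formula M) :
    HoldsInExpansion B φ.not ↔ ¬ HoldsInExpansion B φ :=
  Iff.rfl

theorem inf_iff (B : Set (Fin n → M)) (φ ψ : (L.sum (relLang n)).Formula M) :
    HoldsInExpansion B (φ ⊓ ψ) ↔ HoldsInExpansion B φ ∧ HoldsInExpansion B ψ := by
  let := expandedStructure (L := L) n B
  exact Formula.realize_inf

theorem top (B : Set (Fin n → M)) :
    HoldsInExpansion B (⊤ : (L.sum (relLang n)).Formula M) := by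
  let := expandedStructure (L := L) n B
  exact Formula.realize_top.2 trivial

/-- Distinct subsets of `Mⁿ` are separated by a sentence with parameters from `M`. -/
theorem exists_separating {A B : Set (Fin n → M)} (h : B ≠ A) :
    ∃ φ : (L.sum (relLang n)).Formula M, HoldsInExpansion A φ ∧ ¬ HoldsInExpansion B φ := by
  obtain ⟨a, ha⟩ : ∃ a, ¬ (a ∈ B ↔ a ∈ A) := by
    by_contra! hBA
    exact h (Set.ext hBA)
  by_cases haA : a ∈ A
  · refine ⟨memFormula L a, ?_⟩
    simp only [memFormula_iff]
    tauto
  · refine ⟨(memFormula L a).not, ?_⟩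
    simp only [not_iff, memFormula_iff]
    tauto

/-- A sentence with parameters from `M` isolates `A` from any finite family of subsets. -/
theorem exists_isolating (A : Set (Fin n → M)) {S : Set (Set (Fin n → M))} (hS : S.Finite) :
    ∃ φ : (L.sum (relLang n)).Formula M,
      HoldsInExpansion A φ ∧ ∀ B ∈ S, HoldsInExpansion B φ → B = A := by
  induction S, hS using Set.Finite.induction_on with
  | empty => exact ⟨⊤, top A, by simp⟩
  | @insert C S _ _ ih =>
    obtain ⟨φ, hA, hφ⟩ := ih
    by_cases hC : C = A
    · refine ⟨φ, hA, ?_⟩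
      rintro B (rfl | hB) h
      exacts [hC, hφ B hB h]
    · obtain ⟨χ, hχA, hχC⟩ := exists_separating (L := L) hC
      refine ⟨φ ⊓ χ, (inf_iff A φ χ).2 ⟨hA, hχA⟩, ?_⟩
      rintro B (rfl | hB) h
      exacts [absurd ((inf_iff _ φ χ).1 h).2 hχC, hφ B hB ((inf_iff _ φ χ).1 h).1]

end HoldsInExpansion

/-- A subset `A ⊆ Mⁿ` is algebraic over `M` if and only if it is implicitly definable over `M`. -/
theorem algebraicOver_iff_implicitlyDefinableOver {L : FirstOrder.Language} (M : Type*)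
    [L.Structure M] (n : ℕ) (A : Set (Fin n → M)) :
    AlgebraicOver (L := L) M n A ↔ ImplicitlyDefinableOver (L := L) M n A := by
  constructor
  · rintro ⟨ψ, hA, hfin⟩
    obtain ⟨φ, hφA, hφ⟩ := HoldsInExpansion.exists_isolating (L := L) A hfin
    refine ⟨ψ ⊓ φ, (HoldsInExpansion.inf_iff A ψ φ).2 ⟨hA, hφA⟩, fun B hB => ?_⟩
    obtain ⟨hψB, hφB⟩ := (HoldsInExpansion.inf_iff B ψ φ).1 hB
    exact hφ B hψB hφB
  · rintro ⟨ψ, hA, huniq⟩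
    exact ⟨ψ, hA, (Set.finite_singleton A).subset huniq⟩
end

section
/- Let L be a first-order language and M an L-structure such that some L-formula in two free variables without parameters defines a linear order on M. Then M is pointwise algebraic if and only if M is pointwise definable. -/
open FirstOrder Language

/-- An element `a` of `M` is definable without parameters: there is a formula `φ(x)`
without parameters such that `a` is the unique element of `M` satisfying `φ`. -/
def IsDefinableElement {L : FirstOrder.Language} {M : Type*} [L.Structure M] (a : M) : Prop :=
  ∃ φ : L.Formula (Fin 1), ∀ b : M, φ.Realize ![b] ↔ b = a

/-- An element `a` of `M` is algebraic without parameters: there is a formula `φ(x)` without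
parameters satisfied by `a` and by only finitely many elements of `M`. -/
def IsAlgebraicElement {L : FirstOrder.Language} {M : Type*} [L.Structure M] (a : M) : Prop :=
  ∃ φ : L.Formula (Fin 1), φ.Realize ![a] ∧ {b : M | φ.Realize ![b]}.Finite

/-- The formula stating that `x` satisfies `φ` and is `ρ`-below every element satisfying `φ`. -/
noncomputable def leastFormula {L : FirstOrder.Language} (ρ : L.Formula (Fin 2))
    (φ : L.Formula (Fin 1)) : L.Formula (Fin 1) :=
  φ ⊓ Formula.iAlls (Fin 1)
    ((φ.relabel Sum.inr).imp (ρ.relabel ![Sum.inl 0, Sum.inr 0]))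

theorem realize_leastFormula {L : FirstOrder.Language} {M : Type*} [L.Structure M]
    (ρ : L.Formula (Fin 2)) (φ : L.Formula (Fin 1)) (a : M) :
    (leastFormula ρ φ).Realize ![a] ↔
      φ.Realize ![a] ∧ ∀ b : M, φ.Realize ![b] → ρ.Realize ![a, b] := by
  have hφ (i : Fin 1 → M) : Sum.elim ![a] i ∘ Sum.inr = ![i 0] := by
    ext j; fin_cases j; rfl
  have hρ (i : Fin 1 → M) :
      Sum.elim ![a] i ∘ ![Sum.inl 0, Sum.inr 0] = ![a, i 0] := by
    ext j; fin_cases j <;> rfl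
  simp only [leastFormula, Formula.realize_inf, Formula.realize_iAlls, Formula.realize_imp,
    Formula.realize_relabel, hφ, hρ]
  exact and_congr_right fun _ => ⟨fun h b => h ![b], fun h i => h (i 0)⟩

theorem Set.Finite.exists_least_of_isLinearOrder {M : Type*} {r : M → M → Prop}
    (hr : IsLinearOrder M r) {s : Set M} (hs : s.Finite) (hne : s.Nonempty) :
    ∃ m ∈ s, ∀ b ∈ s, r m b := by
  let _ : PartialOrder M :=
    { le := r
      le_refl := hr.refl
      le_trans := hr.trans
      le_antisymm := hr.antisymm }
  obtain ⟨m, hm⟩ := hs.exists_minimal hne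
  exact ⟨m, hm.1, fun b hb => (hr.total m b).elim id fun h => hm.2 hb h⟩

/-- In a structure with a definable linear order, every algebraic element is definable. -/
theorem IsAlgebraicElement.isDefinableElement {L : FirstOrder.Language} {M : Type*}
    [L.Structure M] {ρ : L.Formula (Fin 2)}
    (hρ : IsLinearOrder M (fun a b : M => ρ.Realize ![a, b])) {a : M}
    (ha : IsAlgebraicElement (L := L) a) : IsDefinableElement (L := L) a := by
  obtain ⟨φ, hφa, hfin⟩ := ha
  induction hn : {b : M | φ.Realize ![b]}.ncard using Nat.strong_induction_on
    generalizing φ with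
  | _ n ih =>
  by_cases hleast : (leastFormula ρ φ).Realize ![a]
  · refine ⟨leastFormula ρ φ, fun b => ⟨fun hb => ?_, fun h => h ▸ hleast⟩⟩
    rw [realize_leastFormula] at hb hleast
    exact hρ.antisymm b a (hb.2 a hφa) (hleast.2 b hb.1)
  · obtain ⟨m, hm, hmin⟩ := hfin.exists_least_of_isLinearOrder hρ ⟨a, hφa⟩
    have hsub : {b : M | (φ ⊓ (leastFormula ρ φ).not).Realize ![b]} ⊂
        {b : M | φ.Realize ![b]} := by
      refine ⟨fun b hb => (Formula.realize_inf.1 hb).1, fun h => ?_⟩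
      exact Formula.realize_not.1 (Formula.realize_inf.1 (h hm)).2
        ((realize_leastFormula ρ φ m).2 ⟨hm, hmin⟩)
    exact ih _ (hn ▸ Set.ncard_lt_ncard hsub hfin) (φ ⊓ (leastFormula ρ φ).not)
      (Formula.realize_inf.2 ⟨hφa, Formula.realize_not.2 hleast⟩)
      (hfin.subset hsub.subset) rfl

/-- A definable element is algebraic. -/
theorem IsDefinableElement.isAlgebraicElement {L : FirstOrder.Language} {M : Type*}
    [L.Structure M] {a : M} (ha : IsDefinableElement (L := L) a) :
    IsAlgebraicElement (L := L) a := by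
  obtain ⟨φ, hφ⟩ := ha
  exact ⟨φ, (hφ a).2 rfl, (Set.finite_singleton a).subset fun b hb => (hφ b).1 hb⟩

/-- If some parameter-free formula in two free variables defines a linear order on `M`, then
`M` is pointwise algebraic if and only if it is pointwise definable. -/
theorem pointwise_algebraic_iff_pointwise_definable_of_definable_linear_order
    {L : FirstOrder.Language} {M : Type*} [L.Structure M]
    (ho : ∃ ρ : L.Formula (Fin 2), IsLinearOrder M (fun a b : M => ρ.Realize ![a, b])) :
    (∀ a : M, IsAlgebraicElement (L := L) a) ↔ (∀ a : M, IsDefinableElement (L := L) a) := by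
  obtain ⟨ρ, hρ⟩ := ho
  exact ⟨fun h a => (h a).isDefinableElement hρ, fun h a => (h a).isAlgebraicElement⟩
end

section
/- Every pointwise algebraic model of ZF is pointwise definable. That is, if M is a structure in the first-order language with a single binary relation symbol ∈ satisfying the ZF axioms, and every element of M is algebraic in M without parameters, then every element of M is definable in M without parameters. -/
open FirstOrder Language BoundedFormula

/-- The first-order language of set theory: a single binary relation symbol `∈`. -/
def setLang : FirstOrder.Language :=
  ⟨fun _ => Empty, fun n => PLift (n = 2)⟩

/-- The membership relation symbol of `setLang`. -/
def memRel : setLang.Relations 2 := PLift.up rfl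

/-- The atomic formula `t ∈ u`. -/
def memF {n : ℕ} (t u : setLang.Term (Empty ⊕ Fin n)) : setLang.BoundedFormula Empty n :=
  memRel.boundedFormula₂ t u

/-- The de Bruijn variable `xᵢ` at quantifier depth `n`. -/
def vr {n : ℕ} (i : ℕ) (h : i < n) : setLang.Term (Empty ⊕ Fin n) :=
  Term.var (Sum.inr ⟨i, h⟩)

/-- Extensionality: `∀x ∀y (∀z (z ∈ x ↔ z ∈ y) → x = y)`. -/
def extensionalityAx : setLang.Sentence :=
  ∀' ∀' ((∀' (memF (&2) (&0) ⇔ memF (&2) (&1))) ⟹ Term.bdEqual (&0) (&1))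

/-- Foundation: `∀x (∃y y ∈ x → ∃y (y ∈ x ∧ ∀z (z ∈ y → z ∉ x)))`. -/
def foundationAx : setLang.Sentence :=
  ∀' ((∃' memF (&1) (&0)) ⟹
    ∃' (memF (&1) (&0) ⊓ ∀' (memF (&2) (&1) ⟹ ∼(memF (&2) (&0)))))

/-- Pairing: `∀x ∀y ∃z ∀w (w ∈ z ↔ (w = x ∨ w = y))`. -/
def pairingAx : setLang.Sentence :=
  ∀' ∀' ∃' ∀' (memF (&3) (&2) ⇔ (Term.bdEqual (&3) (&0) ⊔ Term.bdEqual (&3) (&1)))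

/-- Union: `∀x ∃u ∀z (z ∈ u ↔ ∃y (y ∈ x ∧ z ∈ y))`. -/
def unionAx : setLang.Sentence :=
  ∀' ∃' ∀' (memF (&2) (&1) ⇔ ∃' (memF (&3) (&0) ⊓ memF (&2) (&3)))

/-- Power set: `∀x ∃p ∀z (z ∈ p ↔ ∀w (w ∈ z → w ∈ x))`. -/
def powersetAx : setLang.Sentence :=
  ∀' ∃' ∀' (memF (&2) (&1) ⇔ ∀' (memF (&3) (&2) ⟹ memF (&3) (&0)))

/-- Infinity: `∃x (∃e (e ∈ x ∧ ∀z z ∉ e) ∧ ∀y (y ∈ x → ∃s (s ∈ x ∧ ∀z (z ∈ s ↔ (z ∈ y ∨ z = y)))))`. -/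
def infinityAx : setLang.Sentence :=
  ∃' ((∃' (memF (&1) (&0) ⊓ ∀' ∼(memF (&2) (&1)))) ⊓
    ∀' (memF (&1) (&0) ⟹
      ∃' (memF (&2) (&0) ⊓ ∀' (memF (&3) (&2) ⇔ (memF (&3) (&1) ⊔ Term.bdEqual (&3) (&1))))))

/-- Separation instance for a formula `φ(p₀,…,pₙ₋₁,z)` (with `z` the variable of index `n`):
`∀p⃗ ∀x ∃y ∀z (z ∈ y ↔ (z ∈ x ∧ φ(p⃗,z)))`. -/
def separationAx {n : ℕ} (φ : setLang.BoundedFormula Empty (n + 1)) : setLang.Sentence :=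
  BoundedFormula.alls (∀' ∃' ∀'
    (memF (n := n + 3) (vr (n + 2) (by omega)) (vr (n + 1) (by omega)) ⇔
      (memF (n := n + 3) (vr (n + 2) (by omega)) (vr n (by omega)) ⊓ φ.liftAt 2 n)))

/-- Replacement instance for a formula `φ(p₀,…,pₙ₋₁,x,y)` (with `x`, `y` of indices `n`, `n+1`):
`∀p⃗ ∀a ((∀x (x ∈ a → ∃!y φ(p⃗,x,y))) → ∃b ∀x (x ∈ a → ∃y (y ∈ b ∧ φ(p⃗,x,y))))`. -/
def replacementAx {n : ℕ} (φ : setLang.BoundedFormula Empty (n + 2)) : setLang.Sentence :=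
  BoundedFormula.alls (∀'
    ((∀' (memF (n := n + 2) (vr (n + 1) (by omega)) (vr n (by omega)) ⟹
        ∃' (φ.liftAt 1 n ⊓
          ∀' ((φ.liftAt 1 n).liftAt 1 (n + 2) ⟹
            Term.bdEqual (vr (n := n + 4) (n + 3) (by omega)) (vr (n + 2) (by omega)))))) ⟹
      ∃' ∀' (memF (n := n + 3) (vr (n + 2) (by omega)) (vr n (by omega)) ⟹
        ∃' (memF (n := n + 4) (vr (n + 3) (by omega)) (vr (n + 1) (by omega)) ⊓
          φ.liftAt 2 n))))

/-- The ZF axioms: extensionality, foundation, pairing, union, power set, infinity, and all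
instances of the separation and replacement schemes. -/
def ZF : setLang.Theory :=
  {extensionalityAx, foundationAx, pairingAx, unionAx, powersetAx, infinityAx} ∪
    (⋃ n : ℕ, Set.range (separationAx (n := n))) ∪
    (⋃ n : ℕ, Set.range (replacementAx (n := n)))

namespace SetModel

variable {M : Type*} [setLang.Structure M]

/-- Membership in a structure for the language of set theory. -/
def Mem (a b : M) : Prop := Structure.RelMap memRel ![a, b]

local infix:50 "ε" => Mem

/-! ### Definable relations on environments -/

/-- Prepend a value to an environment. -/
def push (x : M) (v : ℕ → M) : ℕ → M
  | 0 => x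
  | n + 1 => v n

/-- A relation on environments that is defined by a formula without parameters. -/
class Def (P : (ℕ → M) → Prop) : Prop where
  out : ∃ φ : setLang.Formula ℕ, ∀ v, φ.Realize v ↔ P v

namespace Def

variable {P Q : (ℕ → M) → Prop}

instance mem (i j : ℕ) : Def (fun v : ℕ → M => v i ε v j) :=
  .mk ⟨memRel.formula₂ (Term.var i) (Term.var j), fun v => by simp [Mem]⟩

instance eq (i j : ℕ) : Def (fun v : ℕ → M => v i = v j) :=
  .mk ⟨(Term.var i).equal (Term.var j), fun v => by simp⟩

instance not [hP : Def P] : Def (fun v => ¬ P v) := by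
  obtain ⟨φ, hφ⟩ := hP.out
  exact .mk ⟨∼φ, fun v => by simp [hφ]⟩

instance imp [hP : Def P] [hQ : Def Q] : Def (fun v => P v → Q v) := by
  obtain ⟨φ, hφ⟩ := hP.out
  obtain ⟨ψ, hψ⟩ := hQ.out
  exact .mk ⟨φ ⟹ ψ, fun v => by simp [hφ, hψ]⟩

theorem congr (hP : Def P) (h : ∀ v, P v ↔ Q v) : Def Q := by
  obtain ⟨φ, hφ⟩ := hP.out
  exact .mk ⟨φ, fun v => (hφ v).trans (h v)⟩

instance and [hP : Def P] [hQ : Def Q] : Def (fun v => P v ∧ Q v) :=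
  congr (P := fun v => ¬ (P v → ¬ Q v)) inferInstance fun v => by tauto

instance or [hP : Def P] [hQ : Def Q] : Def (fun v => P v ∨ Q v) :=
  congr (P := fun v => ¬ P v → Q v) inferInstance fun v => by tauto

instance iff [hP : Def P] [hQ : Def Q] : Def (fun v => P v ↔ Q v) :=
  congr (P := fun v => (P v → Q v) ∧ (Q v → P v)) inferInstance fun v => by tauto

/-- Definable relations are closed under renaming of variables. -/
theorem rename (hP : Def P) (σ : ℕ → ℕ) : Def (fun v => P fun n => v (σ n)) := by
  obtain ⟨φ, hφ⟩ := hP.out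
  exact .mk ⟨φ.relabel σ, fun v => by rw [Formula.realize_relabel, hφ]; rfl⟩

/-- Definable relations are closed under existential quantification over finite tuples. -/
theorem exTuple {k : ℕ} {R : (ℕ → M) → (Fin k → M) → Prop}
    (h : Def fun w : ℕ → M => R (fun n => w (n + k)) fun i => w i) :
    Def (fun v => ∃ t, R v t) := by
  obtain ⟨φ, hφ⟩ := h.out
  refine .mk ⟨(φ.relabel fun n => if h : n < k then (Sum.inr ⟨n, h⟩ : ℕ ⊕ Fin k)
    else Sum.inl (n - k)).iExs (Fin k), fun v => ?_⟩
  rw [Formula.realize_iExs]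
  refine exists_congr fun t => ?_
  rw [Formula.realize_relabel, hφ]
  refine iff_of_eq (congrArg₂ R ?_ ?_)
  · funext n
    simp
  · funext i
    simp

instance ex {R : (ℕ → M) → M → Prop}
    [h : Def fun w : ℕ → M => R (fun n => w (n + 1)) (w 0)] :
    Def (fun v => ∃ x, R v x) :=
  (exTuple (k := 1) (R := fun v t => R v (t 0)) h).congr fun _ =>
    ⟨fun ⟨t, ht⟩ => ⟨t 0, ht⟩, fun ⟨x, hx⟩ => ⟨fun _ => x, hx⟩⟩

instance all {R : (ℕ → M) → M → Prop}
    [h : Def fun w : ℕ → M => R (fun n => w (n + 1)) (w 0)] :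
    Def (fun v => ∀ x, R v x) :=
  congr (P := fun v => ¬ ∃ x, ¬ R v x) inferInstance fun _ => by simp

end Def

/-- An element that is definable without parameters. -/
class Dfn (a : M) : Prop where
  out : Def fun v : ℕ → M => v 0 = a

/-- A function of the environment whose graph is definable. -/
class DefT (f : (ℕ → M) → M) : Prop where
  out : Def fun v : ℕ → M => v 0 = f fun n => v (n + 1)

namespace DefT

variable {f g : (ℕ → M) → M}

instance var (i : ℕ) : DefT (fun v : ℕ → M => v i) := ⟨inferInstance⟩

instance const (a : M) [h : Dfn a] : DefT (fun _ : ℕ → M => a) := ⟨h.out⟩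

theorem rel₂ (R : M → M → Prop) [hf : DefT f] [hg : DefT g]
    [hR : Def fun v : ℕ → M => R (v 0) (v 1)] : Def (fun v => R (f v) (g v)) := by
  have h₁ := hf.out.rename fun n => n + 1
  have h₂ := hg.out.rename fun n => if n = 0 then 0 else n + 1
  have h₃ := hR.rename fun n => if n = 0 then 1 else 0
  simp only [Nat.add_eq_zero_iff, one_ne_zero, and_false, if_false, if_true] at h₁ h₂ h₃
  exact Def.congr (P := fun v => ∃ x, ∃ y, x = f v ∧ y = g v ∧ R x y) inferInstance fun v => by simp

theorem map₂ (F : M → M → M) [hf : DefT f] [hg : DefT g]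
    [hF : Def fun v : ℕ → M => v 0 = F (v 1) (v 2)] : DefT (fun v => F (f v) (g v)) := by
  have h₁ := hf.out.rename fun n => if n = 0 then 1 else n + 2
  have h₂ := hg.out.rename fun n => if n = 0 then 0 else n + 2
  have h₃ := hF.rename fun n => if n = 0 then 2 else if n = 1 then 1 else 0
  simp only [Nat.add_eq_zero_iff, one_ne_zero, and_false, if_false, if_true, OfNat.ofNat_ne_zero,
    OfNat.ofNat_ne_one] at h₁ h₂ h₃
  exact ⟨Def.congr (P := fun v => ∃ x, ∃ y, x = f (fun n => v (n + 1)) ∧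
    y = g (fun n => v (n + 1)) ∧ v 0 = F x y) inferInstance fun v => by simp⟩

theorem map₁ (F : M → M) [hf : DefT f] [hF : Def fun v : ℕ → M => v 0 = F (v 1)] :
    DefT (fun v => F (f v)) :=
  have : Def fun v : ℕ → M => v 0 = (fun x _ => F x) (v 1) (v 2) := hF
  map₂ (fun x _ => F x) (g := f)

instance (priority := low) mem [DefT f] [DefT g] : Def (fun v => f v ε g v) := rel₂ Mem

instance (priority := low) eq [DefT f] [DefT g] : Def (fun v => f v = g v) := rel₂ Eq

end DefT

/-! ### Semantic form of the axioms -/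

variable (M) in
/-- The axioms of ZF, read off in a structure. -/
class IsZF : Prop where
  ext : ∀ x y : M, (∀ z, z ε x ↔ z ε y) → x = y
  found : ∀ x : M, (∃ y, y ε x) → ∃ y, y ε x ∧ ∀ z, z ε y → ¬ z ε x
  pair : ∀ x y : M, ∃ z, ∀ w, w ε z ↔ w = x ∨ w = y
  union : ∀ x : M, ∃ u, ∀ z, z ε u ↔ ∃ y, y ε x ∧ z ε y
  power : ∀ x : M, ∃ p, ∀ z, z ε p ↔ ∀ w, w ε z → w ε x
  inf : ∃ x : M, (∃ e, e ε x ∧ ∀ z, ¬ z ε e) ∧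
    ∀ y, y ε x → ∃ s, s ε x ∧ ∀ z, z ε s ↔ z ε y ∨ z = y
  sep : ∀ P : (ℕ → M) → Prop, Def P → ∀ v (x : M), ∃ y, ∀ z, z ε y ↔ z ε x ∧ P (push z v)
  repl : ∀ P : (ℕ → M) → Prop, Def P → ∀ v (a : M),
    (∀ x, x ε a → ∃! y, P (push y (push x v))) →
      ∃ b, ∀ x, x ε a → ∃ y, y ε b ∧ P (push y (push x v))

/-- A definable relation is given by a formula whose free variables are an initial segment of the
environment, listed as bound variables in an arbitrary way. -/
theorem Def.exists_boundedFormula {P : (ℕ → M) → Prop} (hP : Def P) :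
    ∃ n, ∀ m (σ : ℕ → Fin m), ∃ φ : setLang.BoundedFormula Empty m,
      ∀ (xs : Fin m → M) v, (∀ i < n, v i = xs (σ i)) → (φ.Realize default xs ↔ P v) := by
  obtain ⟨φ, hφ⟩ := hP.out
  refine ⟨φ.freeVarFinset.sup id + 1, fun m σ => ?_⟩
  refine ⟨BoundedFormula.relabel (fun i : Fin m => (Sum.inr i : Empty ⊕ Fin m))
    (φ.restrictFreeVar fun a => σ a : setLang.Formula (Fin m)), fun xs v hv => ?_⟩
  rw [Formula.realize_relabel_sumInr, ← hφ]
  refine realize_restrictFreeVar v fun a => (hv _ ?_).symm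
  exact Nat.lt_succ_of_le (Finset.le_sup (f := id) a.2)

theorem isZF_of_model (h : M ⊨ ZF) : IsZF M where
  ext := by
    have := h.realize_of_mem extensionalityAx (by simp [ZF])
    simpa [extensionalityAx, Sentence.Realize, Formula.Realize, memF, Fin.snoc, Mem] using this
  found := by
    have := h.realize_of_mem foundationAx (by simp [ZF])
    simpa [foundationAx, Sentence.Realize, Formula.Realize, memF, Fin.snoc, Mem] using this
  pair := by
    have := h.realize_of_mem pairingAx (by simp [ZF])
    simpa [pairingAx, Sentence.Realize, Formula.Realize, memF, Fin.snoc, Mem] using this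
  union := by
    have := h.realize_of_mem unionAx (by simp [ZF])
    simpa [unionAx, Sentence.Realize, Formula.Realize, memF, Fin.snoc, Mem] using this
  power := by
    have := h.realize_of_mem powersetAx (by simp [ZF])
    simpa [powersetAx, Sentence.Realize, Formula.Realize, memF, Fin.snoc, Mem] using this
  inf := by
    have := h.realize_of_mem infinityAx (by simp [ZF])
    simpa [infinityAx, Sentence.Realize, Formula.Realize, memF, Fin.snoc, Mem] using this
  sep P hP v x := by
    obtain ⟨n, hn⟩ := hP.exists_boundedFormula
    obtain ⟨φ, hφ⟩ := hn (n + 1) fun i => if i = 0 then Fin.last n else Fin.ofNat (n + 1) (i - 1)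
    have hφ' : ∀ (xs : Fin (n + 1) → M) z, xs (Fin.last n) = z →
        (∀ i (hi : i < n), xs ⟨i, by omega⟩ = v i) →
        (φ.Realize default xs ↔ P (push z v)) := by
      intro xs z hz hxs
      refine hφ _ _ fun i hi => ?_
      rcases i with _ | i
      · simp [push, hz]
      · have : i % (n + 1) = i := Nat.mod_eq_of_lt (by omega)
        simp [push, Fin.ofNat, this, hxs i (by omega)]
    have := h.realize_of_mem (separationAx φ)
      (Or.inl (Or.inr (Set.mem_iUnion.2 ⟨n, Set.mem_range_self φ⟩)))
    rw [separationAx, Sentence.Realize, realize_alls] at this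
    have := this (fun i => v i)
    simp only [realize_all, realize_ex, realize_iff, realize_inf, memF, vr, realize_rel₂,
      Term.realize_var, Sum.elim_inr, realize_liftAt (Nat.le_succ n)] at this
    obtain ⟨y, hy⟩ := this x
    refine ⟨y, fun z => ?_⟩
    rw [← hφ' _ z]
    · convert hy z using 1
      · simp [Fin.snoc, Mem]
      · congr!
        simp [Fin.snoc, Mem]
    · simp [Fin.snoc]
    · intro i hi
      simp [Fin.snoc, hi, hi.trans (Nat.lt_succ_self n), show i < n + 1 + 1 by omega]
  repl P hP v a := by
    obtain ⟨n, hn⟩ := hP.exists_boundedFormula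
    obtain ⟨φ, hφ⟩ := hn (n + 2) fun i => if i = 0 then Fin.last (n + 1) else
      if i = 1 then (Fin.last n).castSucc else Fin.ofNat (n + 2) (i - 2)
    have hφ' : ∀ (xs : Fin (n + 2) → M) x y, xs (Fin.last (n + 1)) = y →
        xs (Fin.last n).castSucc = x → (∀ i (hi : i < n), xs ⟨i, by omega⟩ = v i) →
        (φ.Realize default xs ↔ P (push y (push x v))) := by
      intro xs x y hy hx hxs
      refine hφ _ _ fun i hi => ?_
      rcases i with _ | _ | i
      · simp [push, hy]
      · simp [push, hx]
      · have : i % (n + 1 + 1) = i := Nat.mod_eq_of_lt (by omega)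
        simp [push, Fin.ofNat, this, hxs i (by omega)]
    have := h.realize_of_mem (replacementAx φ)
      (Or.inr (Set.mem_iUnion.2 ⟨n, Set.mem_range_self φ⟩))
    rw [replacementAx, Sentence.Realize, realize_alls] at this
    have := this (fun i => v i)
    simp only [realize_all, realize_ex, realize_imp, realize_inf, memF, vr, realize_rel₂,
      Term.realize_var, Sum.elim_inr, realize_bdEqual, realize_liftAt (show n ≤ n + 2 by omega),
      realize_liftAt (show n + 2 ≤ n + 2 + 1 by omega)] at this
    intro hfun
    obtain ⟨b, hb⟩ := this a fun x hx => by
      obtain ⟨y, hy, huniq⟩ := hfun x (by simpa [Fin.snoc, Mem] using hx)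
      refine ⟨y, (hφ' _ x y ?_ ?_ ?_).2 hy, fun z hz => ?_⟩
      · simp [Fin.snoc]
      · simp [Fin.snoc]
      · intro i hi
        simp [Fin.snoc, hi, show i < n + 1 by omega, show i < n + 1 + 1 by omega]
      · have := huniq z ((hφ' _ x z ?_ ?_ ?_).1 hz)
        · simpa [Fin.snoc] using this
        · simp [Fin.snoc]
        · simp [Fin.snoc]
        · intro i hi
          simp [Fin.snoc, hi, show i < n + 1 by omega, show i < n + 1 + 1 by omega,
            show i < n + 1 + 1 + 1 by omega]
    refine ⟨b, fun x hx => ?_⟩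
    obtain ⟨y, hy, hxy⟩ := hb x (by simpa [Fin.snoc, Mem] using hx)
    refine ⟨y, by simpa [Fin.snoc, Mem] using hy, (hφ' _ x y ?_ ?_ ?_).1 hxy⟩
    · simp [Fin.snoc]
    · simp [Fin.snoc]
    · intro i hi
      simp [Fin.snoc, hi, show i < n + 1 by omega, show i < n + 1 + 1 by omega,
        show i < n + 1 + 1 + 1 by omega]

section

variable [IsZF M]

/-! ### Elementary set theory in a model of ZF -/

theorem sep₁ (R : M → M → Prop) [h : Def fun v : ℕ → M => R (v 0) (v 1)] (a x : M) :
    ∃ y, ∀ z, z ε y ↔ z ε x ∧ R z a :=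
  IsZF.sep _ h (push a fun _ => a) x

theorem sep₂ (R : M → M → M → Prop) [h : Def fun v : ℕ → M => R (v 0) (v 1) (v 2)] (a b x : M) :
    ∃ y, ∀ z, z ε y ↔ z ε x ∧ R z a b :=
  IsZF.sep _ h (push a (push b fun _ => a)) x

theorem mem_asymm {a b : M} (h : a ε b) : ¬ b ε a := by
  obtain ⟨c, hc⟩ := IsZF.pair a b
  obtain ⟨y, hy, hd⟩ := IsZF.found c ⟨a, (hc a).2 (.inl rfl)⟩
  intro h'
  rcases (hc y).1 hy with rfl | rfl
  · exact hd b h' ((hc b).2 (.inr rfl))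
  · exact hd a h ((hc a).2 (.inl rfl))

theorem mem_irrefl (a : M) : ¬ a ε a := fun h => mem_asymm h h

theorem exists_emp : ∃ e : M, ∀ z, ¬ z ε e := by
  obtain ⟨x, ⟨e, -, he⟩, -⟩ := IsZF.inf (M := M)
  exact ⟨e, he⟩

variable (M) in
/-- The empty set. -/
noncomputable def emp : M := exists_emp.choose

theorem not_mem_emp (z : M) : ¬ z ε emp M := exists_emp.choose_spec z

theorem eq_emp {x : M} (h : ∀ z, ¬ z ε x) : x = emp M :=
  IsZF.ext _ _ fun z => iff_of_false (h z) (not_mem_emp z)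

instance : Dfn (emp M) :=
  ⟨Def.congr (P := fun v => ∀ z, ¬ z ε v 0) inferInstance fun _ =>
    ⟨eq_emp, fun h z => h ▸ not_mem_emp z⟩⟩

/-- The unordered pair. -/
noncomputable def upair (a b : M) : M := (IsZF.pair a b).choose

@[simp] theorem mem_upair {a b w : M} : w ε upair a b ↔ w = a ∨ w = b :=
  (IsZF.pair a b).choose_spec w

instance : Def fun v : ℕ → M => v 0 = upair (v 1) (v 2) :=
  Def.congr (P := fun v => ∀ z, z ε v 0 ↔ z = v 1 ∨ z = v 2) inferInstance fun v =>
    ⟨fun h => IsZF.ext _ _ fun z => (h z).trans mem_upair.symm, fun h z => by rw [h, mem_upair]⟩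

instance {f g : (ℕ → M) → M} [DefT f] [DefT g] : DefT fun v => upair (f v) (g v) :=
  DefT.map₂ upair

/-- The Kuratowski pair. -/
noncomputable def opair (a b : M) : M := upair (upair a a) (upair a b)

instance {f g : (ℕ → M) → M} [DefT f] [DefT g] : DefT fun v => opair (f v) (g v) := by
  unfold opair; infer_instance

theorem upair_inj_right {a b c : M} (h : upair a b = upair a c) : b = c := by
  have h₁ : b ε upair a c := h ▸ mem_upair.2 (.inr rfl)
  have h₂ : c ε upair a b := h ▸ mem_upair.2 (.inr rfl)
  rw [mem_upair] at h₁ h₂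
  grind

@[simp] theorem opair_inj {a b c d : M} : opair a b = opair c d ↔ a = c ∧ b = d := by
  refine ⟨fun h => ?_, fun h => by rw [h.1, h.2]⟩
  have hac : a = c := by
    have h₁ : upair c c ε opair a b := h ▸ mem_upair.2 (.inl rfl)
    rcases mem_upair.1 h₁ with h₂ | h₂
    · have : a ε upair c c := h₂ ▸ mem_upair.2 (.inl rfl)
      simpa using this
    · have : a ε upair c c := h₂ ▸ mem_upair.2 (.inl rfl)
      simpa using this
  subst hac
  exact ⟨rfl, upair_inj_right (upair_inj_right h)⟩

/-- The union of a set. -/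
noncomputable def sUnion (x : M) : M := (IsZF.union x).choose

@[simp] theorem mem_sUnion {x z : M} : z ε sUnion x ↔ ∃ y, y ε x ∧ z ε y :=
  (IsZF.union x).choose_spec z

instance : Def fun v : ℕ → M => v 0 = sUnion (v 1) :=
  Def.congr (P := fun v => ∀ z, z ε v 0 ↔ ∃ y, y ε v 1 ∧ z ε y) inferInstance fun v =>
    ⟨fun h => IsZF.ext _ _ fun z => (h z).trans mem_sUnion.symm, fun h z => by rw [h, mem_sUnion]⟩

instance {f : (ℕ → M) → M} [DefT f] : DefT fun v => sUnion (f v) := DefT.map₁ sUnion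

/-- The set `x ∪ {y}`. -/
noncomputable def insert (x y : M) : M := sUnion (upair x (upair y y))

@[simp] theorem mem_insert {x y z : M} : z ε insert x y ↔ z ε x ∨ z = y := by
  simp [insert]

instance {f g : (ℕ → M) → M} [DefT f] [DefT g] : DefT fun v => insert (f v) (g v) := by
  unfold insert; infer_instance

theorem insert_self_inj {m n : M} (h : insert m m = insert n n) : m = n := by
  have h₁ : m ε insert n n := h ▸ mem_insert.2 (.inr rfl)
  have h₂ : n ε insert m m := h ▸ mem_insert.2 (.inr rfl)
  rw [mem_insert] at h₁ h₂
  rcases h₁ with h₁ | h₁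
  · rcases h₂ with h₂ | h₂
    · exact (mem_asymm h₁ h₂).elim
    · exact h₂.symm
  · exact h₁

theorem insert_self_ne_emp (m : M) : insert m m ≠ emp M := fun h =>
  not_mem_emp m (h ▸ mem_insert.2 (.inr rfl))

/-! ### Transitive closures and induction -/

/-- `s` is the `n`-th iterated union of `{x}`. -/
def Stage (n s x : M) : Prop :=
  ∃ g, opair n s ε g ∧ ∀ q, q ε g → q = opair (emp M) (upair x x) ∨
    ∃ j t, opair j t ε g ∧ q = opair (insert j j) (sUnion t)

instance (i j k : ℕ) : Def fun v : ℕ → M => Stage (v i) (v j) (v k) := by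
  unfold Stage; infer_instance

theorem stage_emp {s x : M} : Stage (emp M) s x ↔ s = upair x x := by
  constructor
  · rintro ⟨g, hs, hg⟩
    rcases hg _ hs with h | ⟨j, t, -, h⟩
    · exact (opair_inj.1 h).2
    · exact (insert_self_ne_emp j (opair_inj.1 h).1.symm).elim
  · rintro rfl
    exact ⟨upair (opair (emp M) (upair x x)) (opair (emp M) (upair x x)), by simp, by simp⟩

theorem stage_succ {n s x : M} : Stage (insert n n) s x ↔ ∃ t, Stage n t x ∧ s = sUnion t := by
  constructor
  · rintro ⟨g, hs, hg⟩
    rcases hg _ hs with h | ⟨j, t, ht, h⟩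
    · exact (insert_self_ne_emp n (opair_inj.1 h).1).elim
    · obtain ⟨h₁, rfl⟩ := opair_inj.1 h
      obtain rfl := insert_self_inj h₁
      exact ⟨t, ⟨g, ht, hg⟩, rfl⟩
  · rintro ⟨t, ⟨g, ht, hg⟩, rfl⟩
    refine ⟨insert g (opair (insert n n) (sUnion t)), by simp, fun q hq => ?_⟩
    rcases mem_insert.1 hq with hq | rfl
    · rcases hg q hq with h | ⟨j, t, h, h'⟩
      · exact .inl h
      · exact .inr ⟨j, t, mem_insert.2 (.inl h), h'⟩
    · exact .inr ⟨n, t, mem_insert.2 (.inl ht), rfl⟩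

theorem exists_transitive (x : M) : ∃ A, x ε A ∧ ∀ y, y ε A → ∀ z, z ε y → z ε A := by
  obtain ⟨I, ⟨e, heI, he⟩, hI⟩ := IsZF.inf (M := M)
  obtain rfl := eq_emp he
  obtain ⟨J, hJ⟩ := sep₁ (fun n x : M => ∃ s, Stage n s x ∧ ∀ t, Stage n t x → t = s) x I
  obtain ⟨B, hB⟩ := IsZF.repl (fun v : ℕ → M => Stage (v 1) (v 0) (v 2)) inferInstance
    (fun _ => x) J fun n hn => ((hJ n).1 hn).2
  obtain ⟨C, hC⟩ := sep₂ (fun s J x : M => ∃ n, n ε J ∧ Stage n s x) J x B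
  have hJC : ∀ n s, n ε J → Stage n s x → s ε C := by
    intro n s hn hs
    obtain ⟨t, ht, hst⟩ := hB n hn
    obtain ⟨u, -, hu⟩ := ((hJ n).1 hn).2
    obtain rfl : s = t := (hu s hs).trans (hu t hst).symm
    exact (hC s).2 ⟨ht, n, hn, hs⟩
  refine ⟨sUnion C, mem_sUnion.2 ⟨upair x x, hJC (emp M) _ ?_ ?_, by simp⟩, ?_⟩
  · exact (hJ _).2 ⟨heI, _, stage_emp.2 rfl, fun t => stage_emp.1⟩
  · exact stage_emp.2 rfl
  · intro y hy z hz
    obtain ⟨s, hs, hys⟩ := mem_sUnion.1 hy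
    obtain ⟨-, n, hn, hns⟩ := (hC s).1 hs
    obtain ⟨hnI, u, -, hu⟩ := (hJ n).1 hn
    refine mem_sUnion.2 ⟨sUnion s, hJC (insert n n) _ ?_ (stage_succ.2 ⟨s, hns, rfl⟩),
      mem_sUnion.2 ⟨y, hys, hz⟩⟩
    obtain ⟨m, hm, hm'⟩ := hI n hnI
    obtain rfl : m = insert n n := IsZF.ext _ _ fun z => by rw [hm', mem_insert]
    refine (hJ _).2 ⟨hm, sUnion s, stage_succ.2 ⟨s, hns, rfl⟩, fun t ht => ?_⟩
    obtain ⟨t', ht', rfl⟩ := stage_succ.1 ht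
    rw [hu t' ht', hu s hns]

/-- Induction along membership for a class defined from parameters. -/
theorem mem_induction (P : (ℕ → M) → Prop) [hP : Def P] (v : ℕ → M)
    (h : ∀ x, (∀ y, y ε x → P (push y v)) → P (push x v)) (x : M) : P (push x v) := by
  by_contra hx
  obtain ⟨A, hxA, hA⟩ := exists_transitive x
  obtain ⟨B, hB⟩ := IsZF.sep (fun v => ¬ P v) inferInstance v A
  obtain ⟨y, hy, hmin⟩ := IsZF.found B ⟨x, (hB x).2 ⟨hxA, hx⟩⟩
  obtain ⟨hyA, hPy⟩ := (hB y).1 hy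
  exact hPy (h y fun z hz => by_contra fun hz' => hmin z hz ((hB z).2 ⟨hA y hyA z hz, hz'⟩))

theorem mem_induction₀ (P : M → Prop) [hP : Def fun v : ℕ → M => P (v 0)]
    (h : ∀ x, (∀ y, y ε x → P y) → P x) (x : M) : P x :=
  mem_induction (fun v => P (v 0)) (fun _ => x) h x

theorem mem_induction₂ (R : M → M → M → Prop) [hP : Def fun v : ℕ → M => R (v 0) (v 1) (v 2)]
    (a b : M) (h : ∀ x, (∀ y, y ε x → R y a b) → R x a b) (x : M) : R x a b :=
  mem_induction (fun v => R (v 0) (v 1) (v 2)) (push a (push b fun _ => x)) h x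

end

section

/-! ### Levels of the cumulative hierarchy -/

/-- The subset relation. -/
def Sub (x y : M) : Prop := ∀ z, z ε x → z ε y

instance {f g : (ℕ → M) → M} [DefT f] [DefT g] : Def fun v => Sub (f v) (g v) :=
  have : Def fun v : ℕ → M => Sub (v 0) (v 1) := by unfold Sub; infer_instance
  DefT.rel₂ Sub

theorem Sub.refl (x : M) : Sub x x := fun _ => id

/-- A set of levels of the cumulative hierarchy that is closed under earlier levels. -/
def History (h : M) : Prop := ∀ w, w ε h → ∀ x, x ε w ↔ ∃ u, u ε h ∧ u ε w ∧ Sub x u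

instance (i : ℕ) : Def fun v : ℕ → M => History (v i) := by unfold History; infer_instance

/-- The levels of the cumulative hierarchy. -/
def Level (w : M) : Prop := ∃ h, History h ∧ w ε h

instance (i : ℕ) : Def fun v : ℕ → M => Level (v i) := by unfold Level; infer_instance

theorem Level.mem_iff {w x : M} (hw : Level w) : x ε w ↔ ∃ u, Level u ∧ u ε w ∧ Sub x u := by
  obtain ⟨h, hh, hwh⟩ := hw
  constructor
  · intro hx
    obtain ⟨u, hu, huw, hxu⟩ := (hh w hwh x).1 hx
    exact ⟨u, ⟨h, hh, hu⟩, huw, hxu⟩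
  · rintro ⟨u, -, huw, hxu⟩
    obtain ⟨u', hu', huw', huu'⟩ := (hh w hwh u).1 huw
    exact (hh w hwh x).2 ⟨u', hu', huw', fun z hz => huu' z (hxu z hz)⟩

theorem Level.mem_of_sub {w x y : M} (hw : Level w) (hx : x ε w) (hy : Sub y x) : y ε w := by
  obtain ⟨u, hu, huw, hxu⟩ := hw.mem_iff.1 hx
  exact hw.mem_iff.2 ⟨u, hu, huw, fun z hz => hxu z (hy z hz)⟩

/-! ### Pointwise algebraic structures -/

variable (M) in
/-- Every element of the structure is algebraic without parameters. -/
class PointwiseAlgebraic : Prop where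
  out : ∀ a : M, ∃ P : M → Prop, Def (fun v : ℕ → M => P (v 0)) ∧ P a ∧ {b | P b}.Finite

/-- The type of an algebraic element is isolated. -/
theorem exists_isolating [PointwiseAlgebraic M] (a : M) :
    ∃ P : M → Prop, Def (fun v : ℕ → M => P (v 0)) ∧ P a ∧
    ∀ Q : M → Prop, Def (fun v : ℕ → M => Q (v 0)) → Q a → ∀ b, P b → Q b := by
  classical
  have hex : ∃ n, ∃ P : M → Prop, Def (fun v : ℕ → M => P (v 0)) ∧ P a ∧ {b | P b}.Finite ∧
      {b | P b}.ncard = n := by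
    obtain ⟨P, hP, ha, hfin⟩ := PointwiseAlgebraic.out a
    exact ⟨_, P, hP, ha, hfin, rfl⟩
  obtain ⟨P, hP, ha, hfin, hcard⟩ := Nat.find_spec hex
  refine ⟨P, hP, ha, fun Q hQ hQa b hb => by_contra fun hQb => ?_⟩
  have hsub : {b | P b ∧ Q b} ⊂ {b | P b} :=
    ⟨fun _ h => h.1, fun h => hQb (h hb).2⟩
  refine Nat.find_min hex (hcard ▸ Set.ncard_lt_ncard hsub hfin)
    ⟨fun x => P x ∧ Q x, inferInstance, ⟨ha, hQa⟩, hfin.subset hsub.1, rfl⟩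

variable [IsZF M]

/-! ### The cumulative hierarchy in a model of ZF -/

theorem Level.trans {w : M} (hw : Level w) : ∀ x, x ε w → Sub x w := by
  refine mem_induction₀ (fun w : M => Level w → ∀ x, x ε w → Sub x w) ?_ w hw
  intro w ih hw x hx y hy
  obtain ⟨u, hu, huw, hxu⟩ := hw.mem_iff.1 hx
  exact hw.mem_iff.2 ⟨u, hu, huw, ih u huw hu y (hxu y hy)⟩

theorem Level.trichotomy {a b : M} (ha : Level a) (hb : Level b) : a ε b ∨ a = b ∨ b ε a := by
  refine mem_induction₀ (fun a : M => Level a → ∀ b, Level b → a ε b ∨ a = b ∨ b ε a)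
    ?_ a ha b hb
  intro a iha ha b hb
  refine mem_induction₂ (fun b a _ : M => Level b → a ε b ∨ a = b ∨ b ε a) a a ?_ b hb
  intro b ihb hb
  by_contra! hab
  refine hab.2.1 (IsZF.ext _ _ fun x => ⟨fun hx => ?_, fun hx => ?_⟩)
  · obtain ⟨u, hu, hua, hxu⟩ := ha.mem_iff.1 hx
    rcases iha u hua hu b hb with h | rfl | h
    · exact hb.mem_of_sub h hxu
    · exact (hab.2.2 hua).elim
    · exact (hab.2.2 (ha.trans u hua b h)).elim
  · obtain ⟨u, hu, hub, hxu⟩ := hb.mem_iff.1 hx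
    rcases ihb u hub hu with h | rfl | h
    · exact (hab.1 (hb.trans u hub a h)).elim
    · exact (hab.1 hub).elim
    · exact ha.mem_of_sub h hxu

theorem exists_level_above (H : M) (hH : ∀ u, u ε H → Level u) :
    ∃ w, Level w ∧ ∀ u, u ε H → u ε w := by
  obtain ⟨h, hh⟩ := sep₁ (fun u H : M => Level u ∧ (u ε H ∨ ∃ w, w ε H ∧ u ε w)) H
    (sUnion (upair H (sUnion H)))
  have mem_h : ∀ u, u ε h ↔ Level u ∧ (u ε H ∨ ∃ w, w ε H ∧ u ε w) := fun u => by
    rw [hh, and_iff_right_of_imp]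
    rintro ⟨-, hu | ⟨w, hw, hu⟩⟩
    · exact mem_sUnion.2 ⟨H, by simp, hu⟩
    · exact mem_sUnion.2 ⟨sUnion H, by simp, mem_sUnion.2 ⟨w, hw, hu⟩⟩
  have down : ∀ w u, w ε h → Level u → u ε w → u ε h := by
    intro w u hw hu huw
    refine (mem_h u).2 ⟨hu, .inr ?_⟩
    rcases ((mem_h w).1 hw).2 with hw | ⟨w', hw', hww'⟩
    · exact ⟨w, hw, huw⟩
    · exact ⟨w', hw', (hH w' hw').trans w hww' u huw⟩
  obtain ⟨p, hp⟩ := IsZF.power (sUnion h)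
  obtain ⟨w, hw⟩ := sep₁ (fun x h : M => ∃ u, u ε h ∧ Sub x u) h p
  have mem_w : ∀ x, x ε w ↔ ∃ u, u ε h ∧ Sub x u := fun x => by
    rw [hw, and_iff_right_of_imp]
    rintro ⟨u, hu, hxu⟩
    exact (hp x).2 fun z hz => mem_sUnion.2 ⟨u, hu, hxu z hz⟩
  have h_w : ∀ u, u ε h → u ε w := fun u hu => (mem_w u).2 ⟨u, hu, Sub.refl u⟩
  refine ⟨w, ⟨insert h w, ?_, by simp⟩, fun u hu => h_w u ((mem_h u).2 ⟨hH u hu, .inl hu⟩)⟩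
  intro w' hw' x
  rcases mem_insert.1 hw' with hwh | rfl
  · have hL := ((mem_h w').1 hwh).1
    rw [hL.mem_iff]
    constructor
    · rintro ⟨u, hu, huw', hxu⟩
      exact ⟨u, mem_insert.2 (.inl (down w' u hwh hu huw')), huw', hxu⟩
    · rintro ⟨u, hu, huw', hxu⟩
      rcases mem_insert.1 hu with hu | rfl
      · exact ⟨u, ((mem_h u).1 hu).1, huw', hxu⟩
      · exact (mem_asymm huw' (h_w w' hwh)).elim
  · rw [mem_w]
    constructor
    · rintro ⟨u, hu, hxu⟩
      exact ⟨u, mem_insert.2 (.inl hu), h_w u hu, hxu⟩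
    · rintro ⟨u, hu, huw, hxu⟩
      rcases mem_insert.1 hu with hu | rfl
      · exact ⟨u, hu, hxu⟩
      · exact (mem_irrefl _ huw).elim

theorem Level.exists_mem {u : M} (hu : Level u) : ∃ w, Level w ∧ u ε w := by
  obtain ⟨w, hw, h⟩ := exists_level_above (upair u u) (by simp [hu])
  exact ⟨w, hw, h u (by simp)⟩

theorem Level.exists_mem₂ {u₁ u₂ : M} (h₁ : Level u₁) (h₂ : Level u₂) :
    ∃ w, Level w ∧ u₁ ε w ∧ u₂ ε w := by
  obtain ⟨w, hw, h⟩ := exists_level_above (upair u₁ u₂) (by simp [h₁, h₂])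
  exact ⟨w, hw, h u₁ (by simp), h u₂ (by simp)⟩

theorem level_emp : Level (emp M) :=
  ⟨upair (emp M) (emp M), fun w hw x => by
    obtain rfl : w = emp M := by simpa using hw
    exact ⟨fun h => (not_mem_emp x h).elim, fun ⟨u, _, hu, _⟩ => (not_mem_emp u hu).elim⟩, by simp⟩

theorem exists_least_level (A : M → M → Prop) [Def fun v : ℕ → M => A (v 0) (v 1)] (a : M)
    (h : ∃ w, Level w ∧ A w a) :
    ∃ w, Level w ∧ A w a ∧ ∀ w', Level w' → A w' a → w = w' ∨ w ε w' := by
  by_contra! hne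
  obtain ⟨w, hw, hA⟩ := h
  refine mem_induction₂ (fun w a _ : M => Level w → ¬ A w a) a a (fun w ih hw hA => ?_) w hw hA
  obtain ⟨w', hw', hA', h₁, h₂⟩ := hne w hw hA
  rcases hw.trichotomy hw' with h | h | h
  · exact h₂ h
  · exact h₁ h
  · exact ih w' h hw' hA'

theorem exists_level_bound (A : M → M → Prop) [hA : Def fun v : ℕ → M => A (v 0) (v 1)] (X : M)
    (h : ∀ x, x ε X → ∃ w, Level w ∧ A w x) :
    ∃ γ, Level γ ∧ ∀ x, x ε X → ∃ w, Level w ∧ w ε γ ∧ A w x := by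
  have hA' : Def fun v : ℕ → M => A (v 0) (v 2) := hA.rename fun n => 2 * n
  obtain ⟨B, hB⟩ := IsZF.repl (fun v : ℕ → M => Level (v 0) ∧ A (v 0) (v 1) ∧
    ∀ w, Level w → A w (v 1) → v 0 = w ∨ v 0 ε w) inferInstance (fun _ => X) X (by
      intro x hx
      obtain ⟨w, hw, hwA, hmin⟩ := exists_least_level A x (h x hx)
      refine ⟨w, ⟨hw, hwA, hmin⟩, ?_⟩
      rintro w' ⟨hw', hwA', hmin'⟩
      rcases hmin w' hw' hwA' with h | h
      · exact h.symm
      · rcases hmin' w hw hwA with h' | h'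
        · exact h'
        · exact (mem_asymm h h').elim)
  obtain ⟨H, hH⟩ := sep₁ (fun w _ : M => Level w) B B
  obtain ⟨γ, hγ, hHγ⟩ := exists_level_above H fun u hu => ((hH u).1 hu).2
  refine ⟨γ, hγ, fun x hx => ?_⟩
  obtain ⟨w, hwB, hw, hwA, -⟩ := hB x hx
  exact ⟨w, hw, hHγ w ((hH w).2 ⟨hwB, hw⟩), hwA⟩

theorem exists_level_mem (x : M) : ∃ w, Level w ∧ x ε w := by
  refine mem_induction₀ (fun x : M => ∃ w, Level w ∧ x ε w) (fun x ih => ?_) x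
  obtain ⟨γ, hγ, h⟩ := exists_level_bound (fun w x : M => x ε w) x ih
  obtain ⟨w, hw, hγw⟩ := hγ.exists_mem
  refine ⟨w, hw, hw.mem_of_sub hγw fun y hy => ?_⟩
  obtain ⟨u, -, huγ, hyu⟩ := h y hy
  exact hγ.trans u huγ y hyu

/-! ### Definable elements of pointwise algebraic models of ZF -/

variable [PointwiseAlgebraic M]

theorem dfn_of_forall_mem {a : M} (h : ∀ c, c ε a → Dfn c) : Dfn a := by
  obtain ⟨P, hP, ha, hmin⟩ := exists_isolating a
  refine ⟨hP.congr fun v => ⟨fun hv => ?_, fun hv => hv ▸ ha⟩⟩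
  have hsub : ∀ b, P b → Sub a b := fun b hb c hc =>
    have := h c hc
    hmin (fun x => c ε x) inferInstance hc b hb
  exact IsZF.ext _ _ fun z => ⟨hmin (fun x => ∀ b, P b → Sub x b) inferInstance hsub _ hv a ha z,
    hsub _ hv z⟩

theorem Level.dfn {a : M} (h : Level a) : Dfn a := by
  obtain ⟨P, hP, ha, hmin⟩ := exists_isolating a
  obtain ⟨m, hm, hPm, hle⟩ := exists_least_level (fun w _ => P w) a ⟨a, h, ha⟩
  have ham : ∀ b, Level b → P b → a = b ∨ a ε b := by
    by_contra hne
    exact hmin (fun a => ¬ ∀ b, Level b → P b → a = b ∨ a ε b) inferInstance hne m hPm hle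
  refine ⟨hP.congr fun v => ⟨fun hv => ?_, fun hv => hv ▸ ha⟩⟩
  have hb := hmin (fun x => Level x ∧ ∀ b, Level b → P b → x = b ∨ x ε b) inferInstance
    ⟨h, ham⟩ _ hv
  rcases ham _ hb.1 hv with h' | h'
  · exact h'.symm
  · rcases hb.2 a h ha with h'' | h''
    · exact h''
    · exact (mem_asymm h' h'').elim

end

section

theorem Def.exists_lt {P : ℕ → (ℕ → M) → Prop} (hP : ∀ k, Def (P k)) (n : ℕ) :
    Def fun v => ∃ k < n, P k v := by
  induction n with
  | zero => exact Def.congr (P := fun v => ¬ v 0 = v 0) inferInstance fun v => by simp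
  | succ n ih =>
    exact Def.congr (P := fun v => (∃ k < n, P k v) ∨ P n v) inferInstance fun v =>
      Nat.exists_lt_succ_right.symm

variable [IsZF M]

/-! ### Tags -/

variable (M) in
/-- An increasing sequence of levels, used to name the operations in a program. -/
noncomputable def tagLevel : ℕ → {w : M // Level w}
  | 0 => ⟨emp M, level_emp⟩
  | k + 1 => ⟨(tagLevel k).2.exists_mem.choose, (tagLevel k).2.exists_mem.choose_spec.1⟩

variable (M) in
/-- The `k`-th tag. -/
noncomputable def tag (k : ℕ) : M := (tagLevel M k).1

theorem level_tag (k : ℕ) : Level (tag M k) := (tagLevel M k).2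

theorem tag_mem_succ (k : ℕ) : tag M k ε tag M (k + 1) :=
  (tagLevel M k).2.exists_mem.choose_spec.2

theorem tag_mem {i j : ℕ} (h : i < j) : tag M i ε tag M j := by
  induction j, h using Nat.le_induction with
  | base => exact tag_mem_succ i
  | succ j _ ih => exact (level_tag _).trans _ (tag_mem_succ j) _ ih

theorem tag_injective {i j : ℕ} (h : tag M i = tag M j) : i = j := by
  rcases lt_trichotomy i j with hij | hij | hij
  · exact (mem_irrefl _ (h ▸ tag_mem (M := M) hij)).elim
  · exact hij
  · exact (mem_irrefl _ (h ▸ tag_mem (M := M) hij)).elim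

/-! ### Programs -/

/-- The elements of the result of the `k`-th basic operation on `A` and `B`. -/
def Op : ℕ → M → M → M → Prop
  | 0, A, B, w => w ε A ∧ ¬ w ε B
  | 1, A, B, w => ∃ t y, t ε A ∧ y ε B ∧ w = opair t y
  | 2, A, _, w => ∃ y, opair w y ε A
  | 3, A, B, w => ∃ t z y, opair t y ε A ∧ z ε B ∧ w = opair (opair t z) y
  | 4, A, _, w => w ε A ∧ ∃ t z y, w = opair (opair t z) y ∧ z ε y
  | 5, A, _, w => w ε A ∧ ∃ t z y, w = opair (opair t z) y ∧ y ε z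
  | 6, A, _, w => w ε A ∧ ∃ t z y, w = opair (opair t z) y ∧ z = y
  | 7, A, _, w => ∃ t y, opair t y ε A ∧ w ε y
  | _, _, _, w => w = emp M

instance (k i j l : ℕ) : Def fun v : ℕ → M => Op k (v i) (v j) (v l) := by
  rcases k with _ | _ | _ | _ | _ | _ | _ | _ | k <;> simp only [Op] <;> infer_instance

/-- The elements of the result of the instruction `l` on `A` and `B`: a tag names a basic
operation and a level beyond the tags names itself. -/
def Instr (l A B w : M) : Prop :=
  (∃ k < 9, l = tag M k ∧ Op k A B w) ∨ (tag M 9 ε l ∧ w ε l)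

/-- `x` is the result of the instruction `l` on `A` and `B`. -/
def Step (l A B x : M) : Prop := ∀ w, w ε x ↔ Instr l A B w

theorem Step.unique {l A B x y : M} (hx : Step l A B x) (hy : Step l A B y) : x = y :=
  IsZF.ext _ _ fun w => (hx w).trans (hy w).symm

theorem step_tag {k : ℕ} (hk : k < 9) {A B x : M} (h : ∀ w, w ε x ↔ Op k A B w) :
    Step (tag M k) A B x := fun w => by
  rw [h]
  constructor
  · exact fun hw => .inl ⟨k, hk, rfl, hw⟩
  · rintro (⟨j, -, hj, hw⟩ | ⟨h9, -⟩)
    · rwa [tag_injective hj]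
    · exact (mem_asymm h9 (tag_mem hk)).elim

theorem step_level {l : M} (h : tag M 9 ε l) (A B : M) : Step l A B l := fun w => by
  constructor
  · exact fun hw => .inr ⟨h, hw⟩
  · rintro (⟨k, hk, rfl, -⟩ | ⟨-, hw⟩)
    · exact (mem_asymm h (tag_mem hk)).elim
    · exact hw

/-- The line of a program that computes the value at `m` by the instruction `l` from the values
at `m₁` and `m₂`. -/
noncomputable def line (m m₁ m₂ l : M) : M := opair (opair m m₁) (opair m₂ l)

instance {f g h k : (ℕ → M) → M} [DefT f] [DefT g] [DefT h] [DefT k] :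
    DefT fun v => line (f v) (g v) (h v) (k v) := by
  unfold line; infer_instance

@[simp] theorem line_inj {m m₁ m₂ l n n₁ n₂ k : M} :
    line m m₁ m₂ l = line n n₁ n₂ k ↔ m = n ∧ m₁ = n₁ ∧ m₂ = n₂ ∧ l = k := by
  simp [line, and_assoc]

/-- `s` is a program all of whose entries are levels. -/
def Program (s : M) : Prop :=
  (∀ q, q ε s → ∃ m m₁ m₂ l, Level m ∧ Level m₁ ∧ Level m₂ ∧ Level l ∧ q = line m m₁ m₂ l) ∧
    ∀ m m₁ m₂ l n₁ n₂ k, line m m₁ m₂ l ε s → line m n₁ n₂ k ε s → m₁ = n₁ ∧ m₂ = n₂ ∧ l = k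

/-- The pair `⟨m, x⟩` is justified by the program `s` and the record `E`. -/
def Justified (s E m x : M) : Prop :=
  (m = emp M ∧ x = emp M) ∨ ∃ m₁ m₂ l A B, m₁ ε m ∧ m₂ ε m ∧ line m m₁ m₂ l ε s ∧
    opair m₁ A ε E ∧ opair m₂ B ε E ∧ Step l A B x

/-- `E` is a record of a run of the program `s`. -/
def Run (s E : M) : Prop :=
  Program s ∧ ∀ e, e ε E → ∃ m x, e = opair m x ∧ Level m ∧ Justified s E m x

theorem Run.level {s E m x : M} (h : Run s E) (hx : opair m x ε E) : Level m := by
  obtain ⟨m', x', he, hm, -⟩ := h.2 _ hx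
  rwa [(opair_inj.1 he).1]

theorem Run.justified {s E m x : M} (h : Run s E) (hx : opair m x ε E) : Justified s E m x := by
  obtain ⟨m', x', he, -, hj⟩ := h.2 _ hx
  obtain ⟨rfl, rfl⟩ := opair_inj.1 he
  exact hj

theorem Justified.mono {s E s' E' m x : M} (h : Justified s E m x) (hs : Sub s s')
    (hE : Sub E E') : Justified s' E' m x := by
  rcases h with h | ⟨m₁, m₂, l, A, B, h₁, h₂, hl, hA, hB, hx⟩
  · exact .inl h
  · exact .inr ⟨m₁, m₂, l, A, B, h₁, h₂, hs _ hl, hE _ hA, hE _ hB, hx⟩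

theorem run_emp : Run (emp M) (emp M) :=
  ⟨⟨fun q hq => (not_mem_emp q hq).elim, fun _ _ _ _ _ _ _ h => (not_mem_emp _ h).elim⟩,
    fun e he => (not_mem_emp e he).elim⟩

theorem sub_insert (x y : M) : Sub x (insert x y) := fun _ h => mem_insert.2 (.inl h)

theorem Run.insert {s E s' m x : M} (h : Run s E) (hs' : Program s') (hs : Sub s s')
    (hm : Level m) (hx : Justified s' E m x) : Run s' (insert E (opair m x)) := by
  refine ⟨hs', fun e he => ?_⟩
  rcases mem_insert.1 he with he | rfl
  · obtain ⟨n, y, rfl, hn, hj⟩ := h.2 e he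
    exact ⟨n, y, rfl, hn, hj.mono hs (sub_insert _ _)⟩
  · exact ⟨m, x, rfl, hm, hx.mono (Sub.refl _) (sub_insert _ _)⟩

theorem Level.fst_mem {w a b : M} (hw : Level w) (h : opair a b ε w) : a ε w :=
  hw.trans _ (hw.trans _ h (upair a a) (by simp [opair])) _ (by simp)

/-- `x` can be adjoined to every run. -/
def Reach (x : M) : Prop :=
  ∀ s E, Run s E → ∃ s' E', Run s' E' ∧ Sub E E' ∧ ∃ m, opair m x ε E'

theorem reach_emp : Reach (emp M) := fun s E h =>
  ⟨s, insert E (opair (emp M) (emp M)), h.insert h.1 (Sub.refl s) level_emp (.inl ⟨rfl, rfl⟩),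
    sub_insert _ _, emp M, by simp⟩

theorem Reach.step {A B l x : M} (hA : Reach A) (hB : Reach B) (hl : Level l)
    (hx : Step l A B x) : Reach x := by
  intro s E h
  obtain ⟨s₁, E₁, h₁, hE₁, m₁, hm₁⟩ := hA s E h
  obtain ⟨s₂, E₂, h₂, hE₂, m₂, hm₂⟩ := hB s₁ E₁ h₁
  replace hm₁ := hE₂ _ hm₁
  obtain ⟨w, hw, hsw⟩ := exists_level_mem s₂
  obtain ⟨m, hm, hmem⟩ := exists_level_above (SetModel.insert (upair m₁ m₂) w) (by
    intro u hu
    rcases mem_insert.1 hu with hu | rfl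
    · rcases mem_upair.1 hu with rfl | rfl
      · exact h₂.level hm₁
      · exact h₂.level hm₂
    · exact hw)
  have hfresh : ∀ n₁ n₂ k, ¬ line m n₁ n₂ k ε s₂ := fun n₁ n₂ k hn =>
    mem_irrefl m (hm.fst_mem (hm.fst_mem (hm.trans _ (hm.trans w (hmem w (by simp)) _ hsw) _ hn)))
  refine ⟨SetModel.insert s₂ (line m m₁ m₂ l), SetModel.insert E₂ (opair m x),
    h₂.insert ⟨?_, ?_⟩ (sub_insert _ _) hm (.inr ⟨m₁, m₂, l, A, B, hmem _ (by simp),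
      hmem _ (by simp), by simp, hm₁, hm₂, hx⟩),
    fun e he => sub_insert _ _ e (hE₂ e (hE₁ e he)), m, by simp⟩
  · intro q hq
    rcases mem_insert.1 hq with hq | rfl
    · exact h₂.1.1 q hq
    · exact ⟨m, m₁, m₂, l, hm, h₂.level hm₁, h₂.level hm₂, hl, rfl⟩
  · intro n n₁ n₂ k p₁ p₂ j hn hp
    rw [mem_insert, line_inj] at hn hp
    rcases hn with hn | ⟨rfl, rfl, rfl, rfl⟩ <;> rcases hp with hp | ⟨h, rfl, rfl, rfl⟩
    · exact h₂.1.2 _ _ _ _ _ _ _ hn hp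
    · exact (hfresh _ _ _ (h ▸ hn)).elim
    · exact (hfresh _ _ _ hp).elim
    · exact ⟨rfl, rfl, rfl⟩

theorem Reach.op {k : ℕ} (hk : k < 9) {A B x : M} (hA : Reach A) (hB : Reach B)
    (hx : ∀ w, w ε x ↔ Op k A B w) : Reach x :=
  hA.step hB (level_tag k) (step_tag hk hx)

theorem Level.reach {l : M} (hl : Level l) (h : tag M 9 ε l) : Reach l :=
  reach_emp.step reach_emp hl (step_level h _ _)

/-- `x` is a value in some run of some program. -/
def Constructed (x : M) : Prop := ∃ s E m, Run s E ∧ opair m x ε E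

theorem Reach.constructed {x : M} (h : Reach x) : Constructed x := by
  obtain ⟨s, E, hE, -, m, hm⟩ := h _ _ run_emp
  exact ⟨s, E, m, hE, hm⟩

variable [PointwiseAlgebraic M]

instance (k : ℕ) : Dfn (tag M k) := (level_tag k).dfn

instance (a b c d : ℕ) : Def fun v : ℕ → M => Instr (v a) (v b) (v c) (v d) := by
  have : Def fun v : ℕ → M => ∃ k < 9, v a = tag M k ∧ Op k (v b) (v c) (v d) :=
    Def.exists_lt (fun k => inferInstance) 9
  unfold Instr; infer_instance

instance (a b c d : ℕ) : Def fun v : ℕ → M => Step (v a) (v b) (v c) (v d) := by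
  unfold Step; infer_instance

instance (a b c d : ℕ) : Def fun v : ℕ → M => Justified (v a) (v b) (v c) (v d) := by
  unfold Justified; infer_instance

instance (a : ℕ) : Def fun v : ℕ → M => Program (v a) := by
  unfold Program; infer_instance

instance (a b : ℕ) : Def fun v : ℕ → M => Run (v a) (v b) := by
  unfold Run; infer_instance

instance (a : ℕ) : Def fun v : ℕ → M => Constructed (v a) := by
  unfold Constructed; infer_instance

instance dfn_upair {a b : M} [ha : Dfn a] [hb : Dfn b] : Dfn (upair a b) :=
  dfn_of_forall_mem fun c hc => by rcases mem_upair.1 hc with rfl | rfl <;> assumption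

instance dfn_opair {a b : M} [Dfn a] [Dfn b] : Dfn (opair a b) := dfn_upair

theorem Program.dfn {s : M} (h : Program s) : Dfn s := dfn_of_forall_mem fun q hq => by
  obtain ⟨m, m₁, m₂, l, hm, hm₁, hm₂, hl, rfl⟩ := h.1 q hq
  have := hm.dfn
  have := hm₁.dfn
  have := hm₂.dfn
  have := hl.dfn
  unfold line
  infer_instance

theorem Run.unique {s E E' m x x' : M} (h : Run s E) (h' : Run s E') (hx : opair m x ε E)
    (hx' : opair m x' ε E') : x = x' := by
  refine mem_induction₂ (fun m s _ : M => ∀ E E' x x', Run s E → Run s E' → opair m x ε E →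
    opair m x' ε E' → x = x') s s ?_ m E E' x x' h h' hx hx'
  clear! m x x' E E'
  intro m ih E E' x x' h h' hx hx'
  rcases h.justified hx with ⟨rfl, rfl⟩ | ⟨m₁, m₂, l, A, B, h₁, h₂, hl, hA, hB, hst⟩ <;>
    rcases h'.justified hx' with ⟨h₀, rfl⟩ | ⟨n₁, n₂, k, A', B', h₁', h₂', hl', hA', hB', hst'⟩
  · rfl
  · exact (not_mem_emp _ h₁').elim
  · exact (not_mem_emp _ (h₀ ▸ h₁)).elim
  · obtain ⟨rfl, rfl, rfl⟩ := h.1.2 _ _ _ _ _ _ _ hl hl'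
    obtain rfl := ih _ h₁ _ _ _ _ h h' hA hA'
    obtain rfl := ih _ h₂ _ _ _ _ h h' hB hB'
    exact hst.unique hst'

theorem Constructed.dfn {x : M} (h : Constructed x) : Dfn x := by
  obtain ⟨s, E, m, hE, hx⟩ := h
  have := hE.1.dfn
  have := (hE.level hx).dfn
  refine ⟨Def.congr (P := fun v => ∃ s' E, s' = s ∧ Run s' E ∧ opair m (v 0) ε E) inferInstance
    fun v => ⟨?_, ?_⟩⟩
  · rintro ⟨_, E', rfl, hE', hx'⟩
    exact hE'.unique hE hx' hx
  · rintro h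
    exact ⟨s, E, rfl, hE, h ▸ hx⟩

end

section

theorem def_realize {k : ℕ} (ψ : setLang.BoundedFormula Empty k) (σ : Fin k → ℕ) :
    Def fun v : ℕ → M => ψ.Realize default fun i => v (σ i) :=
  ⟨ψ.toFormula.relabel (Sum.elim Empty.elim σ), fun v => by
    rw [Formula.realize_relabel, realize_toFormula]
    exact iff_of_eq (congrArg₂ _ (Subsingleton.elim _ _) rfl)⟩

variable [IsZF M]

/-! ### Existence of the results of the basic operations -/

theorem Level.snd_mem {w a b : M} (hw : Level w) (h : opair a b ε w) : b ε w :=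
  hw.trans _ (hw.trans _ h (upair a b) (by simp [opair])) _ (by simp)

theorem Level.exists_opair_mem {w : M} (hw : Level w) :
    ∃ w', Level w' ∧ Sub w w' ∧ ∀ a b, a ε w → b ε w → opair a b ε w' := by
  obtain ⟨w₁, hw₁, h₁⟩ := hw.exists_mem
  obtain ⟨w₂, hw₂, h₂⟩ := hw₁.exists_mem
  refine ⟨w₂, hw₂, fun z hz => hw₂.trans _ h₂ z (hw₁.trans _ h₁ z hz), fun a b ha hb => ?_⟩
  have key : ∀ c, c ε w → upair a c ε w₁ := fun c hc => hw₁.mem_of_sub h₁ fun z hz => by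
    rcases mem_upair.1 hz with rfl | rfl <;> assumption
  refine hw₂.mem_of_sub h₂ fun z hz => ?_
  rcases mem_upair.1 hz with rfl | rfl
  exacts [key a ha, key b hb]

theorem exists_op (k : ℕ) (A B : M) : ∃ x, ∀ w, w ε x ↔ Op k A B w := by
  obtain ⟨u₁, hu₁, hA⟩ := exists_level_mem A
  obtain ⟨u₂, hu₂, hB⟩ := exists_level_mem B
  obtain ⟨u, hu, h₁, h₂⟩ := hu₁.exists_mem₂ hu₂
  replace hA := hu.trans _ h₁ _ hA
  replace hB := hu.trans _ h₂ _ hB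
  obtain ⟨u', hu', huu', hpair⟩ := hu.exists_opair_mem
  obtain ⟨u'', hu'', huu'', hpair'⟩ := hu'.exists_opair_mem
  obtain ⟨x, hx⟩ := sep₂ (fun w A B : M => Op k A B w) A B u''
  refine ⟨x, fun w => (hx w).trans (and_iff_right_of_imp fun hw => ?_)⟩
  have memA : ∀ z, z ε A → z ε u := hu.trans A hA
  have memB : ∀ z, z ε B → z ε u := hu.trans B hB
  have lift : ∀ z, z ε u → z ε u'' := fun z hz => huu'' z (huu' z hz)
  rcases k with _ | _ | _ | _ | _ | _ | _ | _ | k <;> simp only [Op] at hw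
  · exact lift _ (memA _ hw.1)
  · obtain ⟨t, y, ht, hy, rfl⟩ := hw
    exact huu'' _ (hpair _ _ (memA _ ht) (memB _ hy))
  · obtain ⟨y, hy⟩ := hw
    exact lift _ (hu.fst_mem (memA _ hy))
  · obtain ⟨t, z, y, ht, hz, rfl⟩ := hw
    exact hpair' _ _ (hpair _ _ (hu.fst_mem (memA _ ht)) (memB _ hz))
      (huu' _ (hu.snd_mem (memA _ ht)))
  · exact lift _ (memA _ hw.1)
  · exact lift _ (memA _ hw.1)
  · exact lift _ (memA _ hw.1)
  · obtain ⟨t, y, ht, hy⟩ := hw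
    exact lift _ (hu.trans _ (hu.snd_mem (memA _ ht)) _ hy)
  · exact lift _ (hw ▸ hu.mem_of_sub hA fun z hz => (not_mem_emp z hz).elim)

theorem Reach.exists_op {k : ℕ} (hk : k < 9) {A B : M} (hA : Reach A) (hB : Reach B) :
    ∃ x, Reach x ∧ ∀ w, w ε x ↔ Op k A B w := by
  obtain ⟨x, hx⟩ := SetModel.exists_op k A B
  exact ⟨x, hA.op hk hB hx, hx⟩

/-! ### Tuples -/

/-- The code of a finite tuple. -/
noncomputable def tup : (k : ℕ) → (Fin k → M) → M
  | 0, _ => emp M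
  | k + 1, t => opair (tup k (Fin.init t)) (t (Fin.last k))

theorem tup_snoc {k : ℕ} (t : Fin k → M) (y : M) :
    tup (k + 1) (Fin.snoc t y : Fin (k + 1) → M) = opair (tup k t) y := by
  simp [tup]

theorem tup_injective : ∀ {k : ℕ} {t t' : Fin k → M}, tup k t = tup k t' → t = t'
  | 0, _, _, _ => Subsingleton.elim _ _
  | k + 1, t, t', h => by
    obtain ⟨h₁, h₂⟩ := opair_inj.1 h
    rw [← Fin.snoc_init_self t, ← Fin.snoc_init_self t', tup_injective h₁, h₂]

instance defT_tup : ∀ (k : ℕ) (σ : Fin k → ℕ), DefT fun v : ℕ → M => tup k fun i => v (σ i)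
  | 0, _ => by unfold tup; infer_instance
  | k + 1, σ =>
    have := defT_tup k fun i => σ i.castSucc
    inferInstanceAs (DefT fun v : ℕ → M => opair (tup k fun i => v (σ i.castSucc))
      (v (σ (Fin.last k))))

/-! ### Relations on a level obtained by programs -/

/-- `w` codes a tuple of elements of `β` that satisfies `R`. -/
def Codes (β : M) {k : ℕ} (R : (Fin k → M) → Prop) (w : M) : Prop :=
  ∃ t, (∀ i, t i ε β) ∧ R t ∧ w = tup k t

theorem codes_tup {β : M} {k : ℕ} {R : (Fin k → M) → Prop} {t : Fin k → M} :
    Codes β R (tup k t) ↔ (∀ i, t i ε β) ∧ R t := by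
  constructor
  · rintro ⟨t', h, hR, ht⟩
    obtain rfl := tup_injective ht
    exact ⟨h, hR⟩
  · exact fun h => ⟨t, h.1, h.2, rfl⟩

theorem codes_succ {β w : M} {k : ℕ} {R : (Fin (k + 1) → M) → Prop} :
    Codes β R w ↔ ∃ (t : Fin k → M) (y : M), (∀ i, t i ε β) ∧ y ε β ∧
      R (Fin.snoc t y : Fin (k + 1) → M) ∧ w = opair (tup k t) y := by
  constructor
  · rintro ⟨t, h, hR, rfl⟩
    exact ⟨Fin.init t, t (Fin.last k), fun i => h _, h _, by rwa [Fin.snoc_init_self], rfl⟩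
  · rintro ⟨t, y, h, hy, hR, rfl⟩
    refine ⟨_, fun i => ?_, hR, (tup_snoc t y).symm⟩
    induction i using Fin.lastCases with
    | last => simpa using hy
    | cast i => simpa using h i

/-- The restriction of `R` to `β` can be adjoined to every run. -/
def ReachRel (β : M) {k : ℕ} (R : (Fin k → M) → Prop) : Prop :=
  ∃ X, Reach X ∧ ∀ w, w ε X ↔ Codes β R w

namespace ReachRel

variable {β : M} {k : ℕ} {R S : (Fin k → M) → Prop}

theorem congr (h : ReachRel β R) (hRS : ∀ t, R t ↔ S t) : ReachRel β S := by
  rwa [← show R = S from funext fun t => propext (hRS t)]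

theorem false : ReachRel β fun _ : Fin k → M => False :=
  ⟨emp M, reach_emp, fun w => iff_of_false (not_mem_emp w) fun ⟨_, _, h, _⟩ => h⟩

theorem prod (hβ : Reach β) (h : ReachRel β R) :
    ReachRel β fun t : Fin (k + 1) → M => R (Fin.init t) := by
  obtain ⟨X, hX, hXR⟩ := h
  obtain ⟨Y, hY, hYX⟩ := hX.exists_op (k := 1) (by norm_num) hβ
  refine ⟨Y, hY, fun w => ?_⟩
  rw [hYX, codes_succ]
  constructor
  · rintro ⟨t, y, ht, hy, rfl⟩
    obtain ⟨t, h, hR, rfl⟩ := (hXR t).1 ht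
    exact ⟨t, y, h, hy, by rwa [Fin.init_snoc], rfl⟩
  · rintro ⟨t, y, h, hy, hR, rfl⟩
    rw [Fin.init_snoc] at hR
    exact ⟨_, y, (hXR _).2 ⟨t, h, hR, rfl⟩, hy, rfl⟩

theorem true (hβ : Reach β) : ReachRel β fun _ : Fin k → M => True := by
  induction k with
  | zero =>
    obtain ⟨X, hX, h⟩ := reach_emp.exists_op (M := M) (k := 8) (by norm_num) reach_emp
    exact ⟨X, hX, fun w => (h w).trans ⟨fun h => ⟨Fin.elim0, fun i => i.elim0, trivial, h⟩,
      fun ⟨_, _, _, h⟩ => h⟩⟩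
  | succ k ih => exact ih.prod hβ

theorem diff (hR : ReachRel β R) (hS : ReachRel β S) : ReachRel β fun t => R t ∧ ¬ S t := by
  obtain ⟨X, hX, hXR⟩ := hR
  obtain ⟨Y, hY, hYS⟩ := hS
  obtain ⟨Z, hZ, h⟩ := hX.exists_op (k := 0) (by norm_num) hY
  refine ⟨Z, hZ, fun w => (h w).trans ?_⟩
  rw [Op, hXR, hYS]
  constructor
  · rintro ⟨⟨t, h, hR, rfl⟩, hS⟩
    rw [codes_tup] at hS
    exact ⟨t, h, ⟨hR, fun h' => hS ⟨h, h'⟩⟩, rfl⟩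
  · rintro ⟨t, h, hRS, rfl⟩
    rw [codes_tup, codes_tup]
    exact ⟨⟨h, hRS.1⟩, fun h' => hRS.2 h'.2⟩

theorem imp (hβ : Reach β) (hR : ReachRel β R) (hS : ReachRel β S) :
    ReachRel β fun t => R t → S t :=
  ((true hβ).diff (hR.diff hS)).congr fun t => by tauto

theorem dom {R : (Fin (k + 1) → M) → Prop} (h : ReachRel β R) :
    ReachRel β fun t : Fin k → M => ∃ y, y ε β ∧ R (Fin.snoc t y : Fin (k + 1) → M) := by
  obtain ⟨X, hX, hXR⟩ := h
  obtain ⟨Y, hY, h⟩ := hX.exists_op (k := 2) (by norm_num) reach_emp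
  refine ⟨Y, hY, fun w => (h w).trans ?_⟩
  simp only [Op, hXR, codes_succ, opair_inj]
  constructor
  · rintro ⟨_, t, y, h, hy, hR, rfl, rfl⟩
    exact ⟨t, h, ⟨_, hy, hR⟩, rfl⟩
  · rintro ⟨t, h, ⟨y, hy, hR⟩, rfl⟩
    exact ⟨y, t, y, h, hy, hR, rfl, rfl⟩

theorem ins (hβ : Reach β) {R : (Fin (k + 1) → M) → Prop} (h : ReachRel β R) :
    ReachRel β fun t : Fin (k + 2) → M =>
      R (Fin.snoc (Fin.init (Fin.init t)) (t (Fin.last _)) : Fin (k + 1) → M) := by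
  obtain ⟨X, hX, hXR⟩ := h
  obtain ⟨Y, hY, h⟩ := hX.exists_op (k := 3) (by norm_num) hβ
  refine ⟨Y, hY, fun w => (h w).trans ?_⟩
  simp only [Op, hXR, codes_succ (k := k), codes_succ (k := k + 1), opair_inj]
  constructor
  · rintro ⟨_, z, _, ⟨t, y, h, hy, hR, rfl, rfl⟩, hz, rfl⟩
    refine ⟨Fin.snoc t z, _, fun i => ?_, hy, by simpa using hR, by rw [tup_snoc]⟩
    induction i using Fin.lastCases with
    | last => simpa using hz
    | cast i => simpa using h i
  · rintro ⟨t, y, h, hy, hR, rfl⟩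
    exact ⟨_, t (Fin.last k), _, ⟨Fin.init t, y, fun i => h _, hy, by simpa using hR, rfl, rfl⟩,
      h _, rfl⟩

theorem sel {T : M → M → Prop} {j : ℕ} (hj : j < 9)
    (hT : ∀ A B w : M, Op j A B w ↔ w ε A ∧ ∃ t z y, w = opair (opair t z) y ∧ T z y)
    (hβ : Reach β) :
    ReachRel β fun t : Fin (k + 2) → M => T (t (Fin.last k).castSucc) (t (Fin.last (k + 1))) := by
  obtain ⟨X, hX, hXR⟩ := true (k := k + 2) hβ
  obtain ⟨Y, hY, h⟩ := hX.exists_op hj reach_emp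
  refine ⟨Y, hY, fun w => (h w).trans ?_⟩
  rw [hT, hXR]
  constructor
  · rintro ⟨⟨t, h, -, rfl⟩, _, z, y, ht, hzy⟩
    obtain ⟨ht', rfl⟩ := opair_inj.1 ht
    obtain ⟨-, rfl⟩ := opair_inj.1 ht'
    exact ⟨t, h, hzy, rfl⟩
  · rintro ⟨t, h, hzy, rfl⟩
    exact ⟨⟨t, h, trivial, rfl⟩, _, _, _, rfl, hzy⟩

theorem atom_last (hβ : Reach β) {T : M → M → Prop}
    (hT : ∀ k, ReachRel β fun t : Fin (k + 2) → M =>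
      T (t (Fin.last k).castSucc) (t (Fin.last (k + 1)))) (i : Fin k) :
    ReachRel β fun t : Fin (k + 1) → M => T (t i.castSucc) (t (Fin.last k)) := by
  induction k with
  | zero => exact i.elim0
  | succ k ih =>
    induction i using Fin.lastCases with
    | last => exact hT k
    | cast i => exact ((ih i).ins hβ).congr fun t => by simp [Fin.init]

theorem atom (hβ : Reach β) {T : M → M → Prop}
    (hT : ∀ k, ReachRel β fun t : Fin (k + 2) → M =>
      T (t (Fin.last k).castSucc) (t (Fin.last (k + 1))))
    (hT' : ∀ k, ReachRel β fun t : Fin (k + 2) → M =>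
      T (t (Fin.last (k + 1))) (t (Fin.last k).castSucc))
    (hdiag : (∀ x, T x x) ∨ ∀ x, ¬ T x x) (i j : Fin k) :
    ReachRel β fun t : Fin k → M => T (t i) (t j) := by
  induction k with
  | zero => exact i.elim0
  | succ k ih =>
    induction i using Fin.lastCases with
    | last =>
      induction j using Fin.lastCases with
      | last =>
        rcases hdiag with h | h
        · exact (true hβ).congr fun t => by simp [h]
        · exact false.congr fun t => by simp [h]
      | cast j => exact atom_last (T := fun x y => T y x) hβ hT' j
    | cast i =>
      induction j using Fin.lastCases with
      | last => exact atom_last hβ hT i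
      | cast j => exact (ih i j).prod hβ

theorem mem (hβ : Reach β) (i j : Fin k) : ReachRel β fun t : Fin k → M => t i ε t j :=
  atom hβ (fun _ => sel (j := 4) (by norm_num) (fun _ _ _ => Iff.rfl) hβ)
    (fun _ => sel (T := fun x y => y ε x) (j := 5) (by norm_num) (fun _ _ _ => Iff.rfl) hβ)
    (.inr mem_irrefl) i j

theorem eq (hβ : Reach β) (i j : Fin k) : ReachRel β fun t : Fin k → M => t i = t j :=
  have h : ∀ k, ReachRel β fun t : Fin (k + 2) → M =>
      t (Fin.last k).castSucc = t (Fin.last (k + 1)) :=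
    fun _ => sel (T := Eq) (j := 6) (by norm_num) (fun _ _ _ => Iff.rfl) hβ
  atom (T := Eq) hβ h (fun k => (h k).congr fun _ => eq_comm) (.inl fun _ => rfl) i j

end ReachRel

/-- Every level is contained in a level that reflects the existence of counterexamples. -/
theorem exists_level_reflecting {k : ℕ} (ψ : setLang.BoundedFormula Empty (k + 1)) {β X : M}
    (hβ : Level β) (hX : ∀ w, w ε X ↔ Codes β (fun _ : Fin k → M => True) w) :
    ∃ γ, Level γ ∧ β ε γ ∧ ∀ t : Fin k → M, (∀ i, t i ε β) →
      (∀ y, y ε γ → ψ.Realize default (Fin.snoc t y : Fin (k + 1) → M)) →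
        ∀ y, ψ.Realize default (Fin.snoc t y : Fin (k + 1) → M) := by
  let N : M → M → Prop := fun p y =>
    ∃ t : Fin k → M, p = tup k t ∧ ¬ ψ.Realize default (Fin.snoc t y : Fin (k + 1) → M)
  have hN : Def fun v : ℕ → M => N (v 0) (v 1) := by
    refine Def.exTuple (k := k) (R := fun v t => v 0 = tup k t ∧
      ¬ ψ.Realize default (Fin.snoc t (v 1) : Fin (k + 1) → M)) ?_
    have := def_realize (M := M) ψ (Fin.snoc (fun i : Fin k => (i : ℕ)) (1 + k) : Fin (k + 1) → ℕ)
    have h : ∀ w : ℕ → M, (Fin.snoc (fun i : Fin k => w i) (w (1 + k)) : Fin (k + 1) → M) =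
        fun i => w ((Fin.snoc (fun i : Fin k => (i : ℕ)) (1 + k) : Fin (k + 1) → ℕ) i) := by
      intro w
      funext i
      induction i using Fin.lastCases <;> simp
    simp only [h]
    infer_instance
  have hN' := hN.rename fun n => if n = 0 then 3 else 0
  have hN'' := hN.rename fun n => if n = 0 then 2 else 0
  simp only [one_ne_zero, if_true, if_false] at hN' hN''
  obtain ⟨γ₀, hγ₀, hγ₀N⟩ := exists_level_bound
    (fun w p : M => ∀ y, N p y → ∃ y', y' ε w ∧ N p y') X (by
      intro p _
      by_cases h : ∃ y, N p y
      · obtain ⟨y, hy⟩ := h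
        obtain ⟨w, hw, hyw⟩ := exists_level_mem y
        exact ⟨w, hw, fun _ _ => ⟨y, hyw, hy⟩⟩
      · exact ⟨emp M, level_emp, fun y hy => (h ⟨y, hy⟩).elim⟩)
  obtain ⟨γ, hγ, hβγ, hγ₀γ⟩ := hβ.exists_mem₂ hγ₀
  refine ⟨γ, hγ, hβγ, fun t ht h y => by_contra fun hy => ?_⟩
  obtain ⟨w, -, hw, hwN⟩ := hγ₀N (tup k t) ((hX _).2 (codes_tup.2 ⟨ht, trivial⟩))
  obtain ⟨y', hy', t', htt', hψ⟩ := hwN y ⟨t, rfl, hy⟩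
  obtain rfl := tup_injective htt'
  exact hψ (h y' (hγ.trans _ hγ₀γ _ (hγ₀.trans _ hw _ hy')))

theorem reachRel_realize {k : ℕ} (ψ : setLang.BoundedFormula Empty k) :
    ∀ β : M, Level β → tag M 9 ε β → ReachRel β fun t : Fin k → M => ψ.Realize default t := by
  have hvar : ∀ {k : ℕ} (s : setLang.Term (Empty ⊕ Fin k)), ∃ i : Fin k, s = &i := by
    rintro k ((⟨⟨⟩⟩ | i) | ⟨⟨⟩, _⟩)
    exact ⟨i, rfl⟩
  induction ψ with
  | falsum => exact fun _ _ _ => ReachRel.false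
  | equal s₁ s₂ =>
    intro β hβ h9
    obtain ⟨i, rfl⟩ := hvar s₁
    obtain ⟨j, rfl⟩ := hvar s₂
    exact ReachRel.eq (hβ.reach h9) i j
  | rel r ts =>
    intro β hβ h9
    obtain ⟨rfl⟩ := r
    obtain ⟨i, hi⟩ := hvar (ts 0)
    obtain ⟨j, hj⟩ := hvar (ts 1)
    refine (ReachRel.mem (hβ.reach h9) i j).congr fun t => ?_
    change Structure.RelMap memRel ![t i, t j] ↔
      Structure.RelMap memRel fun l => (ts l).realize (Sum.elim default t)
    refine iff_of_eq (congrArg _ (funext fun l => ?_))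
    fin_cases l
    · simp [hi]
    · simp [hj]
  | imp φ ψ ihφ ihψ => exact fun β hβ h9 => (ihφ β hβ h9).imp (hβ.reach h9) (ihψ β hβ h9)
  | @all k ψ ih =>
    intro β hβ h9
    obtain ⟨X, hX, hXβ⟩ := ReachRel.true (k := k) (hβ.reach h9)
    obtain ⟨γ, hγ, hβγ, hrefl⟩ := exists_level_reflecting ψ hβ hXβ
    have h9γ := hγ.trans β hβγ _ h9
    obtain ⟨Y, hY, hYγ⟩ := ((ReachRel.true (hγ.reach h9γ)).diff (ih γ hγ h9γ)).dom
    obtain ⟨Z, hZ, h⟩ := hX.exists_op (k := 0) (by norm_num) hY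
    refine ⟨Z, hZ, fun w => (h w).trans ?_⟩
    rw [Op, hXβ, hYγ]
    constructor
    · rintro ⟨⟨t, ht, -, rfl⟩, hnot⟩
      refine ⟨t, ht, realize_all.2 (hrefl t ht fun y hy => by_contra fun hψ => hnot ?_), rfl⟩
      exact codes_tup.2 ⟨fun i => hγ.trans β hβγ _ (ht i), y, hy, trivial, hψ⟩
    · rintro ⟨t, ht, hψ, rfl⟩
      refine ⟨⟨t, ht, trivial, rfl⟩, fun hc => ?_⟩
      obtain ⟨-, y, -, -, hy⟩ := codes_tup.1 hc
      exact hy (realize_all.1 hψ y)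

/-! ### All elements are definable -/

theorem Dfn.reach {x : M} (hx : Dfn x) : Reach x := by
  obtain ⟨n, hn⟩ := hx.out.exists_boundedFormula
  obtain ⟨φ, hφ⟩ := hn 1 fun _ => 0
  obtain ⟨u, hu, hxu⟩ := exists_level_mem x
  obtain ⟨β, hβ, huβ, h9⟩ := hu.exists_mem₂ (level_tag 9)
  obtain ⟨X, hX, h⟩ := reachRel_realize φ β hβ h9
  refine hX.op (k := 7) (by norm_num) reach_emp fun w => ?_
  have hmem : ∀ p, p ε X ↔ p = opair (emp M) x := by
    intro p
    rw [h]
    constructor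
    · rintro ⟨t, -, ht, rfl⟩
      rw [hφ t (fun _ => t 0) fun _ _ => rfl] at ht
      rw [← ht]
      rfl
    · rintro rfl
      exact ⟨fun _ => x, fun _ => hβ.trans u huβ x hxu,
        (hφ _ (fun _ => x) fun _ _ => rfl).2 rfl, rfl⟩
  simp [Op, hmem]

theorem dfn [PointwiseAlgebraic M] (x : M) : Dfn x :=
  (mem_induction₀ (fun x : M => Constructed x)
    (fun _ ih => (dfn_of_forall_mem fun c hc => (ih c hc).dfn).reach.constructed) x).dfn

end

end SetModel

/-- Every pointwise algebraic model of ZF is pointwise definable: if `M ⊨ ZF` and every element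
of `M` is algebraic in `M` without parameters, then every element of `M` is definable in `M`
without parameters. -/
theorem pointwise_algebraic_model_of_ZF_is_pointwise_definable
    (M : Type*) [setLang.Structure M] (hZF : M ⊨ ZF)
    (halg : ∀ a : M, ∃ φ : setLang.Formula (Fin 1),
      φ.Realize ![a] ∧ {b : M | φ.Realize ![b]}.Finite) :
    ∀ a : M, ∃ φ : setLang.Formula (Fin 1), ∀ b : M, φ.Realize ![b] ↔ b = a := by
  have := SetModel.isZF_of_model hZF
  have : SetModel.PointwiseAlgebraic M := ⟨fun a => by
    obtain ⟨φ, ha, hfin⟩ := halg a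
    refine ⟨fun b => φ.Realize ![b], .mk ⟨φ.relabel fun _ => 0, fun v => ?_⟩, ha, hfin⟩
    rw [Formula.realize_relabel]
    exact iff_of_eq (congrArg _ (funext fun i => by simp))⟩
  intro a
  obtain ⟨φ, hφ⟩ := (SetModel.dfn a).out.out
  refine ⟨φ.relabel fun _ => 0, fun b => ?_⟩
  rw [Formula.realize_relabel, hφ]
  rfl
end

section
/- Let T be a theory in the first-order language with a single binary relation symbol ∈ that contains all the ZF axioms. Then T has a pointwise algebraic model if and only if T has a pointwise definable model. -/
open FirstOrder Language BoundedFormula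

universe u

/-! ### Definability calculus -/

section Definability

variable {M : Type u} [setLang.Structure M]

/-- Membership in a `setLang`-structure. -/
def Elem (a b : M) : Prop := Structure.RelMap memRel ![a, b]

infix:50 "ε" => Elem

/-- `P` is a relation on assignments that is definable with parameters from `A`. -/
class Def (A : Set M) (P : (ℕ → M) → Prop) : Prop where
  out : ∃ φ : setLang.Formula (A ⊕ ℕ), ∀ v, φ.Realize (Sum.elim Subtype.val v) ↔ P v

/-- `f` is a function on assignments whose graph is definable with parameters from `A`. -/
class DefFun (A : Set M) (f : (ℕ → M) → M) : Prop where
  out : Def A fun w => w 0 = f fun n => w (n + 1)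

variable {A : Set M} {P Q : (ℕ → M) → Prop}

theorem Def.congr [h : Def A P] (e : ∀ v, P v ↔ Q v) : Def A Q := by
  obtain ⟨φ, hφ⟩ := h
  exact ⟨φ, fun v => (hφ v).trans (e v)⟩

instance Def.false : Def A fun _ => False := ⟨⊥, fun _ => by simp [Formula.Realize]⟩

instance Def.imp [hP : Def A P] [hQ : Def A Q] : Def A fun v => P v → Q v := by
  obtain ⟨φ, hφ⟩ := hP
  obtain ⟨ψ, hψ⟩ := hQ
  exact ⟨φ.imp ψ, fun v => by rw [Formula.realize_imp, hφ, hψ]⟩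

instance Def.not [Def A P] : Def A fun v => ¬ P v :=
  Def.congr (P := fun v => P v → False) fun _ => Iff.rfl

instance Def.and [Def A P] [Def A Q] : Def A fun v => P v ∧ Q v :=
  Def.congr (P := fun v => ¬ (P v → ¬ Q v)) fun _ => by tauto

instance Def.or [Def A P] [Def A Q] : Def A fun v => P v ∨ Q v :=
  Def.congr (P := fun v => ¬ P v → Q v) fun _ => by tauto

instance Def.iff [Def A P] [Def A Q] : Def A fun v => (P v ↔ Q v) :=
  Def.congr (P := fun v => (P v → Q v) ∧ (Q v → P v)) fun _ => by tauto

instance Def.all {P : (ℕ → M) → M → Prop} [h : Def A fun w => P (fun n => w (n + 1)) (w 0)] :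
    Def A fun v => ∀ x, P v x := by
  obtain ⟨φ, hφ⟩ := h
  let g : A ⊕ ℕ → (A ⊕ ℕ) ⊕ Fin 1
    | .inl a => .inl (.inl a)
    | .inr 0 => .inr 0
    | .inr (n + 1) => .inl (.inr n)
  refine ⟨(BoundedFormula.relabel g φ : setLang.BoundedFormula (A ⊕ ℕ) 1).all, fun v => ?_⟩
  rw [Formula.Realize, realize_all]
  refine forall_congr' fun x => ?_
  have key := hφ (fun n => Nat.casesOn n x v)
  refine Iff.trans ?_ key
  erw [BoundedFormula.realize_relabel]
  rw [Formula.Realize, iff_eq_eq]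
  refine _root_.congr (_root_.congr rfl (funext fun i => ?_)) (Subsingleton.elim _ _)
  rcases i with a | _ | n
  · rfl
  · simp [g, Fin.snoc]
  · rfl

instance Def.ex {P : (ℕ → M) → M → Prop} [h : Def A fun w => P (fun n => w (n + 1)) (w 0)] :
    Def A fun v => ∃ x, P v x :=
  Def.congr (P := fun v => ¬ ∀ x, ¬ P v x) fun _ => by push Not; rfl

instance Def.prop (p : Prop) : Def A fun _ => p := by
  by_cases hp : p
  · exact Def.congr (P := fun _ => False → False) fun _ => by simp [hp]
  · exact Def.congr (P := fun _ => False) fun _ => by simp [hp]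

instance Def.exFin {k : ℕ} {P : Fin k → (ℕ → M) → Prop} [h : ∀ i, Def A (P i)] :
    Def A fun v => ∃ i, P i v := by
  induction k with
  | zero => exact Def.congr (P := fun _ => False) fun v => by simp
  | succ k ih =>
    have := ih (P := fun i => P i.succ)
    exact Def.congr (P := fun v => P 0 v ∨ ∃ i : Fin k, P i.succ v) fun v => by
      rw [Fin.exists_fin_succ]

theorem Def.relabel (h : Def A P) (g : ℕ → ℕ) : Def A fun v => P fun n => v (g n) := by
  obtain ⟨φ, hφ⟩ := h
  refine ⟨φ.relabel (Sum.map id g), fun v => ?_⟩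
  rw [Formula.realize_relabel, ← hφ]
  exact iff_of_eq (_root_.congr rfl (funext fun i => by rcases i <;> rfl))

theorem DefFun.relabel {f : (ℕ → M) → M} (h : DefFun A f) (g : ℕ → ℕ) :
    DefFun A fun v => f fun n => v (g n) :=
  ⟨h.out.relabel (P := fun w => w 0 = f fun n => w (n + 1))
    (fun n => Nat.casesOn n 0 fun m => g m + 1)⟩

theorem Def.var_eq (i j : ℕ) : Def A fun v => v i = v j :=
  ⟨Term.equal (.var (.inr i)) (.var (.inr j)), fun v => by simp [Formula.realize_equal]⟩

theorem Def.var_elem (i j : ℕ) : Def A fun v => v i ε v j :=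
  ⟨memRel.formula₂ (.var (.inr i)) (.var (.inr j)), fun v => by
    rw [Formula.realize_rel₂]; rfl⟩

instance DefFun.var (i : ℕ) : DefFun A fun v => v i := ⟨Def.var_eq 0 (i + 1)⟩

instance DefFun.const (c : M) : DefFun (Set.univ : Set M) fun _ => c :=
  ⟨⟨Term.equal (.var (.inr 0)) (.var (.inl ⟨c, trivial⟩)), fun v => by
    simp [Formula.realize_equal]⟩⟩

theorem Def.subst {P : (ℕ → M) → M → Prop} {f : (ℕ → M) → M} (hf : DefFun A f)
    (h : Def A fun w => P (fun n => w (n + 1)) (w 0)) : Def A fun v => P v (f v) :=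
  have := hf.out
  Def.congr (P := fun v => ∃ x, x = f v ∧ P v x) fun v => by simp

theorem Def.rel₁ {R : M → Prop} (h : Def A fun v => R (v 0)) {f : (ℕ → M) → M}
    (hf : DefFun A f) : Def A fun v => R (f v) :=
  Def.subst (P := fun _ x => R x) hf (h.relabel id)

theorem Def.rel₂ {R : M → M → Prop} (h : Def A fun v => R (v 0) (v 1)) {f g : (ℕ → M) → M}
    (hf : DefFun A f) (hg : DefFun A g) : Def A fun v => R (f v) (g v) :=
  Def.subst (P := fun v x => R x (g v)) hf <|
    Def.subst (P := fun w y => R (w 0) y) (hg.relabel fun n => n + 1) <| h.relabel fun n => 1 - n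

theorem Def.rel₃ {R : M → M → M → Prop} (h : Def A fun v => R (v 0) (v 1) (v 2))
    {f g k : (ℕ → M) → M} (hf : DefFun A f) (hg : DefFun A g) (hk : DefFun A k) :
    Def A fun v => R (f v) (g v) (k v) :=
  Def.subst (P := fun v x => R x (g v) (k v)) hf <|
    Def.subst (P := fun w y => R (w 0) y (k fun n => w (n + 1))) (hg.relabel fun n => n + 1) <|
    Def.subst (P := fun w z => R (w 1) (w 0) z) (hk.relabel fun n => n + 1 + 1) <|
    h.relabel fun n => 2 - n

theorem Def.rel₄ {R : M → M → M → M → Prop} (h : Def A fun v => R (v 0) (v 1) (v 2) (v 3))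
    {f g k l : (ℕ → M) → M} (hf : DefFun A f) (hg : DefFun A g) (hk : DefFun A k)
    (hl : DefFun A l) : Def A fun v => R (f v) (g v) (k v) (l v) :=
  Def.subst (P := fun v x => R x (g v) (k v) (l v)) hf <|
    Def.subst (P := fun w y => R (w 0) y (k fun n => w (n + 1)) (l fun n => w (n + 1)))
      (hg.relabel fun n => n + 1) <|
    Def.subst (P := fun w z => R (w 1) (w 0) z (l fun n => w (n + 1 + 1)))
      (hk.relabel fun n => n + 1 + 1) <|
    Def.subst (P := fun w z => R (w 2) (w 1) (w 0) z) (hl.relabel fun n => n + 1 + 1 + 1) <|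
    h.relabel fun n => 3 - n

theorem DefFun.app₁ {F : M → M} (h : Def A fun v => v 0 = F (v 1)) {f : (ℕ → M) → M}
    (hf : DefFun A f) : DefFun A fun v => F (f v) :=
  ⟨Def.rel₂ (R := fun x y => x = F y) h (DefFun.var 0) (hf.relabel fun n => n + 1)⟩

theorem DefFun.app₂ {F : M → M → M} (h : Def A fun v => v 0 = F (v 1) (v 2))
    {f g : (ℕ → M) → M} (hf : DefFun A f) (hg : DefFun A g) : DefFun A fun v => F (f v) (g v) :=
  ⟨Def.rel₃ (R := fun x y z => x = F y z) h (DefFun.var 0) (hf.relabel fun n => n + 1)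
    (hg.relabel fun n => n + 1)⟩

theorem DefFun.app₃ {F : M → M → M → M} (h : Def A fun v => v 0 = F (v 1) (v 2) (v 3))
    {f g k : (ℕ → M) → M} (hf : DefFun A f) (hg : DefFun A g) (hk : DefFun A k) :
    DefFun A fun v => F (f v) (g v) (k v) :=
  ⟨Def.rel₄ (R := fun x y z w => x = F y z w) h (DefFun.var 0) (hf.relabel fun n => n + 1)
    (hg.relabel fun n => n + 1) (hk.relabel fun n => n + 1)⟩

instance Def.eq {f g : (ℕ → M) → M} [hf : DefFun A f] [hg : DefFun A g] :
    Def A fun v => f v = g v :=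
  Def.rel₂ (Def.var_eq 0 1) hf hg

instance Def.elem {f g : (ℕ → M) → M} [hf : DefFun A f] [hg : DefFun A g] :
    Def A fun v => f v ε g v :=
  Def.rel₂ (Def.var_elem 0 1) hf hg

end Definability

/-! ### The axioms of ZF in semantic form -/

section Axioms

variable {M : Type u} [setLang.Structure M]

theorem Def.exists_boundedFormula [Nonempty M] {P : (ℕ → M) → Prop} (h : Def Set.univ P) {k : ℕ}
    (ρ : ℕ → Fin k) :
    ∃ (n : ℕ) (ψ : setLang.BoundedFormula Empty (n + k)) (p : Fin n → M), ∀ xs : Fin k → M,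
      ψ.Realize default (Fin.append p xs) ↔ P fun i => xs (ρ i) := by
  classical
  obtain ⟨φ, hφ⟩ := h
  let e := φ.freeVarFinset.equivFin
  let f : φ.freeVarFinset → Fin (φ.freeVarFinset.card + k) := fun s =>
    Sum.elim (fun _ => Fin.castAdd k (e s)) (fun i => Fin.natAdd _ (ρ i)) s.1
  let p : Fin φ.freeVarFinset.card → M := fun j =>
    Sum.elim Subtype.val (fun _ => Classical.arbitrary M) (e.symm j).1
  refine ⟨φ.freeVarFinset.card, BoundedFormula.relabel (n := φ.freeVarFinset.card + k) Sum.inr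
    (φ.restrictFreeVar f), p, fun xs => ?_⟩
  refine (Formula.realize_relabel_sumInr _).trans ?_
  rw [← hφ, Formula.Realize, Formula.Realize]
  refine realize_restrictFreeVar _ fun s => ?_
  obtain ⟨s | s, hs⟩ := s
  · simp [f, p]
  · simp [f]

variable [M ⊨ ZF]

theorem ext_elem {a b : M} (h : ∀ z, z ε a ↔ z ε b) : a = b := by
  have := Theory.realize_sentence_of_mem (M := M) ZF (φ := extensionalityAx) (by simp [ZF])
  simp only [extensionalityAx, Sentence.Realize, Formula.Realize, memF, realize_all, realize_imp,
    realize_iff, realize_rel₂, realize_bdEqual] at this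
  exact this a b h

theorem exists_minimal_elem {a : M} (h : ∃ z, z ε a) : ∃ z, z ε a ∧ ∀ y, y ε z → ¬ y ε a := by
  have := Theory.realize_sentence_of_mem (M := M) ZF (φ := foundationAx) (by simp [ZF])
  simp only [foundationAx, Sentence.Realize, Formula.Realize, memF, realize_all, realize_imp,
    realize_rel₂, realize_ex, realize_inf, realize_not] at this
  exact this a h

theorem exists_upair (a b : M) : ∃ c, ∀ z, z ε c ↔ z = a ∨ z = b := by
  have := Theory.realize_sentence_of_mem (M := M) ZF (φ := pairingAx) (by simp [ZF])
  simp only [pairingAx, Sentence.Realize, Formula.Realize, memF, realize_all, realize_sup,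
    realize_iff, realize_rel₂, realize_ex, realize_bdEqual] at this
  exact this a b

theorem exists_union_elem (a : M) : ∃ c, ∀ z, z ε c ↔ ∃ y, y ε a ∧ z ε y := by
  have := Theory.realize_sentence_of_mem (M := M) ZF (φ := unionAx) (by simp [ZF])
  simp only [unionAx, Sentence.Realize, Formula.Realize, memF, realize_all, realize_inf,
    realize_iff, realize_rel₂, realize_ex] at this
  exact this a

theorem exists_powerset (a : M) : ∃ c, ∀ z, z ε c ↔ ∀ w, w ε z → w ε a := by
  have := Theory.realize_sentence_of_mem (M := M) ZF (φ := powersetAx) (by simp [ZF])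
  simp only [powersetAx, Sentence.Realize, Formula.Realize, memF, realize_all, realize_imp,
    realize_iff, realize_rel₂, realize_ex] at this
  exact this a

variable (M) in
theorem exists_inductive : ∃ x : M, (∃ e, e ε x ∧ ∀ z, ¬ z ε e) ∧
    ∀ y, y ε x → ∃ s, s ε x ∧ ∀ z, z ε s ↔ z ε y ∨ z = y := by
  have := Theory.realize_sentence_of_mem (M := M) ZF (φ := infinityAx) (by simp [ZF])
  simp only [infinityAx, Sentence.Realize, Formula.Realize, memF, realize_all, realize_imp,
    realize_iff, realize_rel₂, realize_ex, realize_inf, realize_sup, realize_not,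
    realize_bdEqual] at this
  exact this

theorem exists_sep (Q : M → Prop) [h : Def Set.univ fun v : ℕ → M => Q (v 0)] (a : M) :
    ∃ b, ∀ z, z ε b ↔ z ε a ∧ Q z := by
  have : Nonempty M := ⟨a⟩
  obtain ⟨n, ψ, p, hψ⟩ := h.exists_boundedFormula (k := 1) fun _ => 0
  have := Theory.realize_sentence_of_mem (M := M) ZF (φ := separationAx ψ)
    (Or.inl (Or.inr (Set.mem_iUnion.2 ⟨n, ψ, rfl⟩)))
  simp only [separationAx, Sentence.Realize, realize_alls, memF, realize_all,
    realize_iff, realize_rel₂, realize_ex, realize_inf] at this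
  obtain ⟨b, hb⟩ := this p a
  refine ⟨b, fun z => ?_⟩
  have hz := hb z
  rw [realize_liftAt (by omega)] at hz
  have e : (Fin.snoc (Fin.snoc (Fin.snoc p a : Fin (n + 1) → M) b : Fin (n + 2) → M) z :
      Fin (n + 3) → M) ∘ (fun i : Fin (n + 1) =>
        if ↑i < n then Fin.castAdd 2 i else Fin.addNat i 2) = Fin.append p ![z] := by
    funext i
    refine Fin.addCases (fun i => ?_) (fun i => ?_) i
    · have := i.2
      simp [Fin.snoc, Fin.append_left, show (i : ℕ) < n + 1 by omega, show (i : ℕ) < n + 2 by omega]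
      rfl
    · obtain rfl := Subsingleton.elim i 0
      simp [Fin.snoc, Fin.append_right]
  rw [e, hψ] at hz
  simpa [vr, Fin.snoc, Elem] using hz

theorem exists_repl (R : M → M → Prop) [h : Def Set.univ fun v : ℕ → M => R (v 0) (v 1)] (a : M)
    (hR : ∀ x, x ε a → ∃ y, R x y ∧ ∀ z, R x z → z = y) :
    ∃ b, ∀ x, x ε a → ∃ y, y ε b ∧ R x y := by
  have : Nonempty M := ⟨a⟩
  obtain ⟨n, ψ, p, hψ⟩ := h.exists_boundedFormula (k := 2) fun i => if i = 0 then 0 else 1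
  have := Theory.realize_sentence_of_mem (M := M) ZF (φ := replacementAx ψ)
    (Or.inr (Set.mem_iUnion.2 ⟨n, ψ, rfl⟩))
  simp only [replacementAx, Sentence.Realize, realize_alls, memF, realize_all, realize_imp,
    realize_rel₂, realize_ex, realize_inf, realize_bdEqual] at this
  have e₁ : ∀ x y : M, (Fin.snoc (Fin.snoc (Fin.snoc p a : Fin (n + 1) → M) x : Fin (n + 2) → M) y :
      Fin (n + 3) → M) ∘ (fun i : Fin (n + 2) =>
        if ↑i < n then Fin.castAdd 1 i else Fin.addNat i 1) = Fin.append p ![x, y] := by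
    intro x y
    funext i
    refine Fin.addCases (fun i => ?_) (fun i => ?_) i
    · have := i.2
      simp [Fin.snoc, Fin.append_left, show (i : ℕ) < n + 1 by omega, show (i : ℕ) < n + 2 by omega]
      rfl
    · fin_cases i <;> simp [Fin.snoc, Fin.append_right]
  have e₂ : ∀ x y z : M, (Fin.snoc (Fin.snoc (Fin.snoc (Fin.snoc p a : Fin (n + 1) → M) x :
      Fin (n + 2) → M) y : Fin (n + 3) → M) z : Fin (n + 4) → M) ∘ (fun i : Fin (n + 3) =>
        if ↑i < n + 2 then Fin.castAdd 1 i else Fin.addNat i 1) =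
      Fin.snoc (Fin.snoc (Fin.snoc p a : Fin (n + 1) → M) x : Fin (n + 2) → M) z := by
    intro x y z
    funext i
    rcases lt_or_ge (i : ℕ) (n + 2) with h | h
    · simp [Fin.snoc, h, show (i : ℕ) < n + 3 by omega]
    · obtain rfl : i = Fin.last (n + 2) := Fin.ext (by have := i.2; simp; omega)
      simp [Fin.snoc]
  have e₃ : ∀ b x y : M, (Fin.snoc (Fin.snoc (Fin.snoc (Fin.snoc p a : Fin (n + 1) → M) b :
      Fin (n + 2) → M) x : Fin (n + 3) → M) y : Fin (n + 4) → M) ∘ (fun i : Fin (n + 2) =>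
        if ↑i < n then Fin.castAdd 2 i else Fin.addNat i 2) = Fin.append p ![x, y] := by
    intro b x y
    funext i
    refine Fin.addCases (fun i => ?_) (fun i => ?_) i
    · have := i.2
      simp [Fin.snoc, Fin.append_left, show (i : ℕ) < n + 1 by omega,
        show (i : ℕ) < n + 2 by omega, show (i : ℕ) < n + 3 by omega]
      rfl
    · fin_cases i <;> simp [Fin.snoc, Fin.append_right]
  have H := this p a
  simp only [realize_liftAt (show n ≤ n + 2 by omega),
    realize_liftAt (show n + 2 ≤ n + 2 + 1 by omega)] at H
  simp only [e₁, e₂, e₃, hψ] at H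
  simp [vr, Fin.snoc] at H
  exact H hR
end Axioms

/-! ### Basic set operations and iteration along `ω` -/

section Basic

variable {M : Type u} [setLang.Structure M] {A : Set M}

/-- Inclusion in a `setLang`-structure. -/
def Incl (a b : M) : Prop := ∀ z, z ε a → z ε b

instance Def.incl {f g : (ℕ → M) → M} [hf : DefFun A f] [hg : DefFun A g] :
    Def A fun v => Incl (f v) (g v) :=
  Def.rel₂ (by unfold Incl; infer_instance) hf hg

variable [M ⊨ ZF]

theorem Incl.antisymm {a b : M} (h : Incl a b) (h' : Incl b a) : a = b :=
  ext_elem fun z => ⟨h z, h' z⟩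

theorem eq_iff_elem {a : M} {Q : M → Prop} {b : M} (h : ∀ z, z ε b ↔ Q z) :
    a = b ↔ ∀ z, z ε a ↔ Q z :=
  ⟨fun e z => e ▸ h z, fun e => ext_elem fun z => (e z).trans (h z).symm⟩

variable (M) in
theorem exists_emp : ∃ e : M, ∀ z, ¬ z ε e := by
  obtain ⟨x, ⟨e, -, he⟩, -⟩ := exists_inductive M
  exact ⟨e, he⟩

variable (M) in
/-- The empty set. -/
noncomputable def emp : M := (exists_emp M).choose

theorem not_elem_emp (z : M) : ¬ z ε emp M := (exists_emp M).choose_spec z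

theorem eq_emp_iff {a : M} : a = emp M ↔ ∀ z, ¬ z ε a :=
  ⟨fun e z => e ▸ not_elem_emp z, fun h => ext_elem fun z => by simp [h, not_elem_emp]⟩

instance DefFun.emp : DefFun A fun _ => emp M :=
  ⟨Def.congr (P := fun v => ∀ z, ¬ z ε v 0) fun _ => eq_emp_iff.symm⟩

/-- The unordered pair. -/
noncomputable def upair (a b : M) : M := (exists_upair a b).choose

theorem elem_upair {a b z : M} : z ε upair a b ↔ z = a ∨ z = b := (exists_upair a b).choose_spec z

instance DefFun.upair {f g : (ℕ → M) → M} [hf : DefFun A f] [hg : DefFun A g] :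
    DefFun A fun v => upair (f v) (g v) :=
  DefFun.app₂ (Def.congr (P := fun v => ∀ z, z ε v 0 ↔ z = v 1 ∨ z = v 2) fun _ =>
    (eq_iff_elem fun _ => elem_upair).symm) hf hg

/-- The Kuratowski pair. -/
noncomputable def pr (a b : M) : M := upair (upair a a) (upair a b)

instance DefFun.pr {f g : (ℕ → M) → M} [hf : DefFun A f] [hg : DefFun A g] :
    DefFun A fun v => pr (f v) (g v) := by
  unfold _root_.pr
  infer_instance

theorem upair_inj_left {a b c : M} (h : upair a b = upair a c) : b = c := by
  have h1 : b ε upair a c := h ▸ elem_upair.2 (Or.inr rfl)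
  have h2 : c ε upair a b := h ▸ elem_upair.2 (Or.inr rfl)
  rw [elem_upair] at h1 h2
  grind

theorem pr_inj {a b c d : M} : pr a b = pr c d ↔ a = c ∧ b = d := by
  refine ⟨fun h => ?_, fun ⟨h, h'⟩ => h ▸ h' ▸ rfl⟩
  have h1 : upair a a ε pr c d := h ▸ elem_upair.2 (Or.inl rfl)
  have h2 : c ε upair a a := by
    rcases elem_upair.1 h1 with e | e <;> rw [e] <;> exact elem_upair.2 (Or.inl rfl)
  obtain rfl : c = a := by simpa [elem_upair] using h2
  exact ⟨rfl, upair_inj_left (upair_inj_left h)⟩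

/-- The union of a set. -/
noncomputable def sUn (a : M) : M := (exists_union_elem a).choose

theorem elem_sUn {a z : M} : z ε sUn a ↔ ∃ y, y ε a ∧ z ε y := (exists_union_elem a).choose_spec z

instance DefFun.sUn {f : (ℕ → M) → M} [hf : DefFun A f] : DefFun A fun v => sUn (f v) :=
  DefFun.app₁ (Def.congr (P := fun v => ∀ z, z ε v 0 ↔ ∃ y, y ε v 1 ∧ z ε y) fun _ =>
    (eq_iff_elem fun _ => elem_sUn).symm) hf

/-- The power set. -/
noncomputable def pow (a : M) : M := (exists_powerset a).choose

theorem elem_pow {a z : M} : z ε pow a ↔ Incl z a := (exists_powerset a).choose_spec z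

/-- The set `p ∪ {s}`. -/
noncomputable def ins (p s : M) : M := sUn (upair p (upair s s))

theorem elem_ins {p s z : M} : z ε ins p s ↔ z ε p ∨ z = s := by
  simp [ins, elem_sUn, elem_upair]

instance DefFun.ins {f g : (ℕ → M) → M} [hf : DefFun A f] [hg : DefFun A g] :
    DefFun A fun v => ins (f v) (g v) := by
  unfold _root_.ins
  infer_instance

theorem not_elem_self (a : M) : ¬ a ε a := by
  intro h
  obtain ⟨z, hz, hz'⟩ := exists_minimal_elem (a := upair a a) ⟨a, elem_upair.2 (Or.inl rfl)⟩
  obtain rfl : z = a := by simpa [elem_upair] using hz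
  exact hz' _ h hz

theorem elem_asymm {a b : M} (h : a ε b) : ¬ b ε a := by
  intro h'
  obtain ⟨z, hz, hz'⟩ := exists_minimal_elem (a := upair a b) ⟨a, elem_upair.2 (Or.inl rfl)⟩
  rcases elem_upair.1 hz with rfl | rfl
  · exact hz' _ h' (elem_upair.2 (Or.inr rfl))
  · exact hz' _ h (elem_upair.2 (Or.inl rfl))

/-- The successor operation is injective. -/
theorem ins_self_inj {m n : M} (h : ins m m = ins n n) : m = n := by
  have h1 : m ε ins n n := h ▸ elem_ins.2 (Or.inr rfl)
  have h2 : n ε ins m m := h ▸ elem_ins.2 (Or.inr rfl)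
  rcases elem_ins.1 h1 with h1 | h1
  · rcases elem_ins.1 h2 with h2 | h2
    · exact absurd h2 (elem_asymm h1)
    · exact h2.symm
  · exact h1

theorem ins_ne_emp {m n : M} : ins m n ≠ emp M := fun h =>
  not_elem_emp n (h ▸ elem_ins.2 (Or.inr rfl))

/-- Strong replacement: the image of a set under a definable partial function is a set. -/
theorem exists_image (R : M → M → Prop) [h : Def Set.univ fun v : ℕ → M => R (v 0) (v 1)] (a : M)
    (hR : ∀ x, x ε a → ∀ y z, R x y → R x z → y = z) :
    ∃ b, ∀ y, y ε b ↔ ∃ x, x ε a ∧ R x y := by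
  have i1 : ∀ f : (ℕ → M) → M, DefFun Set.univ f → Def Set.univ fun v => ∃ y, R (f v) y :=
    fun f hf => Def.rel₁ (R := fun x => ∃ y, R x y)
      (@Def.ex _ _ _ (fun v y => R (v 0) y) (h.relabel fun n => 1 - n)) hf
  have := i1 (fun v => v 0) inferInstance
  obtain ⟨a', ha'⟩ := exists_sep (fun x => ∃ y, R x y) a
  obtain ⟨b, hb⟩ := exists_repl R a' fun x hx => by
    obtain ⟨hx, y, hy⟩ := (ha' x).1 hx
    exact ⟨y, hy, fun z hz => hR x hx _ _ hz hy⟩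
  have : Def Set.univ fun v : ℕ → M => R (v 0) (v 1) := h
  have : Def Set.univ fun v : ℕ → M => ∃ x, x ε a ∧ R x (v 0) := 
    @Def.ex _ _ _ (fun v x => x ε a ∧ R x (v 0)) (@Def.and _ _ _ _ _ inferInstance h)
  obtain ⟨c, hc⟩ := exists_sep (fun y => ∃ x, x ε a ∧ R x y) b
  refine ⟨c, fun y => (hc y).trans ⟨And.right, fun hy => ⟨?_, hy⟩⟩⟩
  obtain ⟨x, hx, hxy⟩ := hy
  obtain ⟨y', hy', hxy'⟩ := hb x ((ha' x).2 ⟨hx, y, hxy⟩)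
  exact hR x hx _ _ hxy hxy' ▸ hy'

/-- `J` contains `∅` and is closed under successor. -/
def Ind (J : M) : Prop := emp M ε J ∧ ∀ y, y ε J → ins y y ε J

instance Def.ind {f : (ℕ → M) → M} [hf : DefFun A f] : Def A fun v => Ind (f v) :=
  Def.rel₁ (by unfold Ind; infer_instance) hf

variable (M) in
theorem exists_omega : ∃ w : M, Ind w ∧ ∀ J, Ind J → Incl w J := by
  obtain ⟨I, ⟨e, he, he'⟩, hI⟩ := exists_inductive M
  obtain ⟨w, hw⟩ := exists_sep (fun n => ∀ J : M, Ind J → n ε J) I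
  have hI' : Ind I := by
    refine ⟨eq_emp_iff.2 he' ▸ he, fun y hy => ?_⟩
    obtain ⟨s, hs, hs'⟩ := hI y hy
    rwa [show ins y y = s from ext_elem fun z => by rw [elem_ins, hs'] ]
  refine ⟨w, ⟨(hw _).2 ⟨hI'.1, fun J hJ => hJ.1⟩, fun y hy => ?_⟩, fun J hJ n hn =>
    ((hw n).1 hn).2 J hJ⟩
  obtain ⟨h1, h2⟩ := (hw y).1 hy
  exact (hw _).2 ⟨hI'.2 _ h1, fun J hJ => hJ.2 _ (h2 J hJ)⟩

/-- A definable total function can be iterated: every element lies in a closed set. -/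
theorem exists_closed (R : M → M → Prop)
    (h : Def Set.univ fun v : ℕ → M => R (v 0) (v 1)) (hR : ∀ y, ∃! z, R y z) (x : M) :
    ∃ C, x ε C ∧ ∀ y, y ε C → ∀ z, R y z → z ε C := by
  obtain ⟨w, hw, hmin⟩ := exists_omega M
  have iR : ∀ {f g : (ℕ → M) → M} [DefFun Set.univ f] [DefFun Set.univ g],
    Def Set.univ fun v => R (f v) (g v) := fun {_ _} hf hg => Def.rel₂ h hf hg
  let S : M → Prop := fun f => ∀ m z, pr m z ε f → (m = emp M ∧ z = x) ∨
    ∃ m' z', m = ins m' m' ∧ pr m' z' ε f ∧ R z' z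
  let K : M → M → Prop := fun n y => ∃ f, pr n y ε f ∧ S f
  have iK : ∀ {f g : (ℕ → M) → M} [DefFun Set.univ f] [DefFun Set.univ g],
    Def Set.univ fun v => K (f v) (g v) := fun {_ _} hf hg => Def.rel₂ (by
      unfold K S; infer_instance) hf hg
  have K0 : ∀ y, K (emp M) y ↔ y = x := by
    refine fun y => ⟨fun ⟨f, hf, hS⟩ => ?_, ?_⟩
    · rcases hS _ _ hf with h | ⟨m, z, h, -⟩
      · exact h.2
      · exact absurd h.symm ins_ne_emp
    · rintro rfl
      refine ⟨ins (emp M) (pr (emp M) y), elem_ins.2 (Or.inr rfl), fun m z hm => Or.inl ?_⟩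
      simpa [elem_ins, not_elem_emp, pr_inj] using hm
  have Ks : ∀ n y, K (ins n n) y ↔ ∃ z, K n z ∧ R z y := by
    refine fun n y => ⟨fun ⟨f, hf, hS⟩ => ?_, ?_⟩
    · rcases hS _ _ hf with h | ⟨m, z, h, h', hz⟩
      · exact absurd h.1 ins_ne_emp
      · exact ⟨z, ⟨f, ins_self_inj h ▸ h', hS⟩, hz⟩
    · rintro ⟨z, ⟨f, hf, hS⟩, hz⟩
      refine ⟨ins f (pr (ins n n) y), elem_ins.2 (Or.inr rfl), fun m z' hm => ?_⟩
      rcases elem_ins.1 hm with hm | hm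
      · rcases hS _ _ hm with h | ⟨m', z'', h, h', h''⟩
        · exact Or.inl h
        · exact Or.inr ⟨m', z'', h, elem_ins.2 (Or.inl h'), h''⟩
      · obtain ⟨rfl, rfl⟩ := pr_inj.1 hm
        exact Or.inr ⟨n, z, rfl, elem_ins.2 (Or.inl hf), hz⟩
  have KU : ∀ n, n ε w → ∃ y, K n y ∧ ∀ z, K n z → z = y := by
    obtain ⟨J, hJ⟩ := exists_sep (fun n => ∃ y, K n y ∧ ∀ z, K n z → z = y) w
    refine fun n hn => ((hJ n).1 (hmin J ⟨(hJ _).2 ⟨hw.1, x, (K0 x).2 rfl, fun z hz => (K0 z).1 hz⟩,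
      fun n hn => ?_⟩ n hn)).2
    obtain ⟨hn, y, hy, hy'⟩ := (hJ n).1 hn
    obtain ⟨z, hz, hz'⟩ := hR y
    refine (hJ _).2 ⟨hw.2 _ hn, z, (Ks _ _).2 ⟨y, hy, hz⟩, fun z' h => ?_⟩
    obtain ⟨y', h1, h2⟩ := (Ks _ _).1 h
    exact hz' _ (hy' _ h1 ▸ h2)
  obtain ⟨C, hC⟩ := exists_image K w fun n hn y z hy hz => by
    obtain ⟨u, -, hu⟩ := KU n hn
    rw [hu y hy, hu z hz]
  refine ⟨C, (hC x).2 ⟨_, hw.1, (K0 x).2 rfl⟩, fun y hy z hz => ?_⟩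
  obtain ⟨n, hn, hn'⟩ := (hC y).1 hy
  exact (hC z).2 ⟨_, hw.2 n hn, (Ks n z).2 ⟨y, hn', hz⟩⟩

/-- Every element lies in a transitive set. -/
theorem exists_transitive (x : M) : ∃ t, x ε t ∧ ∀ y, y ε t → Incl y t := by
  obtain ⟨C, hC, hC'⟩ := exists_closed (fun y z : M => z = sUn y) inferInstance
    (fun y => ⟨_, rfl, fun _ h => h⟩) (upair x x)
  refine ⟨sUn C, elem_sUn.2 ⟨_, hC, elem_upair.2 (Or.inl rfl)⟩, fun y hy z hz => ?_⟩
  obtain ⟨u, hu, hyu⟩ := elem_sUn.1 hy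
  exact elem_sUn.2 ⟨_, hC' u hu _ rfl, elem_sUn.2 ⟨y, hyu, hz⟩⟩

/-- A nonempty definable class has an `∈`-minimal element. -/
theorem exists_minimal_class (P : M → Prop) [Def Set.univ fun v : ℕ → M => P (v 0)]
    (h : ∃ x, P x) : ∃ x, P x ∧ ∀ y, y ε x → ¬ P y := by
  obtain ⟨x, hx⟩ := h
  obtain ⟨t, ht, ht'⟩ := exists_transitive x
  obtain ⟨s, hs⟩ := exists_sep P t
  obtain ⟨z, hz, hz'⟩ := exists_minimal_elem (a := s) ⟨x, (hs x).2 ⟨ht, hx⟩⟩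
  obtain ⟨h1, h2⟩ := (hs z).1 hz
  exact ⟨z, h2, fun y hy hP => hz' y hy ((hs y).2 ⟨ht' z h1 y hy, hP⟩)⟩

theorem elem_induction (P : M → Prop) [h : Def Set.univ fun v : ℕ → M => P (v 0)]
    (ih : ∀ x, (∀ y, y ε x → P y) → P x) (x : M) : P x := by
  by_contra hx
  obtain ⟨x, hx, hx'⟩ := exists_minimal_class (fun x => ¬ P x) ⟨x, hx⟩
  exact hx (ih x fun y hy => not_not.1 (hx' y hy))

/-- A nonempty definable class of pairs `⟨X, q⟩` has an element with no predecessor in `q`. -/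
theorem exists_minimal_record (P : M → Prop) [h : Def Set.univ fun v : ℕ → M => P (v 0)]
    (hP : ∃ x, P x) : ∃ x, P x ∧ ∀ X q, x = pr X q → ∀ s, s ε q → ¬ P s := by
  have iP : ∀ {f : (ℕ → M) → M} [DefFun Set.univ f], Def Set.univ fun v => P (f v) :=
    fun {_} hf => Def.rel₁ h hf
  by_contra! H
  obtain ⟨x, hx⟩ := hP
  refine (elem_induction (fun x => ¬ P x ∧ ∀ y, y ε x → ¬ P y ∧ ∀ z, z ε y → ¬ P z) ?_ x).1 hx
  intro x ih
  refine ⟨fun hx => ?_, fun y hy => ⟨(ih y hy).1, fun z hz => ((ih y hy).2 z hz).1⟩⟩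
  obtain ⟨X, q, rfl, s, hs, hPs⟩ := H x hx
  exact ((ih (upair X q) (elem_upair.2 (Or.inr rfl))).2 q (elem_upair.2 (Or.inr rfl))).2 s hs hPs

end Basic

/-! ### Definable recursion by records

A run of a definable rule `γ` is a set `p` of records `⟨X, q⟩`, where `q` is the set of all
earlier records and `X` is the value which `γ` produces from `q`. -/

section Records

variable {M : Type u} [setLang.Structure M] {A : Set M}

/-- A ternary relation definable without parameters. -/
class DefRel (γ : M → M → M → Prop) : Prop where
  out : ∀ A : Set M, Def A fun v => γ (v 0) (v 1) (v 2)

theorem DefRel.def (γ : M → M → M → Prop) [h : DefRel γ] {f g k : (ℕ → M) → M} [hf : DefFun A f]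
    [hg : DefFun A g] [hk : DefFun A k] : Def A fun v => γ (f v) (g v) (k v) :=
  Def.rel₃ (h.out A) hf hg hk

variable [M ⊨ ZF]

/-- `p` contains all predecessors of its records. -/
def Tr (p : M) : Prop := ∀ Y u : M, pr Y u ε p → Incl u p

instance Def.tr {f : (ℕ → M) → M} [hf : DefFun A f] : Def A fun v => Tr (f v) :=
  Def.rel₁ (by unfold Tr; infer_instance) hf

/-- `p` is a run of the rule `γ θ`. -/
def Run (γ : M → M → M → Prop) (θ p : M) : Prop :=
  (∀ s : M, s ε p → ∃ X q : M, s = pr X q ∧ γ θ q X ∧ Tr q) ∧ Tr p ∧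
    ∀ X q Y u : M, pr X q ε p → pr Y u ε p → pr X q ε u ∨ pr X q = pr Y u ∨ pr Y u ε q

instance Def.run {γ : M → M → M → Prop} [h : DefRel γ] {f g : (ℕ → M) → M} [hf : DefFun A f]
    [hg : DefFun A g] : Def A fun v => Run γ (f v) (g v) := by
  have iγ : ∀ {f g k : (ℕ → M) → M} [DefFun A f] [DefFun A g] [DefFun A k],
    Def A fun v => γ (f v) (g v) (k v) := DefRel.def γ
  exact Def.rel₂ (by unfold Run; infer_instance) hf hg

theorem pr_not_elem (X q : M) : ¬ pr X q ε q := by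
  obtain ⟨x, rfl, h⟩ := exists_minimal_record (fun x => x = pr X q) ⟨_, rfl⟩
  exact fun h' => h X q rfl _ h' rfl

variable {γ : M → M → M → Prop} {θ p p' : M}

theorem Run.of_elem (hp : Run γ θ p) {X q : M} (h : pr X q ε p) : Run γ θ q ∧ γ θ q X := by
  obtain ⟨X', q', e, h1, h2⟩ := hp.1 _ h
  obtain ⟨rfl, rfl⟩ := pr_inj.1 e
  have hq := hp.2.1 _ _ h
  exact ⟨⟨fun s hs => hp.1 s (hq s hs), h2, fun X q Y u hX hY => hp.2.2 X q Y u (hq _ hX) (hq _ hY)⟩,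
    h1⟩

theorem Run.exists_first_diff (hp : Run γ θ p) (hp' : Run γ θ p') (h : ¬ Incl p p') :
    ∃ X q : M, pr X q ε p ∧ ¬ pr X q ε p' ∧ ∀ t, t ε q ↔ t ε p ∧ t ε p' := by
  simp only [Incl, not_forall] at h
  obtain ⟨s, hs, hs'⟩ := h
  obtain ⟨s, ⟨hs, hs'⟩, hmin⟩ := exists_minimal_record (fun s => s ε p ∧ ¬ s ε p') ⟨s, hs, hs'⟩
  obtain ⟨X, q, rfl, -, -⟩ := hp.1 s hs
  have hq := hp.2.1 _ _ hs
  refine ⟨X, q, hs, hs', fun t => ⟨fun ht => ⟨hq t ht, ?_⟩, fun ⟨ht, ht'⟩ => ?_⟩⟩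
  · by_contra h
    exact hmin X q rfl t ht ⟨hq t ht, h⟩
  · obtain ⟨Y, u, rfl, -, -⟩ := hp.1 t ht
    rcases hp.2.2 _ _ _ _ hs ht with h | h | h
    · exact absurd (hp'.2.1 _ _ ht' _ h) hs'
    · exact absurd (h ▸ ht') hs'
    · exact h

/-- `γ θ` has at most one value on each run. -/
def Functional (γ : M → M → M → Prop) (θ : M) : Prop :=
  ∀ p X Y, Run γ θ p → γ θ p X → γ θ p Y → X = Y

theorem Run.comparable (hγ : Functional γ θ) (hp : Run γ θ p) (hp' : Run γ θ p') :
    Incl p p' ∨ Incl p' p := by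
  by_contra! h
  obtain ⟨X, q, h1, h2, h3⟩ := hp.exists_first_diff hp' h.1
  obtain ⟨X', q', h1', h2', h3'⟩ := hp'.exists_first_diff hp h.2
  obtain rfl : q = q' := ext_elem fun t => by rw [h3, h3', and_comm]
  obtain rfl := hγ _ _ _ (hp.of_elem h1).1 (hp.of_elem h1).2 (hp'.of_elem h1').2
  exact h2 h1'

theorem Run.incl_or_elem (hγ : Functional γ θ) (hp : Run γ θ p) (hp' : Run γ θ p') {X : M}
    (h : γ θ p X) : Incl p' p ∨ pr X p ε p' := by
  refine or_iff_not_imp_left.2 fun hn => ?_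
  have hi := (hp.comparable hγ hp').resolve_right hn
  obtain ⟨X', q, h1, h2, h3⟩ := hp'.exists_first_diff hp hn
  obtain rfl : q = p := ext_elem fun t => ⟨fun ht => ((h3 t).1 ht).2, fun ht => (h3 t).2 ⟨hi t ht, ht⟩⟩
  rwa [hγ _ _ _ hp h (hp'.of_elem h1).2]

theorem Run.ins (hp : Run γ θ p) {Z : M} (h : γ θ p Z) : Run γ θ (ins p (pr Z p)) := by
  refine ⟨fun s hs => ?_, fun Y u hY t ht => ?_, fun X q Y u hX hY => ?_⟩
  · rcases elem_ins.1 hs with hs | rfl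
    · exact hp.1 s hs
    · exact ⟨Z, p, rfl, h, hp.2.1⟩
  · refine elem_ins.2 (Or.inl ?_)
    rcases elem_ins.1 hY with hY | hY
    · exact hp.2.1 _ _ hY t ht
    · obtain ⟨rfl, rfl⟩ := pr_inj.1 hY
      exact ht
  · rcases elem_ins.1 hX with hX' | hX' <;> rcases elem_ins.1 hY with hY' | hY'
    · exact hp.2.2 _ _ _ _ hX' hY'
    · obtain ⟨rfl, rfl⟩ := pr_inj.1 hY'
      exact Or.inl hX'
    · obtain ⟨rfl, rfl⟩ := pr_inj.1 hX'
      exact Or.inr (Or.inr hY')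
    · exact Or.inr (Or.inl (hX'.trans hY'.symm))

theorem Run.sUn (hγ : Functional γ θ) {S : M} (h : ∀ p, p ε S → Run γ θ p) :
    Run γ θ (sUn S) := by
  refine ⟨fun s hs => ?_, fun Y u hY t ht => ?_, fun X q Y u hX hY => ?_⟩
  · obtain ⟨p, hp, hs⟩ := elem_sUn.1 hs
    exact (h p hp).1 s hs
  · obtain ⟨p, hp, hs⟩ := elem_sUn.1 hY
    exact elem_sUn.2 ⟨p, hp, (h p hp).2.1 _ _ hs t ht⟩
  · obtain ⟨p, hp, hX⟩ := elem_sUn.1 hX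
    obtain ⟨p', hp', hY⟩ := elem_sUn.1 hY
    rcases (h p hp).comparable hγ (h p' hp') with hi | hi
    · exact (h p' hp').2.2 _ _ _ _ (hi _ hX) hY
    · exact (h p hp).2.2 _ _ _ _ hX (hi _ hY)

end Records

/-! ### Levels of the cumulative hierarchy -/

section Levels

variable {M : Type u} [setLang.Structure M] {A : Set M} [M ⊨ ZF]

/-- The rule producing the next level of the cumulative hierarchy. -/
def LevRule (_ p Z : M) : Prop := ∀ z : M, z ε Z ↔ ∃ X q : M, pr X q ε p ∧ Incl z X

instance : DefRel (LevRule (M := M)) := ⟨fun A => by unfold LevRule; infer_instance⟩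

instance Def.levRule {f g : (ℕ → M) → M} [hf : DefFun A f] [hg : DefFun A g] :
    Def A fun v => LevRule (emp M) (f v) (g v) :=
  DefRel.def LevRule

theorem levRule_functional (θ : M) : Functional LevRule θ := fun _ _ _ _ hX hY =>
  ext_elem fun z => (hX z).trans (hY z).symm

theorem exists_levRule (θ p : M) : ∃ Z, LevRule θ p Z := by
  obtain ⟨Z, hZ⟩ := exists_sep (fun z : M => ∃ X q : M, pr X q ε p ∧ Incl z X) (pow (sUn (sUn (sUn p))))
  refine ⟨Z, fun z => (hZ z).trans ⟨And.right, fun h => ⟨elem_pow.2 fun t ht => ?_, h⟩⟩⟩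
  obtain ⟨X, q, h1, h2⟩ := h
  exact elem_sUn.2 ⟨X, elem_sUn.2 ⟨_, elem_sUn.2 ⟨_, h1, elem_upair.2 (Or.inl rfl)⟩,
    elem_upair.2 (Or.inl rfl)⟩, h2 t ht⟩

theorem LevRule.mono {θ p p' Z Z' : M} (h : LevRule θ p Z) (h' : LevRule θ p' Z') (hi : Incl p p') :
    Incl Z Z' := fun z hz => by
  obtain ⟨X, q, h1, h2⟩ := (h z).1 hz
  exact (h' z).2 ⟨X, q, hi _ h1, h2⟩

/-- `X` is a level of the cumulative hierarchy. -/
def Lev (X : M) : Prop := ∃ q : M, Run LevRule (emp M) q ∧ LevRule (emp M) q X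

instance Def.lev {f : (ℕ → M) → M} [hf : DefFun A f] : Def A fun v => Lev (f v) :=
  Def.rel₁ (by unfold Lev; infer_instance) hf

variable {X Y x y : M}

theorem Lev.trichotomy (hX : Lev X) (hY : Lev Y) : X ε Y ∨ X = Y ∨ Y ε X := by
  obtain ⟨q, hq, hX⟩ := hX
  obtain ⟨q', hq', hY⟩ := hY
  rcases hq.incl_or_elem (levRule_functional _) hq' hX with h | h
  · rcases hq'.incl_or_elem (levRule_functional _) hq hY with h' | h'
    · obtain rfl := h.antisymm h'
      exact Or.inr (Or.inl (levRule_functional _ _ _ _ hq hX hY))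
    · exact Or.inr (Or.inr ((hX _).2 ⟨_, _, h', fun _ h => h⟩))
  · exact Or.inl ((hY _).2 ⟨_, _, h, fun _ h => h⟩)

theorem Lev.elem_of_incl (hX : Lev X) (hy : y ε X) (h : Incl x y) : x ε X := by
  obtain ⟨q, -, hX⟩ := hX
  obtain ⟨Y, u, h1, h2⟩ := (hX y).1 hy
  exact (hX x).2 ⟨Y, u, h1, fun t ht => h2 t (h t ht)⟩

theorem Lev.exists_lev (hX : Lev X) (hy : y ε X) : ∃ Y, Lev Y ∧ Y ε X ∧ Incl y Y := by
  obtain ⟨q, hq, hX⟩ := hX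
  obtain ⟨Y, u, h1, h2⟩ := (hX y).1 hy
  exact ⟨Y, ⟨u, hq.of_elem h1⟩, (hX Y).2 ⟨Y, u, h1, fun _ h => h⟩, h2⟩

theorem Lev.trans (hX : Lev X) (hy : y ε X) : Incl y X := by
  intro z hz
  obtain ⟨q, hq, hX⟩ := hX
  obtain ⟨Y, u, h1, h2⟩ := (hX y).1 hy
  exact (hq.of_elem h1).2.mono hX (hq.2.1 _ _ h1) z (h2 z hz)

theorem Lev.comparable (hX : Lev X) (hY : Lev Y) : Incl X Y ∨ Incl Y X := by
  rcases hX.trichotomy hY with h | rfl | h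
  · exact Or.inl (hY.trans h)
  · exact Or.inl fun _ h => h
  · exact Or.inr (hX.trans h)

theorem exists_least_lev (P : M → Prop) [h : Def Set.univ fun v : ℕ → M => P (v 0)]
    (hP : ∃ Z, Lev Z ∧ P Z) : ∃! Z, Lev Z ∧ P Z ∧ ∀ Y, Lev Y → P Y → ¬ Y ε Z := by
  obtain ⟨Z, ⟨hZ, hPZ⟩, h⟩ := exists_minimal_class (fun Z : M => Lev Z ∧ P Z) hP
  refine ⟨Z, ⟨hZ, hPZ, fun Y hY hPY hYZ => h Y hYZ ⟨hY, hPY⟩⟩, fun Z' ⟨hZ', hPZ', h'⟩ => ?_⟩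
  rcases hZ.trichotomy hZ' with h1 | rfl | h1
  · exact absurd h1 (h' Z hZ hPZ)
  · rfl
  · exact absurd ⟨hZ', hPZ'⟩ (h Z' h1)

theorem exists_lev (x : M) : ∃ X, Lev X ∧ x ε X := by
  refine elem_induction (fun x : M => ∃ X, Lev X ∧ x ε X) (fun x ih => ?_) x
  let R : M → M → Prop := fun y q => Run LevRule (emp M) q ∧
    (∃ Z, LevRule (emp M) q Z ∧ y ε Z) ∧ ∀ q', Run LevRule (emp M) q' →
      (∃ Z, LevRule (emp M) q' Z ∧ y ε Z) → Incl q q'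
  have : Def Set.univ fun v : ℕ → M => R (v 0) (v 1) := by unfold R; infer_instance
  obtain ⟨S, hS⟩ := exists_image R x fun y _ q q' hq hq' =>
    (hq.2.2 _ hq'.1 hq'.2.1).antisymm (hq'.2.2 _ hq.1 hq.2.1)
  have hrun : Run LevRule (emp M) (sUn S) := Run.sUn (levRule_functional _) fun p hp => by
    obtain ⟨y, -, hy⟩ := (hS p).1 hp
    exact hy.1
  obtain ⟨Z₀, hZ₀⟩ := exists_levRule (emp M) (sUn S)
  obtain ⟨Z₁, hZ₁⟩ := exists_levRule (emp M) (ins (sUn S) (pr Z₀ (sUn S)))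
  refine ⟨Z₁, ⟨_, hrun.ins hZ₀, hZ₁⟩, (hZ₁ x).2 ⟨Z₀, _, elem_ins.2 (Or.inr rfl), fun y hy => ?_⟩⟩
  obtain ⟨Z, ⟨⟨q, hq, hqZ⟩, hyZ, hmin⟩, -⟩ := exists_least_lev (fun X => y ε X) (ih y hy)
  have hR : R y q := by
    refine ⟨hq, ⟨Z, hqZ, hyZ⟩, fun q' hq' ⟨Z', hqZ', hyZ'⟩ => ?_⟩
    refine (hq'.incl_or_elem (levRule_functional _) hq hqZ').resolve_right fun h => ?_
    exact hmin Z' ⟨q', hq', hqZ'⟩ hyZ' ((hqZ _).2 ⟨_, _, h, fun _ h => h⟩)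
  exact hqZ.mono hZ₀ (fun s hs => elem_sUn.2 ⟨q, (hS q).2 ⟨y, hy, hR⟩, hs⟩) y hyZ

/-- Collection into a level. -/
theorem exists_collection (R : M → M → Prop) [h : Def Set.univ fun v : ℕ → M => R (v 0) (v 1)]
    (a : M) : ∃ L, Lev L ∧ ∀ x, x ε a → (∃ y, R x y) → ∃ y, y ε L ∧ R x y := by
  have iR : ∀ {f g : (ℕ → M) → M} [DefFun Set.univ f] [DefFun Set.univ g],
    Def Set.univ fun v => R (f v) (g v) := fun {_ _} hf hg => Def.rel₂ h hf hg
  obtain ⟨S, hS⟩ := exists_image (fun x Z : M => Lev Z ∧ (∃ y, y ε Z ∧ R x y) ∧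
    ∀ Y, Lev Y → (∃ y, y ε Y ∧ R x y) → ¬ Y ε Z) a fun x _ Z Z' hZ hZ' =>
      (exists_least_lev (fun Z => ∃ y, y ε Z ∧ R x y) ⟨Z, hZ.1, hZ.2.1⟩).unique hZ hZ'
  obtain ⟨L, hL, hSL⟩ := exists_lev S
  refine ⟨L, hL, fun x hx ⟨y, hy⟩ => ?_⟩
  obtain ⟨X, hX, hyX⟩ := exists_lev y
  obtain ⟨Z, hZ, -⟩ := exists_least_lev (fun Z => ∃ y, y ε Z ∧ R x y) ⟨X, hX, y, hyX, hy⟩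
  obtain ⟨y', hy', hR⟩ := hZ.2.1
  exact ⟨y', hL.trans (hL.trans hSL _ ((hS Z).2 ⟨x, hx, hZ⟩)) _ hy', hR⟩

end Levels

/-! ### A point-free presentation of formulas, and reflection -/

section Reflection

theorem setLang_term_eq {n : ℕ} (t : setLang.Term (Empty ⊕ Fin n)) :
    ∃ i, t = Term.var (Sum.inr i) := by
  cases t with
  | var i =>
    rcases i with i | i
    · exact i.elim
    · exact ⟨i, rfl⟩
  | func f _ => exact Empty.elim f

/-- Point-free terms denoting classes of tuples `⟨xₙ, ⟨xₙ₋₁, …⟩⟩`. -/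
inductive Op : Type
  | bot : Op
  | mem : Op
  | memSwap : Op
  | eq : Op
  | imp : Op → Op → Op
  | all : Op → Op
  | drop : Op → Op
  | skip : Op → Op

variable {M : Type u} [setLang.Structure M] {A : Set M} [M ⊨ ZF]

/-- The class denoted by a point-free term. -/
def Op.Holds : Op → M → Prop
  | bot, _ => False
  | mem, t => ∃ x y s : M, t = pr x (pr y s) ∧ x ε y
  | memSwap, t => ∃ x y s : M, t = pr x (pr y s) ∧ y ε x
  | eq, t => ∃ x y s : M, t = pr x (pr y s) ∧ x = y
  | imp a b, t => a.Holds t → b.Holds t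
  | all a, t => ∀ x : M, a.Holds (pr x t)
  | drop a, t => ∃ x s : M, t = pr x s ∧ a.Holds s
  | skip a, t => ∃ x y s : M, t = pr x (pr y s) ∧ a.Holds (pr x s)

instance Def.holds (τ : Op) {f : (ℕ → M) → M} [hf : DefFun A f] :
    Def A fun v => τ.Holds (f v) := by
  refine Def.rel₁ ?_ hf
  clear hf
  induction τ with
  | bot | mem | memSwap | eq => unfold Op.Holds; infer_instance
  | imp a b iha ihb => exact Def.imp
  | all a ih | drop a ih | skip a ih =>
    have : ∀ {f : (ℕ → M) → M} [DefFun A f], Def A fun v => a.Holds (f v) :=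
      fun {_} hf => Def.rel₁ ih hf
    unfold Op.Holds
    infer_instance

/-- The tuple coding a finite sequence. -/
noncomputable def code : {n : ℕ} → (Fin n → M) → M
  | 0, _ => emp M
  | _ + 1, xs => pr (xs (Fin.last _)) (code fun i => xs i.castSucc)

theorem code_snoc {n : ℕ} (xs : Fin n → M) (x : M) :
    code (Fin.snoc xs x : Fin (n + 1) → M) = pr x (code xs) := by
  simp [code]

theorem Op.exists_lookup (b : Op) (R : M → M → Prop)
    (hb : ∀ x y s, b.Holds (pr x (pr y s)) ↔ R x y) {n : ℕ} (j : Fin n) :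
    ∃ τ : Op, ∀ x (xs : Fin n → M), τ.Holds (pr x (code xs)) ↔ R x (xs j) := by
  induction n with
  | zero => exact j.elim0
  | succ n ih =>
    refine Fin.lastCases ⟨b, fun x xs => hb _ _ _⟩ (fun j => ?_) j
    obtain ⟨τ, hτ⟩ := ih j
    refine ⟨τ.skip, fun x xs => ?_⟩
    refine Iff.trans ?_ (hτ x fun i => xs i.castSucc)
    simp only [Holds, code, pr_inj]
    constructor
    · rintro ⟨x', y, s, ⟨rfl, rfl, rfl⟩, h⟩
      exact h
    · exact fun h => ⟨_, _, _, ⟨rfl, rfl, rfl⟩, h⟩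

theorem Op.exists_atom (b b' d : Op) (R : M → M → Prop)
    (hb : ∀ x y s, b.Holds (pr x (pr y s)) ↔ R x y)
    (hb' : ∀ x y s, b'.Holds (pr x (pr y s)) ↔ R y x)
    (hd : ∀ x t, d.Holds (pr x t) ↔ R x x) {n : ℕ} (i j : Fin n) :
    ∃ τ : Op, ∀ xs : Fin n → M, τ.Holds (code xs) ↔ R (xs i) (xs j) := by
  induction n with
  | zero => exact j.elim0
  | succ n ih =>
    refine Fin.lastCases (Fin.lastCases ?_ (fun j => ?_) j) (fun i => Fin.lastCases ?_ (fun j => ?_) j) i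
    · exact ⟨d, fun xs => hd _ _⟩
    · obtain ⟨τ, hτ⟩ := exists_lookup b R hb j
      exact ⟨τ, fun xs => hτ _ _⟩
    · obtain ⟨τ, hτ⟩ := exists_lookup b' (fun x y => R y x) hb' i
      exact ⟨τ, fun xs => hτ _ _⟩
    · obtain ⟨τ, hτ⟩ := ih i j
      refine ⟨τ.drop, fun xs => ?_⟩
      refine Iff.trans ?_ (hτ fun i => xs i.castSucc)
      simp only [Holds, code, pr_inj]
      exact ⟨fun ⟨_, _, ⟨_, h⟩, h'⟩ => h ▸ h', fun h => ⟨_, _, ⟨rfl, rfl⟩, h⟩⟩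

/-- Every formula is expressed by a point-free term. -/
theorem exists_op {n : ℕ} (φ : setLang.BoundedFormula Empty n) :
    ∃ τ : Op, ∀ xs : Fin n → M, τ.Holds (code xs) ↔ φ.Realize default xs := by
  induction φ with
  | falsum => exact ⟨.bot, fun xs => Iff.rfl⟩
  | equal t₁ t₂ =>
    obtain ⟨i, rfl⟩ := setLang_term_eq t₁
    obtain ⟨j, rfl⟩ := setLang_term_eq t₂
    refine Op.exists_atom .eq .eq (.imp .bot .bot) (fun x y => x = y) ?_ ?_ ?_ i j
    · intro x y s
      simp only [Op.Holds, pr_inj]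
      exact ⟨fun ⟨_, _, _, ⟨h1, h2, _⟩, h⟩ => h1.trans (h.trans h2.symm),
        fun h => ⟨_, _, _, ⟨rfl, rfl, rfl⟩, h⟩⟩
    · intro x y s
      simp only [Op.Holds, pr_inj]
      exact ⟨fun ⟨_, _, _, ⟨h1, h2, _⟩, h⟩ => (h1.trans (h.trans h2.symm)).symm,
        fun h => ⟨_, _, _, ⟨rfl, rfl, rfl⟩, h.symm⟩⟩
    · simp [Op.Holds]
  | rel r ts =>
    obtain ⟨rfl⟩ := r
    obtain ⟨i, hi⟩ := setLang_term_eq (ts 0)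
    obtain ⟨j, hj⟩ := setLang_term_eq (ts 1)
    obtain ⟨τ, hτ⟩ := Op.exists_atom .mem .memSwap .bot (fun x y : M => x ε y) (by
      intro x y s
      simp only [Op.Holds, pr_inj]
      exact ⟨fun ⟨_, _, _, ⟨h1, h2, _⟩, h⟩ => h1 ▸ h2 ▸ h,
        fun h => ⟨_, _, _, ⟨rfl, rfl, rfl⟩, h⟩⟩) (by
      intro x y s
      simp only [Op.Holds, pr_inj]
      exact ⟨fun ⟨_, _, _, ⟨h1, h2, _⟩, h⟩ => h1 ▸ h2 ▸ h,
        fun h => ⟨_, _, _, ⟨rfl, rfl, rfl⟩, h⟩⟩) (by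
      simp [Op.Holds, not_elem_self]) i j
    refine ⟨τ, fun xs => (hτ xs).trans (iff_of_eq ?_)⟩
    refine congrArg (Structure.RelMap memRel) (funext fun k => ?_)
    fin_cases k
    · simp [hi]
    · simp [hj]
  | imp φ ψ ihφ ihψ =>
    obtain ⟨a, ha⟩ := ihφ
    obtain ⟨b, hb⟩ := ihψ
    exact ⟨.imp a b, fun xs => by simp only [Op.Holds, realize_imp, ha, hb]⟩
  | all φ ih =>
    obtain ⟨a, ha⟩ := ih
    exact ⟨.all a, fun xs => by simp only [Op.Holds, realize_all, ← ha, code_snoc]⟩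

/-- `w` contains counterexamples to all quantifiers of `τ` that fail at `t`. -/
def Op.Step : Op → M → M → Prop
  | imp a b, t, w => a.Step t w ∧ b.Step t w
  | all a, t, w => a.Step t w ∧ ((∃ x : M, ¬ a.Holds (pr x t)) → ∃ x : M, x ε w ∧ ¬ a.Holds (pr x t))
  | drop a, t, w => a.Step t w
  | skip a, t, w => a.Step t w
  | _, _, _ => True

instance Def.step (τ : Op) {f g : (ℕ → M) → M} [hf : DefFun A f] [hg : DefFun A g] :
    Def A fun v => τ.Step (f v) (g v) := by
  refine Def.rel₂ ?_ hf hg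
  clear hf hg
  induction τ <;> unfold Op.Step <;> infer_instance

theorem Op.Step.mono {τ : Op} {t w w' : M} (h : τ.Step t w) (hw : Incl w w') : τ.Step t w' := by
  induction τ with
  | bot | mem | memSwap | eq => trivial
  | imp a b iha ihb => exact ⟨iha h.1, ihb h.2⟩
  | drop a ih | skip a ih => exact ih h
  | all a ih =>
    refine ⟨ih h.1, fun hx => ?_⟩
    obtain ⟨x, hx, hx'⟩ := h.2 hx
    exact ⟨x, hw x hx, hx'⟩

theorem Op.exists_step (τ : Op) (t : M) : ∃ w, τ.Step t w := by
  induction τ with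
  | bot | mem | memSwap | eq => exact ⟨t, trivial⟩
  | drop a ih | skip a ih => exact ih
  | imp a b iha ihb =>
    obtain ⟨w, hw⟩ := iha
    obtain ⟨w', hw'⟩ := ihb
    refine ⟨sUn (upair w w'), hw.mono fun z hz => ?_, hw'.mono fun z hz => ?_⟩
    · exact elem_sUn.2 ⟨w, elem_upair.2 (Or.inl rfl), hz⟩
    · exact elem_sUn.2 ⟨w', elem_upair.2 (Or.inr rfl), hz⟩
  | all a ih =>
    obtain ⟨w, hw⟩ := ih
    by_cases h : ∃ x : M, ¬ a.Holds (pr x t)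
    · obtain ⟨x, hx⟩ := h
      exact ⟨ins w x, hw.mono fun z hz => elem_ins.2 (Or.inl hz), fun _ =>
        ⟨x, elem_ins.2 (Or.inr rfl), hx⟩⟩
    · exact ⟨w, hw, fun h' => absurd h' h⟩

/-- Reflection: arbitrarily high levels are closed under pairs and counterexamples for `τ`. -/
theorem exists_reflecting (τ : Op) (a : M) : ∃ θ, Lev θ ∧ a ε θ ∧
    (∀ u v, u ε θ → v ε θ → pr u v ε θ) ∧ ∀ t, t ε θ → τ.Step t θ := by
  let P : M → M → Prop := fun y z => y ε z ∧ (∀ t, t ε y → τ.Step t z) ∧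
    ∀ u v, u ε y → v ε y → pr u v ε z
  have iP : ∀ {f g : (ℕ → M) → M} [DefFun Set.univ f] [DefFun Set.univ g],
    Def Set.univ fun v => P (f v) (g v) := fun {_ _} hf hg => Def.rel₂ (by
      unfold P; infer_instance) hf hg
  let R : M → M → Prop := fun y z => Lev z ∧ P y z ∧ ∀ z', Lev z' → P y z' → ¬ z' ε z
  have hR : ∀ y, ∃! z, R y z := by
    refine fun y => exists_least_lev (P y) ?_
    obtain ⟨L, hL, hL'⟩ := exists_collection (τ.Step (M := M)) y
    obtain ⟨z, hz, hz'⟩ := exists_lev (upair L (pow (pow y)))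
    have h1 : Incl L z := hz.trans (hz.trans hz' _ (elem_upair.2 (Or.inl rfl)))
    have h2 : Incl (pow (pow y)) z := hz.trans (hz.trans hz' _ (elem_upair.2 (Or.inr rfl)))
    refine ⟨z, hz, hz.trans (h2 (pow y) (elem_pow.2 fun _ h => h)) _ (elem_pow.2 fun _ h => h),
      fun t ht => ?_, fun u v hu hv => h2 _ (elem_pow.2 fun s hs => elem_pow.2 fun r hr => ?_)⟩
    · obtain ⟨w, hw, hw'⟩ := hL' t ht (τ.exists_step t)
      exact hw'.mono fun s hs => h1 _ (hL.trans hw s hs)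
    · rcases elem_upair.1 hs with rfl | rfl <;> rcases elem_upair.1 hr with rfl | rfl <;> assumption
  obtain ⟨y₀, hy₀, hay₀⟩ := exists_lev a
  obtain ⟨C, hC, hC'⟩ := exists_closed R (by unfold R; infer_instance) hR y₀
  obtain ⟨z₀, hz₀, hCz₀⟩ := exists_lev C
  obtain ⟨θ, ⟨hθ, hCθ, hmin⟩, -⟩ := exists_least_lev
    (fun θ : M => ∀ r, r ε C → Lev r → Incl r θ) ⟨z₀, hz₀, fun r hr _ => hz₀.trans (hz₀.trans hCz₀ r hr)⟩
  have key : ∀ z, z ε θ → ∃ r, r ε C ∧ Lev r ∧ z ε r := by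
    intro z hz
    obtain ⟨Y, hY, hYθ, hzY⟩ := hθ.exists_lev hz
    by_contra! hn
    refine hmin Y hY (fun r hr hr' => ?_) hYθ
    rcases hr'.trichotomy hY with h | rfl | h
    · exact hY.trans h
    · exact fun _ h => h
    · exact absurd (hr'.elem_of_incl h hzY) (hn r hr hr')
  have next : ∀ r, r ε C → ∃ r', P r r' ∧ Incl r' θ := by
    intro r hr
    obtain ⟨r', hr', -⟩ := hR r
    exact ⟨r', hr'.2.1, hCθ r' (hC' r hr r' hr') hr'.1⟩
  refine ⟨θ, hθ, hCθ y₀ hC hy₀ a hay₀, fun u v hu hv => ?_, fun t ht => ?_⟩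
  · obtain ⟨r, hr, hLr, hur⟩ := key u hu
    obtain ⟨s, hs, hLs, hvs⟩ := key v hv
    rcases hLr.comparable hLs with h | h
    · obtain ⟨r', hP, hr'⟩ := next s hs
      exact hr' _ (hP.2.2 u v (h u hur) hvs)
    · obtain ⟨r', hP, hr'⟩ := next r hr
      exact hr' _ (hP.2.2 u v hur (h v hvs))
  · obtain ⟨r, hr, hLr, hur⟩ := key t ht
    obtain ⟨r', hP, hr'⟩ := next r hr
    exact (hP.2.1 t hur).mono hr'

end Reflection

/-! ### The definably well-ordered algebra of definable subsets of a level -/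

section Algebra

variable {M : Type u} [setLang.Structure M] {A : Set M} [M ⊨ ZF]

/-- The basic operations on subsets of `θ`, mirroring the constructors of `Op`. -/
def BasicHolds : Fin 7 → M → M → M → M → Prop
  | 0, _, _, _, t => ∃ x y s : M, t = pr x (pr y s) ∧ x ε y
  | 1, _, _, _, t => ∃ x y s : M, t = pr x (pr y s) ∧ y ε x
  | 2, _, _, _, t => ∃ x y s : M, t = pr x (pr y s) ∧ x = y
  | 3, _, X, Y, t => t ε X → t ε Y
  | 4, θ, X, _, t => ∀ x : M, x ε θ → pr x t ε X
  | 5, _, X, _, t => ∃ x s : M, t = pr x s ∧ s ε X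
  | 6, _, X, _, t => ∃ x y s : M, t = pr x (pr y s) ∧ pr x s ε X

instance Def.basicHolds (i : Fin 7) {f g k l : (ℕ → M) → M} [hf : DefFun A f] [hg : DefFun A g]
    [hk : DefFun A k] [hl : DefFun A l] : Def A fun v => BasicHolds i (f v) (g v) (k v) (l v) :=
  Def.rel₄ (by fin_cases i <;> simp only [BasicHolds] <;> infer_instance) hf hg hk hl

theorem exists_basic (i : Fin 7) (θ X Y : M) :
    ∃ Z, ∀ t, t ε Z ↔ t ε θ ∧ BasicHolds i θ X Y t :=
  exists_sep (fun t => BasicHolds i θ X Y t) θ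

/-- The result of applying a basic operation. -/
noncomputable def basic (i : Fin 7) (θ X Y : M) : M := (exists_basic i θ X Y).choose

theorem elem_basic {i : Fin 7} {θ X Y t : M} :
    t ε basic i θ X Y ↔ t ε θ ∧ BasicHolds i θ X Y t := (exists_basic i θ X Y).choose_spec t

instance DefFun.basic (i : Fin 7) {f g k : (ℕ → M) → M} [hf : DefFun A f] [hg : DefFun A g]
    [hk : DefFun A k] : DefFun A fun v => basic i (f v) (g v) (k v) :=
  DefFun.app₃ (Def.congr (P := fun v => ∀ t, t ε v 0 ↔ t ε v 1 ∧ BasicHolds i (v 1) (v 2) (v 3) t)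
    fun _ => (eq_iff_elem fun _ => elem_basic).symm) hf hg hk

/-- `X` is the value of some record of `p`. -/
def Fld (p X : M) : Prop := ∃ q : M, pr X q ε p

instance Def.fld {f g : (ℕ → M) → M} [hf : DefFun A f] [hg : DefFun A g] :
    Def A fun v => Fld (f v) (g v) :=
  Def.rel₂ (by unfold Fld; infer_instance) hf hg

/-- The `i`-th operation applied to the values `X`, `Y` of `p` gives a new value. -/
def Cand (i : Fin 7) (θ p X Y : M) : Prop := Fld p X ∧ Fld p Y ∧ ¬ Fld p (basic i θ X Y)

instance Def.cand (i : Fin 7) {f g k l : (ℕ → M) → M} [hf : DefFun A f] [hg : DefFun A g]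
    [hk : DefFun A k] [hl : DefFun A l] : Def A fun v => Cand i (f v) (g v) (k v) (l v) :=
  Def.rel₄ (by unfold Cand; infer_instance) hf hg hk hl

/-- `X` is the first possible left argument for the `i`-th operation. -/
def LeastLeft (i : Fin 7) (θ p X : M) : Prop :=
  ∃ q : M, pr X q ε p ∧ (∃ Y : M, Cand i θ p X Y) ∧
    ∀ X' q' : M, pr X' q' ε q → ¬ ∃ Y : M, Cand i θ p X' Y

instance Def.leastLeft (i : Fin 7) {f g k : (ℕ → M) → M} [hf : DefFun A f] [hg : DefFun A g]
    [hk : DefFun A k] : Def A fun v => LeastLeft i (f v) (g v) (k v) :=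
  Def.rel₃ (by unfold LeastLeft; infer_instance) hf hg hk

/-- `Y` is the first possible right argument for the `i`-th operation with left argument `X`. -/
def LeastRight (i : Fin 7) (θ p X Y : M) : Prop :=
  ∃ q : M, pr Y q ε p ∧ Cand i θ p X Y ∧ ∀ Y' q' : M, pr Y' q' ε q → ¬ Cand i θ p X Y'

instance Def.leastRight (i : Fin 7) {f g k l : (ℕ → M) → M} [hf : DefFun A f] [hg : DefFun A g]
    [hk : DefFun A k] [hl : DefFun A l] : Def A fun v => LeastRight i (f v) (g v) (k v) (l v) :=
  Def.rel₄ (by unfold LeastRight; infer_instance) hf hg hk hl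

/-- The rule enumerating the closure of `{∅}` under the basic operations. -/
def AlgRule (θ p Z : M) : Prop :=
  (p = emp M ∧ Z = emp M) ∨ (p ≠ emp M ∧ ∃ i : Fin 7,
    (¬ ∃ j : Fin 7, j < i ∧ ∃ X Y : M, Cand j θ p X Y) ∧
      ∃ X Y : M, LeastLeft i θ p X ∧ LeastRight i θ p X Y ∧ Z = basic i θ X Y)

instance : DefRel (AlgRule (M := M)) := ⟨fun A => by unfold AlgRule; infer_instance⟩

instance Def.algRule {f g k : (ℕ → M) → M} [hf : DefFun A f] [hg : DefFun A g]
    [hk : DefFun A k] : Def A fun v => AlgRule (f v) (g v) (k v) :=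
  DefRel.def AlgRule

variable {θ p : M}

theorem Run.least_unique {γ : M → M → M → Prop} (hp : Run γ θ p) {K : M → Prop} {X X' q q' : M}
    (h : pr X q ε p) (hK : K X) (hm : ∀ Y u : M, pr Y u ε q → ¬ K Y)
    (h' : pr X' q' ε p) (hK' : K X') (hm' : ∀ Y u : M, pr Y u ε q' → ¬ K Y) : X = X' := by
  rcases hp.2.2 _ _ _ _ h h' with e | e | e
  · exact absurd hK (hm' _ _ e)
  · exact (pr_inj.1 e).1
  · exact absurd hK' (hm _ _ e)

theorem Run.exists_least {γ : M → M → M → Prop} (hp : Run γ θ p) (K : M → Prop)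
    [h : Def Set.univ fun v : ℕ → M => K (v 0)] {X : M} (hX : Fld p X) (hK : K X) :
    ∃ X q : M, pr X q ε p ∧ K X ∧ ∀ Y u : M, pr Y u ε q → ¬ K Y := by
  have iK : ∀ {f : (ℕ → M) → M} [DefFun Set.univ f], Def Set.univ fun v => K (f v) :=
    fun {_} hf => Def.rel₁ h hf
  obtain ⟨q, hq⟩ := hX
  obtain ⟨s, ⟨hs, X, q, rfl, hX⟩, hmin⟩ := exists_minimal_record
    (fun s : M => s ε p ∧ ∃ X q : M, s = pr X q ∧ K X) ⟨_, hq, X, q, rfl, hK⟩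
  exact ⟨X, q, hs, hX, fun Y u hY hKY =>
    hmin X q rfl _ hY ⟨hp.2.1 _ _ hs _ hY, Y, u, rfl, hKY⟩⟩

theorem algRule_functional (θ : M) : Functional AlgRule θ := by
  rintro p Z Z' hp (⟨h, rfl⟩ | ⟨h, i, hi, X, Y, hX, hY, rfl⟩)
    (⟨h', rfl⟩ | ⟨h', j, hj, X', Y', hX', hY', rfl⟩)
  · rfl
  · exact absurd h h'
  · exact absurd h' h
  · obtain ⟨q, hq, hqX, hqm⟩ := hX
    obtain ⟨q', hq', hqX', hqm'⟩ := hX'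
    obtain ⟨u, hu, huY, hum⟩ := hY
    obtain ⟨u', hu', huY', hum'⟩ := hY'
    rcases lt_trichotomy i j with hij | rfl | hij
    · exact absurd ⟨i, hij, X, Y, huY⟩ hj
    · obtain rfl := hp.least_unique (K := fun X => ∃ Y, Cand i θ p X Y) hq hqX hqm hq' hqX' hqm'
      obtain rfl := hp.least_unique (K := fun Y => Cand i θ p X Y) hu huY hum hu' huY' hum'
      rfl
    · exact absurd ⟨j, hij, X', Y', huY'⟩ hi

theorem AlgRule.incl {Z : M} (h : AlgRule θ p Z) : Incl Z θ := by
  rcases h with ⟨-, rfl⟩ | ⟨-, i, -, X, Y, -, -, rfl⟩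
  · exact fun z hz => absurd hz (not_elem_emp z)
  · exact fun z hz => (elem_basic.1 hz).1

theorem AlgRule.not_fld {Z : M} (h : AlgRule θ p Z) : ¬ Fld p Z := by
  rcases h with ⟨rfl, -⟩ | ⟨-, i, -, X, Y, -, ⟨q, -, hq, -⟩, rfl⟩
  · exact fun ⟨q, hq⟩ => not_elem_emp _ hq
  · exact hq.2.2

theorem exists_terminal_run (θ : M) : ∃ p, Run AlgRule θ p ∧ ∀ Z, ¬ AlgRule θ p Z := by
  by_contra! H
  have hγ := algRule_functional θ
  obtain ⟨S, hS⟩ := exists_image (fun Z q : M => Run AlgRule θ q ∧ AlgRule θ q Z) (pow θ)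
    fun Z _ q q' h h' =>
      ((h'.1.incl_or_elem hγ h.1 h'.2).resolve_right fun e => h.2.not_fld ⟨_, e⟩).antisymm
        ((h.1.incl_or_elem hγ h'.1 h.2).resolve_right fun e => h'.2.not_fld ⟨_, e⟩)
  have hrun : Run AlgRule θ (sUn S) := Run.sUn hγ fun p hp => by
    obtain ⟨Z, -, h⟩ := (hS p).1 hp
    exact h.1
  obtain ⟨Z, hZ⟩ := H _ hrun
  obtain ⟨Z', hZ'⟩ := H _ (hrun.ins hZ)
  exact pr_not_elem Z (sUn S) (elem_sUn.2 ⟨_, (hS _).2 ⟨Z', elem_pow.2 hZ'.incl, hrun.ins hZ, hZ'⟩,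
    elem_ins.2 (Or.inr rfl)⟩)

/-- `Z` belongs to the algebra of subsets of `θ` generated by the basic operations. -/
def Alg (θ Z : M) : Prop := ∃ q : M, Run AlgRule θ q ∧ AlgRule θ q Z

instance Def.alg {f g : (ℕ → M) → M} [hf : DefFun A f] [hg : DefFun A g] :
    Def A fun v => Alg (f v) (g v) :=
  Def.rel₂ (by unfold Alg; infer_instance) hf hg

theorem alg_iff_fld (hp : Run AlgRule θ p) (ht : ∀ Z, ¬ AlgRule θ p Z) {Z : M} :
    Alg θ Z ↔ Fld p Z := by
  refine ⟨fun ⟨q, hq, hZ⟩ => ?_, fun ⟨q, hq⟩ => ⟨q, hp.of_elem hq⟩⟩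
  rcases hq.incl_or_elem (algRule_functional θ) hp hZ with h | h
  · by_cases h' : Incl q p
    · exact absurd (h.antisymm h' ▸ hZ) (ht Z)
    · obtain ⟨X, u, h1, h2, h3⟩ := hq.exists_first_diff hp h'
      obtain rfl : u = p := ext_elem fun t => ⟨fun e => ((h3 t).1 e).2, fun e => (h3 t).2 ⟨h t e, e⟩⟩
      exact absurd (hq.of_elem h1).2 (ht X)
  · exact ⟨q, h⟩

theorem alg_emp (θ : M) : Alg θ (emp M) :=
  ⟨emp M, ⟨fun _ h => absurd h (not_elem_emp _), fun _ _ h => absurd h (not_elem_emp _),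
    fun _ _ _ _ h => absurd h (not_elem_emp _)⟩, Or.inl ⟨rfl, rfl⟩⟩

theorem Alg.basic {X Y : M} (hX : Alg θ X) (hY : Alg θ Y) (i : Fin 7) :
    Alg θ (basic i θ X Y) := by
  obtain ⟨p, hp, ht⟩ := exists_terminal_run θ
  rw [alg_iff_fld hp ht] at *
  by_contra hn
  have hex : ∃ i : Fin 7, ∃ X Y : M, Cand i θ p X Y := ⟨i, X, Y, hX, hY, hn⟩
  obtain ⟨i, ⟨X, Y, hc⟩, hmin⟩ := wellFounded_lt.has_min {i : Fin 7 | ∃ X Y : M, Cand i θ p X Y} hex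
  obtain ⟨X, q, hq, ⟨Y, hXY⟩, hqm⟩ := hp.exists_least (fun X : M => ∃ Y : M, Cand i θ p X Y) hc.1 ⟨Y, hc⟩
  obtain ⟨Y, u, hu, hXY, hum⟩ := hp.exists_least (fun Y : M => Cand i θ p X Y) hXY.2.1 hXY
  refine ht _ (Or.inr ⟨fun e => not_elem_emp _ (e ▸ hq), i, fun ⟨j, hj, h⟩ => hmin j h hj, X, Y,
    ⟨q, hq, ⟨Y, hXY⟩, hqm⟩, ⟨u, hu, hXY, hum⟩, rfl⟩)

/-- On a reflecting level, the classes denoted by point-free terms belong to the algebra. -/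
theorem exists_alg_holds (hθ : Lev θ) (hpair : ∀ u v, u ε θ → v ε θ → pr u v ε θ) (τ : Op)
    (h : ∀ t, t ε θ → τ.Step t θ) : ∃ X, Alg θ X ∧ ∀ t, t ε X ↔ t ε θ ∧ τ.Holds t := by
  have left : ∀ {x s : M}, pr x s ε θ → x ε θ := fun e =>
    hθ.trans (hθ.trans e _ (elem_upair.2 (Or.inl rfl))) _ (elem_upair.2 (Or.inl rfl))
  have right : ∀ {x s : M}, pr x s ε θ → s ε θ := fun e =>
    hθ.trans (hθ.trans e _ (elem_upair.2 (Or.inr rfl))) _ (elem_upair.2 (Or.inr rfl))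
  induction τ with
  | bot => exact ⟨emp M, alg_emp θ, fun t => by simp [not_elem_emp, Op.Holds]⟩
  | mem => exact ⟨_, (alg_emp θ).basic (alg_emp θ) 0, fun t => elem_basic⟩
  | memSwap => exact ⟨_, (alg_emp θ).basic (alg_emp θ) 1, fun t => elem_basic⟩
  | eq => exact ⟨_, (alg_emp θ).basic (alg_emp θ) 2, fun t => elem_basic⟩
  | imp a b iha ihb =>
    obtain ⟨X, hX, hX'⟩ := iha fun t ht => (h t ht).1
    obtain ⟨Y, hY, hY'⟩ := ihb fun t ht => (h t ht).2
    refine ⟨_, hX.basic hY 3, fun t => elem_basic.trans (and_congr_right fun ht => ?_)⟩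
    simp [BasicHolds, Op.Holds, hX', hY', ht]
  | all a ih =>
    obtain ⟨X, hX, hX'⟩ := ih fun t ht => (h t ht).1
    refine ⟨_, hX.basic hX 4, fun t => elem_basic.trans (and_congr_right fun ht => ?_)⟩
    simp only [BasicHolds, Op.Holds, hX']
    refine ⟨fun hx => ?_, fun hx x hxθ => ⟨hpair _ _ hxθ ht, hx x⟩⟩
    by_contra hn
    obtain ⟨x, hxθ, hx'⟩ := (h t ht).2 (not_forall.1 hn)
    exact hx' (hx x hxθ).2
  | drop a ih =>
    obtain ⟨X, hX, hX'⟩ := ih h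
    refine ⟨_, hX.basic hX 5, fun t => elem_basic.trans (and_congr_right fun ht => ?_)⟩
    simp only [BasicHolds, Op.Holds, hX']
    refine exists_congr fun x => exists_congr fun s => and_congr_right fun e => ?_
    exact and_iff_right (right (e ▸ ht))
  | skip a ih =>
    obtain ⟨X, hX, hX'⟩ := ih h
    refine ⟨_, hX.basic hX 6, fun t => elem_basic.trans (and_congr_right fun ht => ?_)⟩
    simp only [BasicHolds, Op.Holds, hX']
    refine exists_congr fun x => exists_congr fun y => exists_congr fun s =>
      and_congr_right fun e => ?_
    subst e
    exact and_iff_right (hpair _ _ (left ht) (right (right ht)))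

end Algebra

/-! ### Algebraic elements are definable -/

section Separation

variable {M : Type u} [setLang.Structure M] {A B : Set M}

theorem Def.mono {P : (ℕ → M) → Prop} (h : Def A P) (hAB : A ⊆ B) : Def B P := by
  obtain ⟨φ, hφ⟩ := h
  refine ⟨φ.relabel (Sum.map (Set.inclusion hAB) id), fun v => ?_⟩
  rw [Formula.realize_relabel, ← hφ]
  exact iff_of_eq (_root_.congr rfl (funext fun i => by rcases i <;> rfl))

theorem Def.app {K : M → Prop} (h : Def (∅ : Set M) fun v => K (v 0)) {f : (ℕ → M) → M}
    [hf : DefFun A f] : Def A fun v => K (f v) :=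
  Def.rel₁ (h.mono (Set.empty_subset A)) hf

theorem Def.of_formula (φ : setLang.Formula (Fin 1)) :
    Def (∅ : Set M) fun v => φ.Realize ![v 0] := by
  refine ⟨φ.relabel fun i => Sum.inr i.1, fun v => ?_⟩
  rw [Formula.realize_relabel]
  exact iff_of_eq (_root_.congr rfl (funext fun i => by rw [Subsingleton.elim i 0]; rfl))

theorem Def.exists_formula {K : M → Prop} (h : Def (∅ : Set M) fun v => K (v 0)) :
    ∃ φ : setLang.Formula (Fin 1), ∀ b, φ.Realize ![b] ↔ K b := by
  obtain ⟨φ, hφ⟩ := h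
  refine ⟨φ.relabel (Sum.elim (fun a => a.2.elim) fun _ => 0), fun b => ?_⟩
  rw [Formula.realize_relabel]
  refine Iff.trans (iff_of_eq (_root_.congr rfl (funext fun i => ?_))) (hφ fun _ => b)
  rcases i with a | i
  · exact a.2.elim
  · rfl

/-- A finite class has a least definable subclass containing a given element. -/
theorem exists_least_def {c : M} (h : ∃ F : M → Prop, Def (∅ : Set M) (fun v => F (v 0)) ∧
    {x | F x}.Finite ∧ F c) :
    ∃ F : M → Prop, Def (∅ : Set M) (fun v => F (v 0)) ∧ F c ∧
      ∀ G : M → Prop, Def (∅ : Set M) (fun v => G (v 0)) → G c → ∀ x, F x → G x := by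
  obtain ⟨F, ⟨hF, hfin, hc⟩, hmin⟩ := (measure fun F : M → Prop => {x | F x}.ncard).wf.has_min
    {F | Def (∅ : Set M) (fun v => F (v 0)) ∧ {x | F x}.Finite ∧ F c} h
  refine ⟨F, hF, hc, fun G hG hGc x hx => ?_⟩
  by_contra hn
  refine hmin (fun x => F x ∧ G x) ⟨Def.and, hfin.subset fun _ hy => hy.1, hc, hGc⟩ ?_
  exact Set.ncard_lt_ncard (LE.le.ssubset_of_mem_notMem (a := x) (fun _ hy => hy.1) hx
    fun hy => hn hy.2) hfin

variable [M ⊨ ZF]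

theorem Def.exists_holds {K : M → Prop} (h : Def (∅ : Set M) fun v => K (v 0)) :
    ∃ τ : Op, ∀ x, τ.Holds (pr x (emp M)) ↔ K x := by
  obtain ⟨φ, hφ⟩ := h.exists_formula
  obtain ⟨τ, hτ⟩ := exists_op (M := M) (BoundedFormula.relabel (n := 1) Sum.inr φ)
  refine ⟨τ, fun x => ?_⟩
  rw [← hφ]
  exact (hτ ![x]).trans (Formula.realize_relabel_sumInr _)

/-- `a` and `b` belong to the same members of the algebras of the levels. -/
def Indisc (a b : M) : Prop :=
  ∀ θ X : M, Lev θ → Alg θ X → (pr a (emp M) ε X ↔ pr b (emp M) ε X)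

instance Def.indisc {f g : (ℕ → M) → M} [hf : DefFun A f] [hg : DefFun A g] :
    Def A fun v => Indisc (f v) (g v) :=
  Def.rel₂ (by unfold Indisc; infer_instance) hf hg

theorem Indisc.iff {a b : M} (h : Indisc a b) {K : M → Prop}
    (hK : Def (∅ : Set M) fun v => K (v 0)) : K a ↔ K b := by
  obtain ⟨τ, hτ⟩ := hK.exists_holds
  obtain ⟨θ, hθ, hab, hpair, hstep⟩ :=
    exists_reflecting τ (upair (pr a (emp M)) (pr b (emp M)))
  obtain ⟨X, hX, hX'⟩ := exists_alg_holds hθ hpair τ hstep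
  have ha := hθ.trans hab _ (elem_upair.2 (Or.inl rfl))
  have hb := hθ.trans hab _ (elem_upair.2 (Or.inr rfl))
  have := h θ X hθ hX
  rwa [hX', hX', and_iff_right ha, and_iff_right hb, hτ, hτ] at this

/-- A definable class meeting the algebra of some level has a definable element. -/
theorem exists_definable_elem {K : M → Prop} (hK : Def (∅ : Set M) fun v => K (v 0))
    (h : ∃ θ, Lev θ ∧ ∃ X, Alg θ X ∧ K X) :
    ∃ X, K X ∧ DefFun (∅ : Set M) fun _ => X := by
  have iK : ∀ {A : Set M} {f : (ℕ → M) → M} [DefFun A f], Def A fun v => K (f v) := hK.app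
  obtain ⟨θ, ⟨hθ, ⟨X, hX, hKX⟩, hmin⟩, huniq⟩ :=
    exists_least_lev (fun θ : M => ∃ X : M, Alg θ X ∧ K X) h
  obtain ⟨p, hp, ht⟩ := exists_terminal_run θ
  obtain ⟨X, q, hXq, hKX, hleast⟩ := hp.exists_least K ((alg_iff_fld hp ht).1 hX) hKX
  obtain ⟨hq, hqX⟩ := hp.of_elem hXq
  let L : M → Prop := fun θ => Lev θ ∧ (∃ X : M, Alg θ X ∧ K X) ∧
    ∀ η : M, Lev η → (∃ X : M, Alg η X ∧ K X) → ¬ η ε θ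
  have iL : ∀ {A : Set M} {f : (ℕ → M) → M} [DefFun A f], Def A fun v => L (f v) :=
    fun {_ _} hf => Def.rel₁ (by unfold L; infer_instance) hf
  have iW : Def (∅ : Set M) fun v => ∃ θ : M, L θ ∧ ∃ q : M, Run AlgRule θ q ∧
    AlgRule θ q (v 0) ∧ K (v 0) ∧ ∀ Y u : M, pr Y u ε q → ¬ K Y := inferInstance
  refine ⟨X, hKX, ⟨iW.congr fun v => ?_⟩⟩
  constructor
  · rintro ⟨θ', hθ', q', hq', hqX', hK', hleast'⟩
    obtain rfl := huniq θ' hθ'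
    have hγ := algRule_functional θ'
    obtain rfl : q' = q :=
      ((hq.incl_or_elem hγ hq' hqX).resolve_right fun e => hleast' _ _ e hKX).antisymm
        ((hq'.incl_or_elem hγ hq hqX').resolve_right fun e => hleast _ _ e hK')
    exact hγ _ _ _ hq hqX' hqX
  · intro e
    exact ⟨θ, ⟨hθ, ⟨X, ⟨q, hq, hqX⟩, hKX⟩, hmin⟩, q, hq, e ▸ hqX, e ▸ hKX, hleast⟩

theorem defFun_of_not_indisc {c : M} (h : ∃ F : M → Prop, Def (∅ : Set M) (fun v => F (v 0)) ∧
    {x | F x}.Finite ∧ F c) (hc : ∀ d, Indisc c d → c = d) : DefFun (∅ : Set M) fun _ => c := by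
  obtain ⟨F, hF, hFc, hleast⟩ := exists_least_def h
  have iF : ∀ {A : Set M} {f : (ℕ → M) → M} [DefFun A f], Def A fun v => F (f v) := hF.app
  refine ⟨Def.congr (P := fun v => F (v 0)) fun v => ⟨fun hd => ?_, fun e => e ▸ hFc⟩⟩
  by_contra hne
  have hsep := mt (hc (v 0)) (Ne.symm hne)
  simp only [Indisc, not_forall] at hsep
  obtain ⟨θ, X, hθ, hX, hsep⟩ := hsep
  obtain ⟨X, ⟨x, y, hx, hy, hxX, hyX⟩, iX⟩ := exists_definable_elem
    (K := fun X : M => ∃ x y : M, F x ∧ F y ∧ pr x (emp M) ε X ∧ ¬ pr y (emp M) ε X)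
    inferInstance ⟨θ, hθ, X, hX, by grind⟩
  by_cases hcX : pr c (emp M) ε X
  · exact hyX (hleast (fun z : M => pr z (emp M) ε X) inferInstance hcX y hy)
  · exact hleast (fun z : M => ¬ pr z (emp M) ε X) inferInstance hcX x hx hxX

/-- In a pointwise algebraic model of ZF every element is definable. -/
theorem defFun_of_pointwise_algebraic (hM : ∀ c : M, ∃ F : M → Prop,
    Def (∅ : Set M) (fun v => F (v 0)) ∧ {x | F x}.Finite ∧ F c) (c : M) :
    DefFun (∅ : Set M) fun _ => c := by
  suffices H : ∀ a b : M, Indisc a b → a = b from defFun_of_not_indisc (hM c) (H c)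
  by_contra! H
  obtain ⟨a, ⟨b, hab, hne⟩, hmin⟩ :=
    exists_minimal_class (fun a : M => ∃ b : M, Indisc a b ∧ a ≠ b) H
  have hdef : ∀ c, c ε a → DefFun (∅ : Set M) fun _ => c := fun c hc =>
    defFun_of_not_indisc (hM c) fun d hd => by_contra fun hn => hmin c hc ⟨d, hd, hn⟩
  refine hne (ext_elem fun c => ⟨fun hc => ?_, fun hc => ?_⟩)
  · have := hdef c hc
    exact (hab.iff (K := fun x : M => c ε x) inferInstance).1 hc
  · obtain ⟨F, hF, hFc, hleast⟩ := exists_least_def (hM c)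
    have iF : ∀ {A : Set M} {f : (ℕ → M) → M} [DefFun A f], Def A fun v => F (f v) := hF.app
    obtain ⟨d, hd, hda⟩ :=
      (hab.iff (K := fun x : M => ∃ y : M, F y ∧ y ε x) inferInstance).2 ⟨c, hFc, hc⟩
    have := hdef d hda
    by_contra hca
    exact hleast (fun x : M => ¬ x = d) inferInstance (fun e => hca (e ▸ hda)) d hd rfl

end Separation

/-- A theory `T ⊇ ZF` has a pointwise algebraic model if and only if it has a pointwise
definable model. -/
theorem exists_pointwise_algebraic_model_iff_exists_pointwise_definable_model
    (T : setLang.Theory) (hT : ZF ⊆ T) :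
    (∃ (M : Type u) (_ : setLang.Structure M), M ⊨ T ∧
      ∀ a : M, ∃ φ : setLang.Formula (Fin 1),
        φ.Realize ![a] ∧ {b : M | φ.Realize ![b]}.Finite) ↔
    (∃ (M : Type u) (_ : setLang.Structure M), M ⊨ T ∧
      ∀ a : M, ∃ φ : setLang.Formula (Fin 1), ∀ b : M, φ.Realize ![b] ↔ b = a) := by
  constructor
  · rintro ⟨M, _, hM, h⟩
    have : M ⊨ ZF := Theory.Model.mono hM hT
    refine ⟨M, _, hM, fun a => Def.exists_formula (K := fun b => b = a)
      (defFun_of_pointwise_algebraic (fun c => ?_) a).out⟩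
    obtain ⟨φ, hφ, hfin⟩ := h c
    exact ⟨fun b => φ.Realize ![b], Def.of_formula φ, hfin, hφ⟩
  · rintro ⟨M, _, hM, h⟩
    refine ⟨M, _, hM, fun a => ?_⟩
    obtain ⟨φ, hφ⟩ := h a
    exact ⟨φ, (hφ a).2 rfl, (Set.finite_singleton a).subset fun b hb => (hφ b).1 hb⟩
end

section
/- Let L be a first-order language and M a nonempty L-structure. Suppose some L-formula in two free variables without parameters defines a linear order ≤ on M such that every nonempty subset of M that is definable with parameters from M has a ≤-least element. Then the set D of all elements of M that are definable in M without parameters is the underlying set of an elementary substructure of M; in particular, this substructure is pointwise definable. -/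
open FirstOrder Language

/-- A subset `S ⊆ M` is definable with parameters from `M`. -/
def DefinableWithParams {L : FirstOrder.Language} {M : Type*} [L.Structure M]
    (S : Set M) : Prop :=
  ∃ φ : L.Formula (M ⊕ Fin 1), S = {b : M | φ.Realize (Sum.elim id ![b])}

namespace FirstOrder.Language

variable {L : FirstOrder.Language} {M : Type*} [L.Structure M]

theorem isDefinableElement_iff_definable₁ {a : M} :
    IsDefinableElement (L := L) a ↔ (∅ : Set M).Definable₁ L {a} := by
  rw [Set.Definable₁, Set.empty_definable_iff]
  refine exists_congr fun φ => ⟨fun h => ?_, fun h b => ?_⟩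
  · ext v
    rw [← show ![v 0] = v from List.ofFn_inj.mp rfl]
    exact (h (v 0)).symm
  · exact (Set.ext_iff.mp h ![b]).symm

/-- Parameters definable without parameters can be eliminated. -/
theorem definable₁_setOf_snoc_mem {n : ℕ} {T : Set (Fin (n + 1) → M)}
    (hT : (∅ : Set M).Definable L T) {x : Fin n → M}
    (hx : ∀ i, IsDefinableElement (L := L) (x i)) :
    (∅ : Set M).Definable₁ L {b | (Fin.snoc x b : Fin (n + 1) → M) ∈ T} := by
  have hparam : (∅ : Set M).Definable L
      (⋂ i : Fin n, {w : Fin (n + 1) → M | w i.castSucc = x i}) :=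
    Set.definable_iInter_of_finite fun i =>
      (isDefinableElement_iff_definable₁.mp (hx i)).preimage_comp fun _ => i.castSucc
  unfold Set.Definable₁
  convert (hT.inter hparam).image_comp (fun _ : Fin 1 => Fin.last n) using 1
  ext v
  simp only [Set.mem_ofPred_eq, Set.mem_image, Set.mem_inter_iff, Set.mem_iInter]
  constructor
  · intro hv
    refine ⟨Fin.snoc x (v 0), ⟨hv, fun i => by simp⟩, ?_⟩
    funext j
    simp [Subsingleton.elim j 0]
  · rintro ⟨w, ⟨hw, hwx⟩, rfl⟩
    have : (Fin.snoc x (w (Fin.last n)) : Fin (n + 1) → M) = w := by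
      funext j
      refine Fin.lastCases ?_ (fun i => ?_) j <;> simp [hwx]
    simpa [this] using hw

theorem definableWithParams_of_definable₁ {S : Set M} (hS : (∅ : Set M).Definable₁ L S) :
    DefinableWithParams (L := L) S := by
  obtain ⟨φ, hφ⟩ := Set.empty_definable_iff.mp hS
  refine ⟨φ.relabel Sum.inr, ?_⟩
  ext b
  simpa [Formula.realize_relabel] using Set.ext_iff.mp hφ ![b]

/-- The least element of a definable set, for a definable antisymmetric relation, is definable. -/
theorem isDefinableElement_of_least (ρ : L.Formula (Fin 2))
    (hanti : ∀ a b : M, ρ.Realize ![a, b] → ρ.Realize ![b, a] → a = b)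
    {S : Set M} (hS : (∅ : Set M).Definable₁ L S) {a : M} (ha : a ∈ S)
    (hmin : ∀ b ∈ S, ρ.Realize ![a, b]) : IsDefinableElement (L := L) a := by
  have hρ : (∅ : Set M).Definable L {w : Fin 2 → M | ρ.Realize w} :=
    Set.empty_definable_iff.mpr ⟨ρ, rfl⟩
  have hbad := ((hS.preimage_comp fun _ => (1 : Fin 2)).sdiff hρ).image_comp
    (fun _ : Fin 1 => (0 : Fin 2))
  rw [isDefinableElement_iff_definable₁, Set.Definable₁]
  convert hS.sdiff hbad using 1
  ext v
  simp only [Set.mem_ofPred_eq, Set.mem_singleton_iff, Set.mem_sdiff, Set.mem_image,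
    Set.mem_preimage, Function.comp_apply, not_exists, not_and]
  constructor
  · rintro rfl
    refine ⟨ha, ?_⟩
    rintro w ⟨hw, hwρ⟩ rfl
    refine hwρ ?_
    rw [← show ![w 0, w 1] = w from List.ofFn_inj.mp rfl]
    exact hmin _ hw
  · rintro ⟨hv, hleast⟩
    refine hanti _ _ ?_ (hmin _ hv)
    by_contra hn
    refine hleast ![v 0, a] ⟨by simpa using ha, hn⟩ ?_
    funext j
    simp [Subsingleton.elim j 0]

/-- The substructure of all elements definable without parameters. -/
def definableElements (L : FirstOrder.Language) (M : Type*) [L.Structure M] :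
    L.Substructure M where
  carrier := {a | IsDefinableElement (L := L) a}
  fun_mem {n} f x hx := by
    have hT : (∅ : Set M).Definable L
        {w : Fin (n + 1) → M | Structure.funMap f (fun i => w i.castSucc) = w (Fin.last n)} :=
      Set.empty_definable_iff.mpr
        ⟨(Term.func f fun i => Term.var i.castSucc).equal (Term.var (Fin.last n)), by
          ext w; simp [Formula.realize_equal]⟩
    refine isDefinableElement_iff_definable₁.mpr ?_
    convert definable₁_setOf_snoc_mem hT hx using 1
    ext b
    simp [eq_comm]

end FirstOrder.Language

/-- If some parameter-free formula in two free variables defines a linear order on the nonempty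
structure `M` in which every nonempty subset of `M` definable with parameters has a least
element, then the set `D` of elements of `M` definable without parameters is the underlying set
of an elementary substructure of `M`; in particular, that substructure is pointwise definable. -/
theorem definable_elements_elementarySubstructure {L : FirstOrder.Language} {M : Type*}
    [L.Structure M] [Nonempty M] (ρ : L.Formula (Fin 2))
    (hlin : IsLinearOrder M (fun a b : M => ρ.Realize ![a, b]))
    (hleast : ∀ S : Set M, S.Nonempty → DefinableWithParams (L := L) S →
      ∃ a ∈ S, ∀ b ∈ S, ρ.Realize ![a, b]) :
    ∃ N : L.ElementarySubstructure M,
      (N : Set M) = {a : M | IsDefinableElement (L := L) a} ∧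
      ∀ a : N, ∃ φ : L.Formula (Fin 1), ∀ b : N, φ.Realize ![b] ↔ b = a := by
  let N : L.ElementarySubstructure M :=
    (definableElements L M).toElementarySubstructure fun n φ x a h => by
      have hT : (∅ : Set M).Definable L {w : Fin (n + 1) → M | φ.Realize default w} :=
        Set.empty_definable_iff.mpr ⟨φ.toFormula.relabel (Sum.elim Empty.elim id), by
          ext w
          simp only [Set.mem_ofPred_eq, Formula.realize_relabel, BoundedFormula.realize_toFormula]
          exact iff_of_eq (congrArg₂ _ (Subsingleton.elim _ _) rfl)⟩
      have hS := definable₁_setOf_snoc_mem hT fun i => (x i).2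
      obtain ⟨b, hb, hmin⟩ := hleast _ ⟨a, h⟩ (definableWithParams_of_definable₁ hS)
      exact ⟨⟨b, isDefinableElement_of_least ρ (fun _ _ => hlin.antisymm _ _) hS hb hmin⟩, hb⟩
  refine ⟨N, rfl, fun a => ?_⟩
  obtain ⟨φ, hφ⟩ := a.2
  refine ⟨φ, fun b => ?_⟩
  rw [← N.subtype.map_formula φ ![b], Subtype.ext_iff, ← hφ b]
  exact iff_of_eq (congrArg _ (List.ofFn_inj.mp rfl))
end
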